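/- Let G be a fork-free graph with odd girth at least 7 (i.e., G contains no triangle and no 5-cycle). Then χ(G) ≤ 3. -/

import Mathlib

open SimpleGraph

/-- The fork: `K_{1,4}` with two edges subdivided. Vertex 0 is the center,
adjacent to leaves 1, 2 and to 3, 5; paths 0-3-4 and 0-5-6. -/
def fork : SimpleGraph (Fin 7) :=
  SimpleGraph.fromEdgeSet {s(0, 1), s(0, 2), s(0, 3), s(0, 5), s(3, 4), s(5, 6)}

/-- A graph is fork-free if it has no induced subgraph isomorphic to the fork. -/
def ForkFree {V : Type} (G : SimpleGraph V) : Prop :=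
  IsEmpty (fork ↪g G)

/-- `c` describes a 5-cycle in `G`. -/
def IsC5 {V : Type} (G : SimpleGraph V) (c : Fin 5 → V) : Prop :=
  Function.Injective c ∧ ∀ i : Fin 5, G.Adj (c i) (c (i + 1))

/-- Distance from a vertex `u` to the 5-cycle `c`. -/
noncomputable def distC {V : Type} (G : SimpleGraph V) (c : Fin 5 → V) (u : V) : ℕ :=
  Finset.univ.inf' Finset.univ_nonempty fun i => G.dist u (c i)

structure Crit {V : Type} (G : SimpleGraph V) : Prop where
  tri : ∀ a b c, G.Adj a b → G.Adj b c → G.Adj a c → False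
  c5 : ∀ a b c d e, G.Adj a b → G.Adj b c → G.Adj c d → G.Adj d e → G.Adj e a → False
  fk : ∀ v a b c d x y, G.Adj v a → G.Adj v b → G.Adj v c → G.Adj v d → c ≠ d →
    G.Adj a x → G.Adj b y → ¬ G.Adj x b → ¬ G.Adj x c → ¬ G.Adj x d →
    ¬ G.Adj y a → ¬ G.Adj y c → ¬ G.Adj y d → False
  ncol : ∀ φ : V → Fin 3, (∀ a b, G.Adj a b → φ a ≠ φ b) → False
  crit : ∀ v, ∃ φ : V → Fin 3, ∀ a b, a ≠ v → b ≠ v → G.Adj a b → φ a ≠ φ b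

/-- `φ` is a proper coloring away from the hole `w`. -/
def St {V : Type} (G : SimpleGraph V) (φ : V → Fin 3) (w : V) : Prop :=
  ∀ a b, a ≠ w → b ≠ w → G.Adj a b → φ a ≠ φ b

/-- degree exactly three (given minimum degree three) -/
def Low {V : Type} (G : SimpleGraph V) (u : V) : Prop :=
  ∃ a b c, ∀ x, G.Adj u x ↔ x = a ∨ x = b ∨ x = c

theorem third (a b : Fin 3) : ∃ c, c ≠ a ∧ c ≠ b := by
  revert a b; decide

theorem fin3_cov (a b c d : Fin 3) (h1 : a ≠ b) (h2 : a ≠ c) (h3 : b ≠ c) : d = a ∨ d = b ∨ d = c := by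
  revert a b c d; decide

namespace Crit
variable {V : Type} {G : SimpleGraph V}

theorem inc (H : Crit G) (u v : V) (h : u ≠ v) : ∃ x, G.Adj u x ∧ ¬ G.Adj v x := by
  by_contra hc
  push Not at hc
  obtain ⟨φ, hφ⟩ := H.crit u
  classical
  refine H.ncol (fun x => if x = u then φ v else φ x) ?_
  intro a b hab
  have h3 := hab.symm
  have h1 := hc a
  have h2 := hc b
  have : ¬ G.Adj v v := G.irrefl
  have h4 := hφ a b
  have h5 := hφ v b
  have h6 := hφ a v
  have h7 : ∀ x, G.Adj v x → G.Adj x v := fun x hx => hx.symm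
  have h8 : ¬ G.Adj u u := G.irrefl
  grind

theorem deg3 (H : Crit G) (u x y : V) : ∃ z, G.Adj u z ∧ z ≠ x ∧ z ≠ y := by
  by_contra hc
  push Not at hc
  obtain ⟨φ, hφ⟩ := H.crit u
  classical
  obtain ⟨c, hcx, hcy⟩ := third (φ x) (φ y)
  refine H.ncol (fun z => if z = u then c else φ z) ?_
  intro a b hab
  have h3 := hab.symm
  have h1 := hc a
  have h2 := hc b
  have h4 := hφ a b
  have h8 : ¬ G.Adj u u := G.irrefl
  have h1' : ∀ z, G.Adj u z → z = x ∨ z = y := fun z hz => by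
    by_cases h : z = x
    · exact Or.inl h
    · exact Or.inr (hc z hz h)
  have := h1' a
  have := h1' b
  clear h1 h2 hc
  grind

theorem nadj_of_common (H : Crit G) {a b c : V} (h1 : G.Adj a b) (h2 : G.Adj a c) : ¬ G.Adj b c :=
  fun h => H.tri a b c h1 h h2

end Crit

theorem high4 {V : Type} {G : SimpleGraph V} {u a b c : V} (h : ¬ Low G u) (ha : G.Adj u a) (hb : G.Adj u b)
    (hc : G.Adj u c) : ∃ d, G.Adj u d ∧ d ≠ a ∧ d ≠ b ∧ d ≠ c := by
  by_contra hn
  push Not at hn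
  exact h ⟨a, b, c, fun x => ⟨fun hx => by have := hn x hx; tauto, by rintro (rfl | rfl | rfl) <;> assumption⟩⟩

/-- hole at the low vertex `w` with neighbours `p1 p2 p3`. -/
structure LS {V : Type} (G : SimpleGraph V) (φ : V → Fin 3) (w p1 p2 p3 : V) : Prop where
  st : St G φ w
  nb : ∀ x, G.Adj w x ↔ x = p1 ∨ x = p2 ∨ x = p3
  n12 : φ p1 ≠ φ p2
  n13 : φ p1 ≠ φ p3
  n23 : φ p2 ≠ φ p3

namespace LS
variable {V : Type} {G : SimpleGraph V} {φ : V → Fin 3} {w p1 p2 p3 : V}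
theorem rot (h : LS G φ w p1 p2 p3) : LS G φ w p2 p3 p1 :=
  ⟨h.st, fun x => by rw [h.nb]; tauto, h.n23, h.n12.symm, h.n13.symm⟩
theorem sw23 (h : LS G φ w p1 p2 p3) : LS G φ w p1 p3 p2 :=
  ⟨h.st, fun x => by rw [h.nb]; tauto, h.n13, h.n12, h.n23.symm⟩
theorem sw12 (h : LS G φ w p1 p2 p3) : LS G φ w p2 p1 p3 :=
  ⟨h.st, fun x => by rw [h.nb]; tauto, h.n12.symm, h.n23, h.n13⟩
theorem a1 (h : LS G φ w p1 p2 p3) : G.Adj w p1 := (h.nb p1).2 (by simp)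
theorem a2 (h : LS G φ w p1 p2 p3) : G.Adj w p2 := (h.nb p2).2 (by simp)
theorem a3 (h : LS G φ w p1 p2 p3) : G.Adj w p3 := (h.nb p3).2 (by simp)
theorem cov (h : LS G φ w p1 p2 p3) (c : Fin 3) : c = φ p1 ∨ c = φ p2 ∨ c = φ p3 :=
  fin3_cov _ _ _ _ h.n12 h.n13 h.n23
end LS

theorem exLS {V : Type} {G : SimpleGraph V} (H : Crit G) {w p1 p2 p3 : V}
    (nb : ∀ x, G.Adj w x ↔ x = p1 ∨ x = p2 ∨ x = p3) {φ : V → Fin 3} (hφ : St G φ w) : LS G φ w p1 p2 p3 := by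
  classical
  have key : ∀ c, φ p1 ≠ c → φ p2 ≠ c → φ p3 ≠ c → False := by
    intro c h1 h2 h3
    refine H.ncol (fun z => if z = w then c else φ z) ?_
    intro a b hab
    have h5 := hab.symm
    have h6 := (nb a).1
    have h7 := (nb b).1
    have h4 := hφ a b
    have h8 : ¬ G.Adj w w := G.irrefl
    grind
  refine ⟨hφ, nb, ?_, ?_, ?_⟩
  · intro h
    obtain ⟨c, h1, h2⟩ := third (φ p1) (φ p3)
    exact key c h1.symm (h ▸ h1.symm) h2.symm
  · intro h
    obtain ⟨c, h1, h2⟩ := third (φ p1) (φ p2)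
    exact key c h1.symm h2.symm (h ▸ h1.symm)
  · intro h
    obtain ⟨c, h1, h2⟩ := third (φ p1) (φ p2)
    exact key c h1.symm h2.symm (h ▸ h2.symm)

/-- recoloring -/
theorem recol {V : Type} {G : SimpleGraph V} (H : Crit G) {φ : V → Fin 3} {w : V} (hφ : St G φ w) (ψ : V → Fin 3)
    (h : ∀ a, (a = w ∨ ψ a ≠ φ a) → ∀ b, G.Adj a b → ψ a ≠ ψ b) : False := by
  refine H.ncol ψ fun a b hab => ?_
  by_cases h1 : a = w ∨ ψ a ≠ φ a
  · exact h a h1 b hab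
  · by_cases h2 : b = w ∨ ψ b ≠ φ b
    · exact (h b h2 a hab.symm).symm
    · have := hφ a b
      grind

/-- two traces: fork with both path middles given -/
theorem T2 {V : Type} {G : SimpleGraph V} (H : Crit G) {v a b c d x y : V} (va : G.Adj v a) (vb : G.Adj v b) (vc : G.Adj v c)
    (vd : G.Adj v d) (cd : c ≠ d) (ax : G.Adj a x) (yb : G.Adj b y) (xb : ¬ G.Adj b x) (xc : ¬ G.Adj c x)
    (xd : ¬ G.Adj d x) (ya : ¬ G.Adj a y) (yc : ¬ G.Adj c y) (yd : ¬ G.Adj d y) : False :=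
  H.fk v a b c d x y va vb vc vd cd ax yb (fun h => xb h.symm) (fun h => xc h.symm) (fun h => xd h.symm)
    (fun h => ya h.symm) (fun h => yc h.symm) (fun h => yd h.symm)


/-- the disjunctive form of fork-freeness -/
theorem Crit.F {V : Type} {G : SimpleGraph V} (H : Crit G) (v a x b y c d : V) :
    ¬ G.Adj v a ∨ ¬ G.Adj a x ∨ ¬ G.Adj v b ∨ ¬ G.Adj b y ∨ ¬ G.Adj v c ∨ ¬ G.Adj v d ∨ c = d ∨
    G.Adj b x ∨ G.Adj c x ∨ G.Adj d x ∨ G.Adj a y ∨ G.Adj c y ∨ G.Adj d y := by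
  by_contra hc
  push Not at hc
  obtain ⟨h1, h2, h3, h4, h5, h6, h7, h8, h9, h10, h11, h12, h13⟩ := hc
  exact T2 H h1 h3 h5 h6 h7 h2 h4 h8 h9 h10 h11 h12 h13

theorem Crit.triD {V : Type} {G : SimpleGraph V} (H : Crit G) : ∀ a b c, ¬ G.Adj a b ∨ ¬ G.Adj b c ∨ ¬ G.Adj a c := by
  intro a b c
  by_contra hc
  push Not at hc
  exact H.tri a b c hc.1 hc.2.1 hc.2.2

theorem St.D {V : Type} {G : SimpleGraph V} {φ : V → Fin 3} {w : V} (h : St G φ w) :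
    ∀ a b, a = w ∨ b = w ∨ ¬ G.Adj a b ∨ φ a ≠ φ b := by
  intro a b
  by_contra hc
  push Not at hc
  exact h a b hc.1 hc.2.1 hc.2.2.1 hc.2.2.2

theorem Crit.ctx {V : Type} {G : SimpleGraph V} (H : Crit G) :
    (∀ a b, G.Adj a b → G.Adj b a) ∧ (∀ a b c, G.Adj a b → G.Adj b c → ¬ G.Adj a c) ∧ (∀ a, ¬ G.Adj a a) :=
  ⟨fun _ _ h => h.symm, fun a b c h1 h2 h3 => H.tri a b c h1 h2 h3, fun _ => G.irrefl⟩

theorem LS.ctx {V : Type} {G : SimpleGraph V} (H : Crit G) {φ : V → Fin 3} {w p1 p2 p3 : V} (S : LS G φ w p1 p2 p3) :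
    (∀ a b, a = w ∨ b = w ∨ ¬ G.Adj a b ∨ φ a ≠ φ b) ∧ (∀ x, G.Adj w x ↔ x = p1 ∨ x = p2 ∨ x = p3) ∧
    G.Adj w p1 ∧ G.Adj w p2 ∧ G.Adj w p3 ∧ φ p1 ≠ φ p2 ∧ φ p1 ≠ φ p3 ∧ φ p2 ≠ φ p3 ∧
    (∀ x, φ x = φ p1 ∨ φ x = φ p2 ∨ φ x = φ p3) ∧ ¬ G.Adj p1 p2 ∧ ¬ G.Adj p1 p3 ∧ ¬ G.Adj p2 p3 :=
  ⟨S.st.D, S.nb, S.a1, S.a2, S.a3, S.n12, S.n13, S.n23, fun _ => S.cov _,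
    H.nadj_of_common S.a1 S.a2, H.nadj_of_common S.a1 S.a3, H.nadj_of_common S.a2 S.a3⟩

theorem lemA {V : Type} {G : SimpleGraph V} (H : Crit G) {φ : V → Fin 3} {w p1 p2 p3 : V} (S : LS G φ w p1 p2 p3)
    {f f' : V} (hf : G.Adj p1 f) (hf' : G.Adj p1 f') (hw : f ≠ w) (hw' : f' ≠ w) (hne : f ≠ f')
    (cf : φ f = φ p3) (cf' : φ f' = φ p3) : ∃ x, x ≠ w ∧ G.Adj p1 x ∧ G.Adj p3 x := by
  classical
  by_contra hc
  push Not at hc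
  have nb := S.nb
  have st := S.st.D
  have := S.a1
  have := S.a2
  have := S.a3
  have := S.n12
  have := S.n13
  have := S.n23
  have sy := G.adj_comm
  have tri := H.triD
  have ir : ∀ a, ¬ G.Adj a a := fun a => G.irrefl
  have key : ∀ b y, G.Adj p1 b → φ b = φ p2 → b ≠ w → G.Adj b y → φ y ≠ φ p3 := by
    intro b y h1 h2 h3 h4 h5
    have := H.F p1 w p3 b y f f'
    grind
  refine recol H S.st (fun z => if z = w then φ p1 else if z = p1 then φ p2 else if G.Adj p1 z ∧ φ z = φ p2 then φ p3 else φ z) ?_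
  intro a ha b hab
  grind

set_option linter.unusedVariables false
theorem y2step {V : Type} {G : SimpleGraph V} (H : Crit G) {φ : V → Fin 3} {w p1 p2 p3 : V} (S : LS G φ w p1 p2 p3)
    {f f' b : V} (hf : G.Adj p1 f) (hf' : G.Adj p1 f') (hw : f ≠ w) (hw' : f' ≠ w) (hne : f ≠ f')
    (cf : φ f = φ p3) (cf' : φ f' = φ p3) (hb : G.Adj p1 b) (hb3 : G.Adj p3 b) (hbw : b ≠ w)
    (h3 : ∀ x, G.Adj p1 x → G.Adj p2 x → x = w) :
    (∀ y, G.Adj b y → φ y = φ p3 → y = p3) ∧ ∃ b', b' ≠ b ∧ b' ≠ w ∧ G.Adj p3 b' ∧ φ b' = φ p2 := by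
  classical
  obtain ⟨sy, -, ir⟩ := H.ctx
  obtain ⟨st, nb, a1, a2, a3, n12, n13, n23, cov, m12, m13, m23⟩ := S.ctx H
  have k1 : ∀ y, G.Adj b y → φ y = φ p3 → y = p3 := by
    intro y hy cy
    have := H.F p1 w p2 b y f f'
    grind
  refine ⟨k1, ?_⟩
  by_contra hc
  push Not at hc
  refine recol H S.st (fun z => if z = w then φ p3 else if z = p3 then φ p2 else if z = b then φ p3 else φ z) ?_
  intro a ha c hac
  grind

theorem y2 {V : Type} {G : SimpleGraph V} (H : Crit G) {φ : V → Fin 3} {w p1 p2 p3 : V} (S : LS G φ w p1 p2 p3)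
    {f f' b : V} (hf : G.Adj p1 f) (hf' : G.Adj p1 f') (hw : f ≠ w) (hw' : f' ≠ w) (hne : f ≠ f')
    (cf : φ f = φ p3) (cf' : φ f' = φ p3) (hb : G.Adj p1 b) (hb3 : G.Adj p3 b) (hbw : b ≠ w)
    (h3 : ∀ x, G.Adj p1 x → G.Adj p2 x → x = w) (hb1 : ∀ x, G.Adj p1 x → x ≠ w → φ x = φ p2 → x = b) : False := by
  classical
  obtain ⟨sy, -, ir⟩ := H.ctx
  obtain ⟨st, nb, a1, a2, a3, n12, n13, n23, cov, m12, m13, m23⟩ := S.ctx H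
  obtain ⟨k1, b', q1, q2, q3, q4⟩ := y2step H S hf hf' hw hw' hne cf cf' hb hb3 hbw h3
  have cb : φ b = φ p2 := by grind
  obtain ⟨a, aw, ap3, ap2⟩ := lemA H S.rot.rot hb3 q3 hbw q2 (Ne.symm q1) cb q4
  have ca : φ a = φ p1 := by grind
  have star : ∀ s, G.Adj p3 s → s = w ∨ s = b ∨ s = b' ∨ G.Adj p2 s := by
    intro s hs
    have := H.F p3 b p1 a p2 s b'
    grind
  have u2 : ∀ s, G.Adj p2 s → s ≠ w → φ s = φ p1 → s = a := by
    intro s h1 h2 h4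
    by_contra h5
    obtain ⟨x, hx⟩ := lemA H S.rot h1 ap2 h2 aw h5 h4 ca
    grind
  by_cases low : Low G p2
  swap
  · obtain ⟨g, g1, g2, g3, -⟩ := high4 low a2.symm ap2 ap2
    obtain ⟨g', g1', g2', g3', g4⟩ := high4 low a2.symm ap2 g1
    obtain ⟨-, b'', r⟩ := y2step H S.sw12 g1 g1' g2 g2' (Ne.symm g4) (by grind) (by grind) ap2 ap3 aw (by grind)
    grind
  obtain ⟨h, h1, h2, h4⟩ := H.deg3 p2 w a
  have nb2 : ∀ x, G.Adj p2 x ↔ x = w ∨ x = a ∨ x = h := by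
    obtain ⟨u, v, z, hz⟩ := low
    intro x
    have := hz x
    have := hz w
    have := hz a
    have := hz h
    grind
  have ch : φ h = φ p3 := by grind
  clear low
  obtain ⟨x, x1, x2, x3⟩ : ∃ x, G.Adj a x ∧ x ≠ p2 ∧ φ x = φ p2 := by
    by_contra hc
    push Not at hc
    refine recol H S.st (fun z => if z = w then φ p2 else if z = p2 then φ p1 else if z = a then φ p2 else φ z) ?_
    intro a ha c hac
    grind
  obtain ⟨k, y1, y2, y3⟩ : ∃ x, G.Adj a x ∧ x ≠ p3 ∧ φ x = φ p3 := by
    by_contra hc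
    push Not at hc
    refine recol H S.st (fun z => if z = w then φ p3 else if z = p3 then φ p1 else if z = a then φ p3 else φ z) ?_
    intro a ha c hac
    grind
  have e1 : ∀ x, G.Adj a x → x ≠ p2 → φ x = φ p2 → G.Adj h x := by
    intro x x1 x2 x3
    have := H.F a p2 h p3 b x k
    grind
  have e2 : ∀ x z, G.Adj a x → x ≠ p2 → φ x = φ p2 → G.Adj x z → z = a ∨ z = h ∨ G.Adj k z := by
    intro x z x1 x2 x3 xz
    have zw : z ≠ w := by grind
    have c1 := star z
    have c2 := u2 z
    have c3 := nb2 z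
    have c4 := k1 k
    clear star u2 k1 h3 hb1 cf cf' hne hw hw' q3 hb hf hf' e1
    have := H.F a p3 b x z p2 k
    grind
  obtain ⟨g, g1, g2, g3, g4⟩ : ∃ g, G.Adj h g ∧ g ≠ p2 ∧ φ g = φ p2 ∧ ¬ G.Adj a g := by
    by_contra hc
    push Not at hc
    refine recol H S.st (fun z => if z = w then φ p2 else if z = p2 then φ p3 else if z = h then φ p2 else if
      G.Adj a z ∧ φ z = φ p2 then φ p3 else φ z) ?_
    intro a ha c hac
    grind
  have S' : St G (fun z => if z = w then φ p2 else φ z) p2 := by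
    intro a b
    have := st a b
    have := nb a
    have := nb b
    grind
  have S2 := exLS H (fun x => by rw [nb2 x]; tauto : ∀ x, G.Adj p2 x ↔ x = h ∨ x = a ∨ x = w) S'
  obtain ⟨t, t1, t2, t3⟩ := lemA H S2 (e1 x x1 x2 x3) g1 x2 g2 (by rintro rfl; exact g4 x1) (by grind) (by grind)
  grind

set_option linter.unusedVariables false
theorem good0 {V : Type} {G : SimpleGraph V} (H : Crit G) {φ : V → Fin 3} {w p1 p2 p3 : V} (S : LS G φ w p1 p2 p3)
    {f f' : V} (hf : G.Adj p1 f) (hf' : G.Adj p1 f') (hw : f ≠ w) (hw' : f' ≠ w) (hne : f ≠ f')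
    (cf : φ f = φ p3) (cf' : φ f' = φ p3) :
    (∃ x, x ≠ w ∧ G.Adj p1 x ∧ G.Adj p3 x) ∧ (∃ x, x ≠ w ∧ G.Adj p1 x ∧ G.Adj p2 x) := by
  obtain ⟨sy, -, ir⟩ := H.ctx
  obtain ⟨st, nb, a1, a2, a3, n12, n13, n23, cov, m12, m13, m23⟩ := S.ctx H
  obtain ⟨b, hbw, hb1, hb3⟩ := lemA H S hf hf' hw hw' hne cf cf'
  refine ⟨⟨b, hbw, hb1, hb3⟩, ?_⟩
  by_contra hc
  push Not at hc
  by_cases hd : ∀ x, G.Adj p1 x → x ≠ w → φ x = φ p2 → x = b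
  · exact y2 H S hf hf' hw hw' hne cf cf' hb1 hb3 hbw (by grind) hd
  · push Not at hd
    obtain ⟨x, x1, x2, x3, x4⟩ := hd
    obtain ⟨z, z1, z2, z3⟩ := lemA H S.sw23 x1 hb1 x2 hbw x4 x3 (by grind)
    grind

theorem good {V : Type} {G : SimpleGraph V} (H : Crit G) {φ : V → Fin 3} {w p1 p2 p3 : V} (S : LS G φ w p1 p2 p3)
    (hi : ¬ Low G p1) :
    ∃ b c, b ≠ w ∧ c ≠ w ∧ G.Adj p1 b ∧ G.Adj p3 b ∧ G.Adj p1 c ∧ G.Adj p2 c ∧ φ b = φ p2 ∧ φ c = φ p3 ∧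
      ∀ q q', G.Adj p1 q → G.Adj p1 q' → ¬ G.Adj p2 q → ¬ G.Adj p2 q' → ¬ G.Adj p3 q → ¬ G.Adj p3 q' → q = q' := by
  obtain ⟨sy, -, ir⟩ := H.ctx
  obtain ⟨st, nb, a1, a2, a3, n12, n13, n23, cov, m12, m13, m23⟩ := S.ctx H
  have main : (∃ x, x ≠ w ∧ G.Adj p1 x ∧ G.Adj p3 x) ∧ (∃ x, x ≠ w ∧ G.Adj p1 x ∧ G.Adj p2 x) := by
    obtain ⟨x, x1, x2, -⟩ := H.deg3 p1 w w
    obtain ⟨y, y1, y2, y3⟩ := H.deg3 p1 w x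
    obtain ⟨z, z1, z2, z3, z4⟩ := high4 hi a1.symm x1 y1
    have g1 : ∀ f f', G.Adj p1 f → G.Adj p1 f' → f ≠ w → f' ≠ w → f ≠ f' → φ f = φ f' →
        (∃ x, x ≠ w ∧ G.Adj p1 x ∧ G.Adj p3 x) ∧ (∃ x, x ≠ w ∧ G.Adj p1 x ∧ G.Adj p2 x) := by
      intro f f' h1 h2 h3 h4 h5 h6
      have : φ f = φ p2 ∨ φ f = φ p3 := by grind
      rcases this with h | h
      · exact (good0 H S.sw23 h1 h2 h3 h4 h5 h (by rw [← h6, h])).symm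
      · exact (good0 H S h1 h2 h3 h4 h5 h (by rw [← h6, h]))
    have : φ x = φ y ∨ φ x = φ z ∨ φ y = φ z := by grind
    rcases this with h | h | h
    · exact g1 _ _ x1 y1 x2 y2 y3.symm h
    · exact g1 _ _ x1 z1 x2 z2 z3.symm h
    · exact g1 _ _ y1 z1 y2 z2 z4.symm h
  obtain ⟨⟨b, b1, b2, b3⟩, c, c1, c2, c3⟩ := main
  have cb : φ b = φ p2 := by grind
  have cc : φ c = φ p3 := by grind
  refine ⟨b, c, b1, c1, b2, b3, c2, c3, cb, cc, ?_⟩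
  intro q q' q1 q2 q3 q4 q5 q6
  have := H.F p1 b p3 c p2 q q'
  grind

set_option linter.unusedVariables false

/-- the private neighbour of `p i` -/
def QQ {V : Type} (G : SimpleGraph V) (w : V) (p o : Fin 3 → V) (i : Fin 3) (q : V) : Prop :=
  G.Adj (p i) q ∧ q ≠ w ∧ ∀ j, q ≠ o j

/-- outer neighbours of `o i` -/
def RR {V : Type} (G : SimpleGraph V) (p o : Fin 3 → V) (i : Fin 3) (q : V) : Prop :=
  G.Adj (o i) q ∧ ∀ j, q ≠ p j

structure CB {V : Type} (G : SimpleGraph V) (φ : V → Fin 3) (w : V) (p o : Fin 3 → V) : Prop where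
  st : St G φ w
  nbw : ∀ x, G.Adj w x ↔ ∃ i, x = p i
  cp : ∀ i, φ (p i) = i
  co : ∀ i, φ (o i) = i
  ow : ∀ i, o i ≠ w
  po : ∀ i j, i ≠ j → G.Adj (p i) (o j)
  cm : ∀ i j x, i ≠ j → G.Adj (p i) x → G.Adj (p j) x → x = w ∨ ∃ k, x = o k
  star : ∀ i q q', QQ G w p o i q → QQ G w p o i q' → q = q'

def Inn {V : Type} (G : SimpleGraph V) (w : V) (p o : Fin 3 → V) (q : V) : Prop :=
  ∃ i, QQ G w p o i q ∧ ∀ x, G.Adj q x → x = p i ∨ ∃ j, RR G p o j x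

/-- colour `d` is admissible for the vertex `x` -/
def OKc {V : Type} (G : SimpleGraph V) (φ : V → Fin 3) (w : V) (p o : Fin 3 → V) (x : V) (d : Fin 3) : Prop :=
  ∀ n, G.Adj x n → (∃ m, n = o m) ∨ Inn G w p o n ∨ φ n ≠ d

theorem fin3_all {i j k : Fin 3} (h1 : i ≠ j) (h2 : i ≠ k) (h3 : j ≠ k) (m : Fin 3) : m = i ∨ m = j ∨ m = k := by
  revert i j k m; decide

theorem fin3_ex (i : Fin 3) : ∃ j k : Fin 3, i ≠ j ∧ i ≠ k ∧ j ≠ k := by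
  revert i; decide

theorem fin3_ex2 {i j : Fin 3} (h : i ≠ j) : ∃ k : Fin 3, i ≠ k ∧ j ≠ k := by
  revert i j; decide

namespace CB
variable {V : Type} {G : SimpleGraph V} {φ : V → Fin 3} {w : V} {p o : Fin 3 → V}

theorem wp (h : CB G φ w p o) (i : Fin 3) : G.Adj w (p i) := (h.nbw _).2 ⟨i, rfl⟩

theorem pp (h : CB G φ w p o) (H : Crit G) (i j : Fin 3) : ¬ G.Adj (p i) (p j) := H.nadj_of_common (h.wp i) (h.wp j)

theorem oo (h : CB G φ w p o) (H : Crit G) (i j : Fin 3) : ¬ G.Adj (o i) (o j) := by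
  obtain ⟨k, h1, h2⟩ : ∃ k : Fin 3, k ≠ i ∧ k ≠ j := by revert i j; decide
  exact H.nadj_of_common (h.po k i h1) (h.po k j h2)

theorem wo (h : CB G φ w p o) (H : Crit G) (i : Fin 3) : ¬ G.Adj w (o i) := by
  obtain ⟨k, h1⟩ : ∃ k : Fin 3, k ≠ i := by revert i; decide
  exact H.nadj_of_common (h.wp k).symm (h.po k i h1)

theorem po' (h : CB G φ w p o) (i : Fin 3) : ¬ G.Adj (p i) (o i) := by
  intro h'
  exact h.st _ _ (fun e => G.irrefl (v := w) (by have := h.wp i; rwa [e] at this)) (h.ow i) h' (by rw [h.cp, h.co])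

theorem pw (h : CB G φ w p o) (i : Fin 3) : p i ≠ w := by
  intro e
  have := h.wp i
  rw [e] at this
  exact G.irrefl this

theorem opne (h : CB G φ w p o) (H : Crit G) (i j : Fin 3) : o i ≠ p j := by
  intro e
  have := h.wo H i
  rw [e] at this
  exact this (h.wp j)

theorem np (h : CB G φ w p o) (i j k : Fin 3) (h1 : i ≠ j) (h2 : i ≠ k) (h3 : j ≠ k) (x : V) :
    G.Adj (p i) x ↔ x = w ∨ x = o j ∨ x = o k ∨ QQ G w p o i x := by
  have := fin3_all h1 h2 h3
  have h4 := h.po i j h1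
  have h5 := h.po i k h2
  have h6 := (h.wp i).symm
  have h7 := h.po' i
  unfold QQ
  constructor
  · intro hx
    by_cases c1 : x = w
    · exact Or.inl c1
    by_cases c2 : x = o j
    · exact Or.inr (Or.inl c2)
    by_cases c3 : x = o k
    · exact Or.inr (Or.inr (Or.inl c3))
    refine Or.inr (Or.inr (Or.inr ⟨hx, c1, fun m => ?_⟩))
    rcases this m with rfl | rfl | rfl
    · rintro rfl; exact h7 hx
    · exact c2
    · exact c3
  · rintro (rfl | rfl | rfl | ⟨hx, -⟩) <;> assumption

theorem no (h : CB G φ w p o) (i j k : Fin 3) (h1 : i ≠ j) (h2 : i ≠ k) (h3 : j ≠ k) (x : V) :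
    G.Adj (o i) x ↔ x = p j ∨ x = p k ∨ RR G p o i x := by
  have := fin3_all h1 h2 h3
  have h4 := (h.po j i h1.symm).symm
  have h5 := (h.po k i h2.symm).symm
  have h7 := h.po' i
  unfold RR
  constructor
  · intro hx
    by_cases c2 : x = p j
    · exact (Or.inl c2)
    by_cases c3 : x = p k
    · exact (Or.inr (Or.inl c3))
    refine (Or.inr (Or.inr ⟨hx, fun m => ?_⟩))
    rcases this m with rfl | rfl | rfl
    · rintro rfl; exact h7 hx.symm
    · exact c2
    · exact c3
  · rintro (rfl | rfl | ⟨hx, -⟩) <;> assumption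

theorem Rc (h : CB G φ w p o) (H : Crit G) {i : Fin 3} {x : V} (hx : RR G p o i x) : x ≠ w ∧ (∀ m, x ≠ p m) ∧ (∀ m, x ≠ o m) ∧
    ¬ G.Adj x w ∧ φ x ≠ i ∧ ∀ m, ¬ G.Adj x (p m) := by
  have e1 : x ≠ w := by rintro rfl; exact h.wo H i hx.1.symm
  have e3 : ∀ m, x ≠ o m := by rintro m rfl; exact h.oo H _ _ hx.1
  have e4 : ¬ G.Adj x w := by
    intro h'
    obtain ⟨m, hm⟩ := (h.nbw x).1 h'.symm
    exact hx.2 m hm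
  refine ⟨e1, hx.2, e3, e4, ?_, ?_⟩
  · have := h.st _ _ (h.ow i) e1 hx.1
    rw [h.co] at this
    exact this.symm
  · intro m hm
    by_cases hmi : m = i
    · subst hmi
      obtain ⟨j, k, h1, h2, h3⟩ := fin3_ex m
      exact H.c5 _ _ _ _ _ hm (h.wp m).symm (h.wp j) (h.po j m h1.symm) hx.1
    · exact H.tri _ _ _ hx.1 hm (h.po m i hmi).symm

theorem RRn (h : CB G φ w p o) (H : Crit G) {i j : Fin 3} {x y : V} (hx : RR G p o i x) (hy : RR G p o j y) : ¬ G.Adj x y := by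
  intro hxy
  by_cases hij : i = j
  · subst hij
    exact H.tri _ _ _ hx.1 hxy hy.1
  · obtain ⟨k, h1, h2⟩ := fin3_ex2 hij
    exact H.c5 _ _ _ _ _ hxy hy.1.symm (h.po k j h2.symm).symm (h.po k i h1.symm) hx.1

theorem Qc (h : CB G φ w p o) (H : Crit G) {i : Fin 3} {x : V} (hx : QQ G w p o i x) : x ≠ w ∧ (∀ m, x ≠ p m) ∧ (∀ m, x ≠ o m) ∧
    ¬ G.Adj x w ∧ φ x ≠ i ∧ (∀ m, ¬ G.Adj x (o m)) ∧ (∀ m, G.Adj x (p m) → m = i) := by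
  have e2 : ∀ m, x ≠ p m := by rintro m rfl; exact h.pp H _ _ hx.1
  refine ⟨hx.2.1, e2, hx.2.2, ?_, ?_, ?_, ?_⟩
  · intro h'
    obtain ⟨m, hm⟩ := (h.nbw x).1 h'.symm
    exact e2 m hm
  · have := h.st _ _ (h.pw i) hx.2.1 hx.1
    rw [h.cp] at this
    exact this.symm
  · intro m hm
    by_cases hmi : m = i
    · subst hmi
      obtain ⟨j, k, h1, h2, h3⟩ := fin3_ex m
      exact H.c5 _ _ _ _ _ hm (h.po j m h1.symm).symm (h.wp j).symm (h.wp m) hx.1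
    · exact H.tri _ _ _ hx.1 hm (h.po i m (Ne.symm hmi))
  · intro m hm
    by_contra hc
    rcases h.cm m i x hc hm.symm hx.1 with e | ⟨k, e⟩
    · exact hx.2.1 e
    · exact hx.2.2 k e

theorem QR (h : CB G φ w p o) (H : Crit G) {i j : Fin 3} {x : V} (hx : QQ G w p o i x) (hy : RR G p o j x) : False :=
  (h.Qc H hx).2.2.2.2.2.1 j hy.1.symm

theorem QQn (h : CB G φ w p o) (H : Crit G) {i j : Fin 3} {x y : V} (hx : QQ G w p o i x) (hy : QQ G w p o j y) : ¬ G.Adj x y := by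
  intro hxy
  by_cases hij : i = j
  · subst hij
    exact H.tri _ _ _ hx.1 hxy hy.1
  · exact H.c5 _ _ _ _ _ hxy hy.1.symm (h.wp j).symm (h.wp i) hx.1

theorem outer (h : CB G φ w p o) (H : Crit G) {i j k : Fin 3} (h1 : i ≠ j) (h2 : i ≠ k) (h3 : j ≠ k) {q y : V}
    (hq : QQ G w p o i q) (hn : ¬ Inn G w p o q) (hy : RR G p o j y) (hy' : ¬ RR G p o k y) : G.Adj q y := by
  have : ∃ n, G.Adj q n ∧ n ≠ p i ∧ ∀ j, ¬ RR G p o j n := by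
    by_contra hc
    push Not at hc
    exact hn ⟨i, hq, fun x hx => by by_cases e : x = p i; exact Or.inl e; exact Or.inr (hc x hx e)⟩
  obtain ⟨n, n1, n2, n3⟩ := this
  by_contra hqy
  obtain ⟨r1, r2, r3, r4, r5, r6⟩ := h.Rc H hy
  obtain ⟨q1, q2, q3, q4, q5, q6, q7⟩ := h.Qc H hq
  have key : ∀ m, ¬ G.Adj (o m) n := by
    intro m hm
    apply n3 m
    refine ⟨hm, fun l hl => ?_⟩
    have := q7 l (hl ▸ n1)
    exact n2 (by rw [hl, this])
  refine T2 H (h.po i j h1) hq.1 (h.wp i).symm (h.po i k h2) (h.ow k).symm hy.1 n1 hqy ?_ ?_ (key j) ?_ (key k)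
  · exact fun e => r4 e.symm
  · exact fun e => hy' ⟨e, hy.2⟩
  · intro e
    obtain ⟨m, hm⟩ := (h.nbw n).1 e
    exact n2 (by rw [hm, q7 m (hm ▸ n1)])

theorem copy (h : CB G φ w p o) (H : Crit G) {i j k : Fin 3} (h1 : i ≠ j) (h2 : i ≠ k) (h3 : j ≠ k) {x x' n : V}
    (hx : RR G p o k x) (hx' : RR G p o k x') (hj : ¬ RR G p o j x) (hj' : ¬ RR G p o j x') (hn : G.Adj x n) :
    (∃ m, n = o m) ∨ Inn G w p o n ∨ φ n ≠ φ x' := by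
  by_contra hc
  push Not at hc
  obtain ⟨c1, c2, c3⟩ := hc
  obtain ⟨r1, r2, r3, r4, r5, r6⟩ := h.Rc H hx
  obtain ⟨s1, s2, s3, s4, s5, s6⟩ := h.Rc H hx'
  have nw : n ≠ w := by rintro rfl; exact r4 hn
  have hxx : x ≠ x' := by
    rintro rfl
    exact h.st _ _ r1 nw hn c3.symm
  have nx' : ¬ G.Adj x' n := by
    intro e
    exact h.st _ _ s1 nw e c3.symm
  have a1 : ¬ G.Adj (p i) n := by
    intro e
    rcases (h.np i j k h1 h2 h3 n).1 e with e | e | e | e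
    · exact nw e
    · exact c1 _ e
    · exact c1 _ e
    · exact nx' (h.outer H h2 h1 h3.symm e c2 hx' hj').symm
  have a2 : ¬ G.Adj (p j) n := by
    intro e
    rcases (h.np j i k h1.symm h3 h2 n).1 e with e | e | e | e
    · exact nw e
    · exact c1 _ e
    · exact c1 _ e
    · by_cases hi : RR G p o i x'
      · have t1 := (h.Rc H hi).2.2.2.2.1
        have t2 := (h.Qc H e).2.2.2.2.1
        rw [c3] at t2
        have := fin3_all h1 h2 h3 (φ x')
        tauto
      · exact nx' (h.outer H h3 h1.symm h2.symm e c2 hx' hi).symm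
  exact T2 H (h.po i k h2).symm hx.1 (h.po j k h3).symm hx'.1 (fun e => hx'.2 j e.symm) (h.po i j h1) hn
    (fun e => hj ⟨e.symm, hx.2⟩) (h.po' j) (fun e => hj' ⟨e.symm, hx'.2⟩) a1 a2 nx'
end CB

set_option linter.unusedVariables false
namespace CB
variable {V : Type} {G : SimpleGraph V} {φ : V → Fin 3} {w : V} {p o : Fin 3 → V}

theorem pinj (h : CB G φ w p o) {i j : Fin 3} (e : p i = p j) : i = j := by
  have := h.cp i
  rw [e, h.cp] at this
  exact this.symm

theorem rc (h : CB G φ w p o) (H : Crit G) (c : Fin 3)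
    (hc : ∀ k x, RR G p o k x → φ x = c → ∃ d, d ≠ c ∧ OKc G φ w p o x d) : False := by
  classical
  have ex : ∀ x, ∃ d, (∃ k, RR G p o k x) → d ≠ c ∧ OKc G φ w p o x d := by
    intro x
    by_cases hx : ∃ k, RR G p o k x
    · obtain ⟨k, hk⟩ := hx
      obtain ⟨r1, r2, r3, r4, r5, r6⟩ := h.Rc H hk
      by_cases e : φ x = c
      · obtain ⟨d, hd⟩ := hc k x hk e
        exact ⟨d, fun _ => hd⟩
      · refine ⟨φ x, fun _ => ⟨e, fun n hn => Or.inr (Or.inr ?_)⟩⟩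
        exact (h.st _ _ r1 (by rintro rfl; exact r4 hn) hn).symm
    · exact ⟨0, fun h => absurd h hx⟩
  choose ψ hψ using ex
  have exd : ∀ i, ∃ d, d ≠ c ∧ ∀ q, QQ G w p o i q → φ q ≠ d := by
    intro i
    by_cases e : ∃ q, QQ G w p o i q
    · obtain ⟨q, hq⟩ := e
      obtain ⟨d, d1, d2⟩ := third c (φ q)
      exact ⟨d, d1, fun q' hq' => by rw [h.star i q' q hq' hq]; exact d2.symm⟩
    · obtain ⟨d, d1, d2⟩ := third c c
      exact ⟨d, d1, fun q hq => absurd ⟨q, hq⟩ e⟩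
  choose δ hδ1 hδ2 using exd
  let A : V → Prop := fun x => x = w ∨ (∃ m, x = o m) ∨ Inn G w p o x
  let χ : V → Fin 3 := fun x => if A x then c else if hp : ∃ i, x = p i then δ hp.choose else
    if ∃ k, RR G p o k x then ψ x else φ x
  have χA : ∀ x, A x → χ x = c := fun x hx => by simp only [χ, if_pos hx]
  have Ap : ∀ i, ¬ A (p i) := by
    rintro i (e | ⟨m, e⟩ | ⟨m, e, -⟩)
    · exact h.pw i e
    · exact h.opne H m i e.symm
    · exact (h.Qc H e).2.1 i rfl
  have AR : ∀ k x, RR G p o k x → ¬ A x := by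
    rintro k x hx (e | ⟨m, e⟩ | ⟨m, e, -⟩)
    · exact (h.Rc H hx).1 e
    · exact (h.Rc H hx).2.2.1 m e
    · exact h.QR H e hx
  have χp : ∀ i, χ (p i) = δ i := by
    intro i
    have hp : ∃ j, p i = p j := ⟨i, rfl⟩
    simp only [χ, if_neg (Ap i), dif_pos hp]
    rw [← h.pinj hp.choose_spec]
  have χR : ∀ k x, RR G p o k x → χ x = ψ x := by
    intro k x hx
    have hp : ¬ ∃ j, x = p j := fun ⟨j, e⟩ => hx.2 j e
    have hk : ∃ k, RR G p o k x := ⟨k, hx⟩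
    simp only [χ, if_neg (AR k x hx), dif_neg hp, if_pos hk]
  have χo : ∀ x, ¬ A x → (∀ i, x ≠ p i) → (∀ k, ¬ RR G p o k x) → χ x = φ x := by
    intro x h1 h2 h3
    have hp : ¬ ∃ j, x = p j := fun ⟨j, e⟩ => h2 j e
    have hk : ¬ ∃ k, RR G p o k x := fun ⟨j, e⟩ => h3 j e
    simp only [χ, if_neg h1, dif_neg hp, if_neg hk]
  -- neighbours of A
  have nA : ∀ x y, A x → G.Adj x y → (∃ i, y = p i) ∨ ∃ k, RR G p o k y := by
    rintro x y (rfl | ⟨m, rfl⟩ | ⟨m, e, e'⟩) hy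
    · exact Or.inl ((h.nbw y).1 hy)
    · by_cases e : ∃ i, y = p i
      · exact Or.inl e
      · exact Or.inr ⟨m, hy, fun j hj => e ⟨j, hj⟩⟩
    · rcases e' y hy with e | e
      · exact Or.inl ⟨m, e⟩
      · exact Or.inr e
  have c1 : ∀ x y, A x → G.Adj x y → χ x ≠ χ y := by
    intro x y hx hxy
    rw [χA x hx]
    rcases nA x y hx hxy with ⟨i, rfl⟩ | ⟨k, hk⟩
    · rw [χp]; exact (hδ1 i).symm
    · rw [χR k y hk]; exact (hψ y ⟨k, hk⟩).1.symm
  have c2 : ∀ i y, G.Adj (p i) y → χ (p i) ≠ χ y := by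
    intro i y hy
    by_cases ay : A y
    · exact (c1 y _ ay hy.symm).symm
    · obtain ⟨j, k, h1, h2, h3⟩ := fin3_ex i
      rcases (h.np i j k h1 h2 h3 y).1 hy with e | e | e | e
      · exact absurd (Or.inl e) ay
      · exact absurd (Or.inr (Or.inl ⟨_, e⟩)) ay
      · exact absurd (Or.inr (Or.inl ⟨_, e⟩)) ay
      · rw [χp, χo y ay (h.Qc H e).2.1 (fun k hk => h.QR H e hk)]
        exact (hδ2 i y e).symm
  have c3 : ∀ k x y, RR G p o k x → G.Adj x y → χ x ≠ χ y := by
    intro k x y hx hy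
    by_cases ay : A y
    · exact (c1 y _ ay hy.symm).symm
    · obtain ⟨r1, r2, r3, r4, r5, r6⟩ := h.Rc H hx
      rw [χR k x hx, χo y ay (fun i e => r6 i (e ▸ hy)) (fun k hk => h.RRn H hx hk hy)]
      rcases (hψ x ⟨k, hx⟩).2 y hy with e | e | e
      · exact absurd (Or.inr (Or.inl e)) ay
      · exact absurd (Or.inr (Or.inr e)) ay
      · exact e.symm
  refine H.ncol χ fun x y hxy => ?_
  by_cases ax : A x
  · exact c1 x y ax hxy
  by_cases ay : A y
  · exact (c1 y x ay hxy.symm).symm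
  by_cases px : ∃ i, x = p i
  · obtain ⟨i, rfl⟩ := px
    exact c2 i y hxy
  by_cases py : ∃ i, y = p i
  · obtain ⟨i, rfl⟩ := py
    exact (c2 i x hxy.symm).symm
  by_cases rx : ∃ i, RR G p o i x
  · obtain ⟨i, hi⟩ := rx
    exact c3 i x y hi hxy
  by_cases ry : ∃ i, RR G p o i y
  · obtain ⟨i, hi⟩ := ry
    exact (c3 i y x hi hxy.symm).symm
  push Not at px py rx ry
  rw [χo x ax px rx, χo y ay py ry]
  exact h.st x y (fun e => ax (Or.inl e)) (fun e => ay (Or.inl e)) hxy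

/-- (N) -/
theorem nn (h : CB G φ w p o) (H : Crit G) {i j : Fin 3} (hij : i ≠ j) (hR : ∀ x, RR G p o i x → φ x ≠ j) :
    ∃ q, QQ G w p o j q ∧ φ q = i := by
  classical
  by_contra hc
  push Not at hc
  obtain ⟨k, h2, h3⟩ := fin3_ex2 hij
  have np := h.np j i k hij.symm h3 h2
  have no := h.no i j k hij h2 h3
  have cp := h.cp
  have co := h.co
  have nbw := h.nbw
  have al := fin3_all hij h2 h3
  have e1 := h.ow i
  have e2 := h.opne H i j
  have e3 := h.pw j
  have e4 := h.pw k
  have e5 : p j ≠ p k := fun e => h3 (h.pinj e)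
  have e6 : o k ≠ o i := fun e => h2.symm (by rw [← h.co k, e, h.co])
  have e8 := h.opne H k j
  have e9 := h.ow k
  have e10 := h.opne H i k
  have st := h.st.D
  have sy := H.ctx.1
  have ir := H.ctx.2.2
  have hRc : ∀ x, RR G p o i x → x ≠ w ∧ x ≠ p j := fun x hx => ⟨(h.Rc H hx).1, hx.2 j⟩
  have hQc : ∀ x, QQ G w p o j x → x ≠ w ∧ x ≠ o i := fun x hx => ⟨hx.2.1, hx.2.2 i⟩
  refine recol H h.st (fun x => if x = w then j else if x = p j then i else if x = o i then j else φ x) ?_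
  intro a ha b hab
  have s1 : a = w ∨ a = p j ∨ a = o i := by
    by_contra hn
    push Not at hn
    simp [hn.1, hn.2.1, hn.2.2] at ha
  rcases s1 with rfl | rfl | rfl
  · obtain ⟨m, rfl⟩ := (nbw b).1 hab
    have := cp m
    have := e2
    rcases al m with rfl | rfl | rfl
    · have : p m ≠ p j := fun e => hij (h.pinj e)
      have := h.opne H m m
      grind
    · grind
    · grind
  · rcases (np b).1 hab with rfl | rfl | rfl | hb
    · grind
    · grind
    · grind
    · have := hc b hb
      have := hQc b hb
      have := (h.Qc H hb).2.1 j
      grind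
  · rcases (no b).1 hab with rfl | rfl | hb
    · grind
    · grind
    · have := hR b hb
      have := hRc b hb
      have := (h.Rc H hb).2.2.1 i
      grind

end CB

set_option linter.unusedVariables false
namespace CB
variable {V : Type} {G : SimpleGraph V} {φ : V → Fin 3} {w : V} {p o : Fin 3 → V}

/-- a vertex whose colour `c` cannot be changed -/
def Bad (G : SimpleGraph V) (φ : V → Fin 3) (w : V) (p o : Fin 3 → V) (x : V) : Prop :=
  ∀ d, d ≠ φ x → ¬ OKc G φ w p o x d

theorem exBad (h : CB G φ w p o) (H : Crit G) (c : Fin 3) : ∃ k x, RR G p o k x ∧ φ x = c ∧ Bad G φ w p o x := by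
  by_contra hc
  push Not at hc
  refine h.rc H c fun k x hx hk => ?_
  have := hc k x hx hk
  unfold Bad at this
  push Not at this
  rwa [hk] at this

theorem mono (h : CB G φ w p o) (H : Crit G) {j k : Fin 3} (hjk : j ≠ k) {x x' : V} (hx : RR G p o k x) (hb : Bad G φ w p o x)
    (hj : ¬ RR G p o j x) (hx' : RR G p o k x') (hj' : ¬ RR G p o j x') : φ x' = φ x := by
  by_contra hc
  obtain ⟨i, h1, h2⟩ := fin3_ex2 hjk
  exact hb _ hc fun n hn => h.copy H h1.symm h2.symm hjk hx hx' hj hj' hn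

theorem no3 (h : CB G φ w p o) (H : Crit G) {i j k : Fin 3} (h1 : i ≠ j) (h2 : i ≠ k) (h3 : j ≠ k) {x : V}
    (a : RR G p o i x) (b : RR G p o j x) (c : RR G p o k x) : False := by
  have := fin3_all h1 h2 h3 (φ x)
  have := (h.Rc H a).2.2.2.2.1
  have := (h.Rc H b).2.2.2.2.1
  have := (h.Rc H c).2.2.2.2.1
  tauto

theorem stR (h : CB G φ w p o) (H : Crit G) {i : Fin 3} {x q : V} (hx : RR G p o i x) (hq : G.Adj q x) : φ q ≠ φ x := by
  refine h.st _ _ ?_ (h.Rc H hx).1 hq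
  rintro rfl
  exact (h.Rc H hx).2.2.2.1 hq.symm

theorem cZ (h : CB G φ w p o) (H : Crit G) {i j k : Fin 3} (h1 : i ≠ j) (h2 : i ≠ k) (h3 : j ≠ k) {x : V}
    (a : RR G p o i x) (b : RR G p o j x) : φ x = k := by
  have := fin3_all h1 h2 h3 (φ x)
  have := (h.Rc H a).2.2.2.2.1
  have := (h.Rc H b).2.2.2.2.1
  tauto

theorem innZ (h : CB G φ w p o) (H : Crit G) {i j k : Fin 3} (h1 : i ≠ j) (h2 : i ≠ k) (h3 : j ≠ k) {x' x'' q : V}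
    (a1 : RR G p o i x') (a2 : RR G p o k x') (b1 : RR G p o i x'') (b2 : RR G p o j x'')
    (hq : QQ G w p o i q) : Inn G w p o q := by
  by_contra hn
  have c1 := h.cZ H h2 h1 h3.symm a1 a2
  have c2 := h.cZ H h1 h2 h3 b1 b2
  have e1 := h.stR H a2 (h.outer H h2 h1 h3.symm hq hn a2 (fun e => h.no3 H h1 h2 h3 a1 e a2))
  have e2 := h.stR H b2 (h.outer H h1 h2 h3 hq hn b2 (fun e => h.no3 H h1 h2 h3 b1 b2 e))
  have := (h.Qc H hq).2.2.2.2.1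
  have := fin3_all h1 h2 h3 (φ q)
  rw [c1] at e1
  rw [c2] at e2
  tauto

theorem termZ (h : CB G φ w p o) (H : Crit G) {i j k : Fin 3} (h1 : i ≠ j) (h2 : i ≠ k) (h3 : j ≠ k) {x x' x'' : V}
    (a1 : RR G p o j x) (a2 : RR G p o k x) (b1 : RR G p o i x') (b2 : RR G p o k x')
    (c1 : RR G p o i x'') (c2 : RR G p o j x'') (bx : Bad G φ w p o x) (bx' : Bad G φ w p o x') : False := by
  have e1 := h.cZ H h3 h1.symm h2.symm a1 a2
  have e2 := h.cZ H h2 h1 h3.symm b1 b2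
  have n1 := bx (φ x') (by rw [e1, e2]; exact h1.symm)
  have n2 := bx' (φ x) (by rw [e1, e2]; exact h1)
  unfold OKc at n1 n2
  push Not at n1 n2
  obtain ⟨n, u1, u2, u3, u4⟩ := n1
  obtain ⟨n', v1, v2, v3, v4⟩ := n2
  have f1 : ¬ G.Adj x' n := fun e => h.stR H b1 e.symm u4
  have f2 : ¬ G.Adj x n' := fun e => h.stR H a1 e.symm v4
  have key : ∀ m n, (∀ i, n ≠ o i) → ¬ Inn G w p o n → ((m = i) ∨ m = j) → n ≠ w → ¬ G.Adj (p m) n := by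
    intro m n g1 g2 g3 g4 g5
    obtain ⟨m1, m2, w1, w2, w3⟩ := fin3_ex m
    rcases (h.np m m1 m2 w1 w2 w3 n).1 g5 with e | e | e | e
    · exact g4 e
    · exact g1 _ e
    · exact g1 _ e
    · rcases g3 with rfl | rfl
      · exact g2 (h.innZ H h1 h2 h3 b1 b2 c1 c2 e)
      · exact g2 (h.innZ H h1.symm h3 h2 a1 a2 c2 c1 e)
  have w1 : n ≠ w := by rintro rfl; exact (h.Rc H a1).2.2.2.1 u1
  have w2 : n' ≠ w := by rintro rfl; exact (h.Rc H b1).2.2.2.1 v1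
  refine T2 H a2.1 b2.1 (h.po i k h2).symm (h.po j k h3).symm (fun e => h1 (h.pinj e)) u1 v1 f1
    (key i n u2 u3 (by simp) w1) (key j n u2 u3 (by simp) w1) f2 (key i n' v2 v3 (by simp) w2) (key j n' v2 v3 (by simp) w2)

/-- F1 -/
theorem f1 (h : CB G φ w p o) (H : Crit G) {i j k : Fin 3} (h1 : i ≠ j) (h2 : i ≠ k) (h3 : j ≠ k) {x y q : V}
    (a : RR G p o j x) (b : RR G p o k y) (a' : ¬ RR G p o k x) (b' : ¬ RR G p o j y) (hq : QQ G w p o i q) :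
    G.Adj x q ∨ G.Adj y q := by
  by_contra hc
  push Not at hc
  have r := h.Rc H a
  have s := h.Rc H b
  exact T2 H (h.po i j h1) (h.po i k h2) (h.wp i).symm hq.1 hq.2.1.symm a.1 b.1
    (fun e => a' ⟨e, a.2⟩) (fun e => r.2.2.2.1 e.symm) (fun e => hc.1 e.symm) (fun e => b' ⟨e, b.2⟩)
    (fun e => s.2.2.2.1 e.symm) (fun e => hc.2 e.symm)

/-- two elements of `R i` when there are no common ones -/
theorem two (h : CB G φ w p o) (H : Crit G) {i j k : Fin 3} (h1 : i ≠ j) (h2 : i ≠ k) (h3 : j ≠ k) {x y : V}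
    (a : RR G p o i x) (b : RR G p o i y) (hne : x ≠ y) (nz : ∀ x, RR G p o i x → ¬ RR G p o j x ∧ ¬ RR G p o k x) :
    ∃ q, G.Adj x q ∧ ¬ G.Adj y q ∧ (QQ G w p o j q ∨ QQ G w p o k q) := by
  obtain ⟨n, n1, n2⟩ := H.inc x y hne
  refine ⟨n, n1, n2, ?_⟩
  have nw : n ≠ w := by rintro rfl; exact (h.Rc H a).2.2.2.1 n1
  have no : ∀ m, n ≠ o m := by
    rintro m rfl
    rcases fin3_all h1 h2 h3 m with rfl | rfl | rfl
    · exact n2 b.1.symm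
    · exact (nz x a).1 ⟨n1.symm, a.2⟩
    · exact (nz x a).2 ⟨n1.symm, a.2⟩
  by_cases e1 : G.Adj (p j) n
  · exact Or.inl ⟨e1, nw, no⟩
  by_cases e2 : G.Adj (p k) n
  · exact Or.inr ⟨e2, nw, no⟩
  exfalso
  exact T2 H (h.po j i h1.symm).symm a.1 (h.po k i h2.symm).symm b.1 (fun e => b.2 k e.symm) (h.po j k h3) n1
    (fun e => (nz x a).2 ⟨e.symm, a.2⟩) (h.po' k) (fun e => (nz y b).2 ⟨e.symm, b.2⟩) e1 e2 n2
end CB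

set_option linter.unusedVariables false
namespace CB
variable {V : Type} {G : SimpleGraph V} {φ : V → Fin 3} {w : V} {p o : Fin 3 → V}

/-- `R k` is nonempty and monochromatic of colour `c` -/
def MM (G : SimpleGraph V) (φ : V → Fin 3) (p o : Fin 3 → V) (k c : Fin 3) : Prop :=
  (∃ x, RR G p o k x) ∧ ∀ x, RR G p o k x → φ x = c

theorem zm (h : CB G φ w p o) (H : Crit G) {i j k : Fin 3} (h1 : i ≠ j) (h2 : i ≠ k) (h3 : j ≠ k) :
    (∃ x, RR G p o j x ∧ RR G p o k x ∧ Bad G φ w p o x) ∨ MM G φ p o j i ∨ MM G φ p o k i := by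
  obtain ⟨m, x, hx, hc, hb⟩ := h.exBad H i
  have hm : m ≠ i := by
    rintro rfl
    exact (h.Rc H hx).2.2.2.2.1 hc
  have ni : ¬ RR G p o i x := fun e => (h.Rc H e).2.2.2.2.1 hc
  have key : ∀ j k, i ≠ j → i ≠ k → j ≠ k → RR G p o k x → ¬ RR G p o j x → MM G φ p o k i := by
    intro j k h1 h2 h3 a b
    refine ⟨⟨x, a⟩, fun x' hx' => ?_⟩
    rw [← hc]
    by_cases e : RR G p o j x'
    · exact h.mono H h2 a hb ni hx' (fun e' => h.no3 H h1 h2 h3 e' e hx')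
    · exact h.mono H h3 a hb b hx' e
  have := fin3_all h1 h2 h3 m
  by_cases e1 : RR G p o j x
  · by_cases e2 : RR G p o k x
    · exact Or.inl ⟨x, e1, e2, hb⟩
    · exact Or.inr (Or.inl (key k j h2 h1 h3.symm e1 e2))
  · rcases this with rfl | rfl | rfl
    · exact absurd rfl hm
    · exact absurd hx e1
    · exact Or.inr (Or.inr (key j m h1 h2 h3 hx e1))

theorem noZ (h : CB G φ w p o) (H : Crit G) {i j k : Fin 3} (h1 : i ≠ j) (h2 : i ≠ k) (h3 : j ≠ k) {x : V}
    (a : RR G p o j x) (b : RR G p o k x) (hb : Bad G φ w p o x) : False := by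
  have c := h.cZ H h3 h1.symm h2.symm a b
  have ej : ∀ c', MM G φ p o j c' → c' = i := fun c' hm => by rw [← c, hm.2 x a]
  have ek : ∀ c', MM G φ p o k c' → c' = i := fun c' hm => by rw [← c, hm.2 x b]
  rcases h.zm H h1.symm h3 h2 with ⟨x', a', b', hb'⟩ | q | q
  · rcases h.zm H h2.symm h3.symm h1 with ⟨x'', a'', b'', hb''⟩ | q | q
    · exact h.termZ H h1 h2 h3 a b a' b' a'' b'' hb hb'
    · have c' := h.cZ H h2 h1 h3.symm a' b'
      rw [q.2 x' a'] at c'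
      exact h3 c'.symm
    · exact h2 (ej k q).symm
  · rcases h.zm H h2.symm h3.symm h1 with ⟨x'', a'', b'', hb''⟩ | q' | q'
    · have c' := h.cZ H h1 h2 h3 a'' b''
      rw [q.2 x'' a''] at c'
      exact h3 c'
    · obtain ⟨⟨y, hy⟩, hq⟩ := q
      exact h3 (by rw [← hq y hy, q'.2 y hy])
    · exact h2 (ej k q').symm
  · exact h1 (ek j q).symm

/-- a deranged configuration -/
theorem der (h : CB G φ w p o) (H : Crit G) : ∃ i j k : Fin 3, i ≠ j ∧ i ≠ k ∧ j ≠ k ∧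
    MM G φ p o i j ∧ MM G φ p o j k ∧ MM G φ p o k i := by
  have un : ∀ m c c', MM G φ p o m c → MM G φ p o m c' → c = c' := by
    rintro m c c' ⟨⟨y, hy⟩, hq⟩ hq'
    rw [← hq y hy, hq'.2 y hy]
  have z : ∀ i j k : Fin 3, i ≠ j → i ≠ k → j ≠ k → MM G φ p o j i ∨ MM G φ p o k i := by
    intro i j k h1 h2 h3
    rcases h.zm H h1 h2 h3 with ⟨x, a, b, hb⟩ | q
    · exact (h.noZ H h1 h2 h3 a b hb).elim
    · exact q
  rcases z 0 1 2 (by decide) (by decide) (by decide) with a | a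
  · rcases z 2 0 1 (by decide) (by decide) (by decide) with b | b
    · rcases z 1 0 2 (by decide) (by decide) (by decide) with c | c
      · exact absurd (un _ _ _ b c) (by decide)
      · exact ⟨0, 2, 1, by decide, by decide, by decide, b, c, a⟩
    · exact absurd (un _ _ _ a b) (by decide)
  · rcases z 1 0 2 (by decide) (by decide) (by decide) with b | b
    · rcases z 2 0 1 (by decide) (by decide) (by decide) with c | c
      · exact absurd (un _ _ _ b c) (by decide)
      · exact ⟨0, 1, 2, by decide, by decide, by decide, b, c, a⟩
    · exact absurd (un _ _ _ a b) (by decide)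
end CB

set_option linter.unusedVariables false
namespace CB
variable {V : Type} {G : SimpleGraph V} {φ : V → Fin 3} {w : V} {p o : Fin 3 → V}

theorem nzM {i j ci cj : Fin 3} (hi : MM G φ p o i ci) (hj : MM G φ p o j cj) (hne : ci ≠ cj) (x : V)
    (a : RR G p o i x) : ¬ RR G p o j x := by
  intro b
  exact hne (by rw [← hi.2 x a, hj.2 x b])

theorem big (h : CB G φ w p o) (H : Crit G) {i j k : Fin 3} (h1 : i ≠ j) (h2 : i ≠ k) (h3 : j ≠ k) {ci cj ck : Fin 3}
    (mi : MM G φ p o i ci) (mj : MM G φ p o j cj) (mk : MM G φ p o k ck) (d1 : ci ≠ cj) (d2 : ci ≠ ck)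
    {qj qk : V} (hj : QQ G w p o j qj) (hk : QQ G w p o k qk) {x y : V}
    (a : RR G p o i x) (b : RR G p o i y) (hne : x ≠ y) :
    (G.Adj x qj ∧ ¬ G.Adj y qj ∧ G.Adj y qk ∧ ¬ G.Adj x qk) ∨ (G.Adj x qk ∧ ¬ G.Adj y qk ∧ G.Adj y qj ∧ ¬ G.Adj x qj) := by
  have nz : ∀ x, RR G p o i x → ¬ RR G p o j x ∧ ¬ RR G p o k x := fun x hx => ⟨nzM mi mj d1 x hx, nzM mi mk d2 x hx⟩
  obtain ⟨q, q1, q2, q3⟩ := h.two H h1 h2 h3 a b hne nz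
  obtain ⟨q', q1', q2', q3'⟩ := h.two H h1 h2 h3 b a hne.symm nz
  rcases q3 with e | e <;> rcases q3' with e' | e'
  · cases h.star _ _ _ e hj
    cases h.star _ _ _ e' e
    tauto
  · cases h.star _ _ _ e hj
    cases h.star _ _ _ e' hk
    tauto
  · cases h.star _ _ _ e hk
    cases h.star _ _ _ e' hj
    tauto
  · cases h.star _ _ _ e hk
    cases h.star _ _ _ e' e
    tauto

/-- all of `R k` sees `qj` if `R i` has two elements -/
theorem big2 (h : CB G φ w p o) (H : Crit G) {i j k : Fin 3} (h1 : i ≠ j) (h2 : i ≠ k) (h3 : j ≠ k) {ci cj ck : Fin 3}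
    (mi : MM G φ p o i ci) (mj : MM G φ p o j cj) (mk : MM G φ p o k ck) (d1 : ci ≠ cj) (d2 : ci ≠ ck)
    {qj qk : V} (hj : QQ G w p o j qj) (hk : QQ G w p o k qk) {x y : V}
    (a : RR G p o i x) (b : RR G p o i y) (hne : x ≠ y) (z : V) (hz : RR G p o k z) : G.Adj z qj := by
  have e := h.big H h1 h2 h3 mi mj mk d1 d2 hj hk a b hne
  have e1 := h.f1 H h1.symm h3 h2 a hz (nzM mi mk d2 x a) (nzM mk mi d2.symm z hz) hj
  have e2 := h.f1 H h1.symm h3 h2 b hz (nzM mi mk d2 y b) (nzM mk mi d2.symm z hz) hj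
  tauto

theorem big3 (h : CB G φ w p o) (H : Crit G) {i j k : Fin 3} (h1 : i ≠ j) (h2 : i ≠ k) (h3 : j ≠ k) {ci cj ck : Fin 3}
    (mi : MM G φ p o i ci) (mj : MM G φ p o j cj) (mk : MM G φ p o k ck) (d1 : ci ≠ cj) (d2 : ci ≠ ck) (d3 : cj ≠ ck)
    {qi qj qk : V} (hi : QQ G w p o i qi) (hj : QQ G w p o j qj) (hk : QQ G w p o k qk) {x y : V}
    (a : RR G p o i x) (b : RR G p o i y) (hne : x ≠ y) (z z' : V) (hz : RR G p o k z) (hz' : RR G p o k z') : z = z' := by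
  by_contra hzz
  have f := h.big2 H h1 h2 h3 mi mj mk d1 d2 hj hk a b hne
  have e := h.big H h2.symm h3.symm h1 mk mi mj d2.symm d3.symm hi hj hz hz' hzz
  have := f z hz
  have := f z' hz'
  tauto

theorem sing (h : CB G φ w p o) (H : Crit G) : ∃ i j k : Fin 3, i ≠ j ∧ i ≠ k ∧ j ≠ k ∧
    MM G φ p o i j ∧ MM G φ p o j k ∧ MM G φ p o k i ∧ (∀ z z', RR G p o j z → RR G p o j z' → z = z') ∧
    (∀ z z', RR G p o k z → RR G p o k z' → z = z') ∧ ∃ qi qj qk, QQ G w p o i qi ∧ QQ G w p o j qj ∧ QQ G w p o k qk ∧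
    φ qi = j ∧ φ qj = k ∧ φ qk = i := by
  obtain ⟨i, j, k, h1, h2, h3, mi, mj, mk⟩ := h.der H
  obtain ⟨qk, hk, ck⟩ := h.nn H h2 (fun x hx => by rw [mi.2 x hx]; exact h3)
  obtain ⟨qi, hi, ci⟩ := h.nn H h1.symm (fun x hx => by rw [mj.2 x hx]; exact h2.symm)
  obtain ⟨qj, hj, cj⟩ := h.nn H h3.symm (fun x hx => by rw [mk.2 x hx]; exact h1)
  have A : ∀ x y, RR G p o i x → RR G p o i y → x ≠ y → ∀ z z', RR G p o k z → RR G p o k z' → z = z' :=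
    fun x y a b hne => h.big3 H h1 h2 h3 mi mj mk h3 h1.symm h2.symm hi hj hk a b hne
  have A' : ∀ x y, RR G p o i x → RR G p o i y → x ≠ y → ∀ z z', RR G p o j z → RR G p o j z' → z = z' :=
    fun x y a b hne => h.big3 H h2 h1 h3.symm mi mk mj h1.symm h3 h2 hi hk hj a b hne
  have B : ∀ x y, RR G p o j x → RR G p o j y → x ≠ y → ∀ z z', RR G p o k z → RR G p o k z' → z = z' :=
    fun x y a b hne => h.big3 H h1.symm h3 h2 mj mi mk h3.symm h2.symm h1.symm hj hi hk a b hne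
  by_cases Q1 : ∀ z z', RR G p o i z → RR G p o i z' → z = z'
  · by_cases Q2 : ∀ z z', RR G p o j z → RR G p o j z' → z = z'
    · by_cases Q3 : ∀ z z', RR G p o k z → RR G p o k z' → z = z'
      · exact ⟨i, j, k, h1, h2, h3, mi, mj, mk, Q2, Q3, qi, qj, qk, hi, hj, hk, ci, cj, ck⟩
      · exact ⟨k, i, j, h2.symm, h3.symm, h1, mk, mi, mj, Q1, Q2, qk, qi, qj, hk, hi, hj, ck, ci, cj⟩
    · push Not at Q2
      obtain ⟨x, y, a, b, hne⟩ := Q2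
      exact ⟨j, k, i, h3, h1.symm, h2.symm, mj, mk, mi, B x y a b hne, Q1, qj, qk, qi, hj, hk, hi, cj, ck, ci⟩
  · push Not at Q1
    obtain ⟨x, y, a, b, hne⟩ := Q1
    exact ⟨i, j, k, h1, h2, h3, mi, mj, mk, A' x y a b hne, A x y a b hne, qi, qj, qk, hi, hj, hk, ci, cj, ck⟩

end CB

set_option linter.unusedVariables false
namespace CB
variable {V : Type} {G : SimpleGraph V} {φ : V → Fin 3} {w : V} {p o : Fin 3 → V}

theorem innN (h : CB G φ w p o) (H : Crit G) {i j k : Fin 3} (h1 : i ≠ j) (h2 : i ≠ k) (h3 : j ≠ k) {q x : V}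
    (hq : QQ G w p o i q) (na : ∀ x, RR G p o i x → ¬ G.Adj q x) (hi : Inn G w p o q) (hx : G.Adj q x) :
    x = p i ∨ RR G p o j x ∨ RR G p o k x := by
  obtain ⟨m, hm, hN⟩ := hi
  rcases hN x hx with e | ⟨l, hl⟩
  · exact Or.inl (by rw [e, (h.Qc H hq).2.2.2.2.2.2 m (e ▸ hx)])
  · rcases fin3_all h1 h2 h3 l with rfl | rfl | rfl
    · exact absurd hx (na x hl)
    · exact Or.inr (Or.inl hl)
    · exact Or.inr (Or.inr hl)

theorem see (h : CB G φ w p o) (H : Crit G) {i j k : Fin 3} (h1 : i ≠ j) (h2 : i ≠ k) (h3 : j ≠ k) {q y z : V}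
    (hq : QQ G w p o i q) (na : ∀ x, RR G p o i x → ¬ G.Adj q x) (hy : ∀ x, RR G p o j x → x = y)
    (hz : RR G p o k z) (hz' : ¬ RR G p o j z) : ∃ x, RR G p o k x ∧ G.Adj q x := by
  by_cases hi : Inn G w p o q
  · obtain ⟨x, x1, x2, x3⟩ := H.deg3 q (p i) y
    rcases h.innN H h1 h2 h3 hq na hi x1 with e | e | e
    · exact absurd e x2
    · exact absurd (hy x e) x3
    · exact ⟨x, e, x1⟩
  · exact ⟨z, hz, h.outer H h2 h1 h3.symm hq hi hz hz'⟩

theorem frk (h : CB G φ w p o) (H : Crit G) {i j k : Fin 3} (h1 : i ≠ j) (h2 : i ≠ k) (h3 : j ≠ k) {q q' y z g : V}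
    (hq : QQ G w p o i q) (hq' : QQ G w p o k q') (hy : RR G p o j y) (hz : RR G p o k z) (a1 : G.Adj q y) (a2 : G.Adj q z)
    (a3 : G.Adj q' y) (a4 : ¬ G.Adj q' z) (a5 : G.Adj q g) (g1 : g ≠ p i) (g2 : g ≠ z) : G.Adj q' g := by
  by_contra hg
  refine T2 H a1 hq.1.symm a2 a5 g2.symm a3.symm (h.wp i).symm ?_ (fun e => a4 e.symm) (fun e => hg e.symm) (h.Rc H hy).2.2.2.1
    (h.Rc H hz).2.2.2.1 ?_
  · intro e
    exact h2 ((h.Qc H hq').2.2.2.2.2.2 i e.symm)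
  · intro e
    obtain ⟨m, hm⟩ := (h.nbw g).1 e.symm
    exact g1 (by rw [hm, (h.Qc H hq).2.2.2.2.2.2 m (hm ▸ a5)])

theorem allInn (h : CB G φ w p o) (H : Crit G) {i j k : Fin 3} (h1 : i ≠ j) (h2 : i ≠ k) (h3 : j ≠ k) {qi qj qk yi yj yk : V}
    (hi : QQ G w p o i qi) (hj : QQ G w p o j qj) (hk : QQ G w p o k qk) (c : ∀ x : Fin 3, x = φ qi ∨ x = φ qj ∨ x = φ qk)
    (ri : RR G p o i yi) (rj : RR G p o j yj) (rk : RR G p o k yk) (a1 : G.Adj qi yj) (a2 : G.Adj qi yk) (a3 : G.Adj qj yi)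
    (a4 : G.Adj qj yk) (a5 : G.Adj qk yi) (a6 : G.Adj qk yj) (n1 : ¬ G.Adj qj yj) (n2 : ¬ G.Adj qk yk) : Inn G w p o qi := by
  refine ⟨i, hi, fun g hg => ?_⟩
  by_contra hc
  push Not at hc
  have e1 := h.frk H h1 h2 h3 hi hk rj rk a1 a2 a6 n2 hg hc.1 (by rintro rfl; exact hc.2 _ rk)
  have e2 := h.frk H h2 h1 h3.symm hi hj rk rj a2 a1 a4 n1 hg hc.1 (by rintro rfl; exact hc.2 _ rj)
  have gw : g ≠ w := by rintro rfl; exact (h.Qc H hi).2.2.2.1 hg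
  have f1 := h.st _ _ hi.2.1 gw hg
  have f2 := h.st _ _ hj.2.1 gw e2
  have f3 := h.st _ _ hk.2.1 gw e1
  have := c (φ g)
  tauto

theorem absurdity (h : CB G φ w p o) (H : Crit G) : False := by
  obtain ⟨i, j, k, h1, h2, h3, mi, mj, mk, uj, uk, qi, qj, qk, hi, hj, hk, ci, cj, ck⟩ := h.sing H
  obtain ⟨yi, ri⟩ := mi.1
  obtain ⟨yj, rj⟩ := mj.1
  obtain ⟨yk, rk⟩ := mk.1
  have ni : ∀ x, RR G p o i x → ¬ G.Adj qi x := fun x hx e => h.stR H hx e (by rw [ci, mi.2 x hx])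
  have nj : ∀ x, RR G p o j x → ¬ G.Adj qj x := fun x hx e => h.stR H hx e (by rw [cj, mj.2 x hx])
  have nk : ∀ x, RR G p o k x → ¬ G.Adj qk x := fun x hx e => h.stR H hx e (by rw [ck, mk.2 x hx])
  have iyk : G.Adj qi yk := by
    obtain ⟨x, x1, x2⟩ := h.see H h1 h2 h3 hi ni (fun x hx => uj x yj hx rj) rk (nzM mk mj h2 _ rk)
    rwa [uk yk x rk x1]
  have iyj : G.Adj qi yj := by
    obtain ⟨x, x1, x2⟩ := h.see H h2 h1 h3.symm hi ni (fun x hx => uk x yk hx rk) rj (nzM mj mk h2.symm _ rj)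
    rwa [uj yj x rj x1]
  obtain ⟨y', r', ky'⟩ := h.see H h3.symm h2.symm h1.symm hk nk (fun x hx => uj x yj hx rj) ri (nzM mi mj h3 _ ri)
  have main : Inn G w p o qi ∧ Inn G w p o qk ∧ G.Adj qk yj ∧ (∀ x, RR G p o i x → G.Adj qk x → x = y') := by
    by_cases S : ∀ z z', RR G p o i z → RR G p o i z' → z = z'
    · have kyi : G.Adj qk yi := by rwa [S yi y' ri r']
      have kyj : G.Adj qk yj := by
        obtain ⟨x, x1, x2⟩ := h.see H h2.symm h3.symm h1 hk nk (fun x hx => S x yi hx ri) rj (nzM mj mi h3.symm _ rj)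
        rwa [uj yj x rj x1]
      have jyk : G.Adj qj yk := by
        obtain ⟨x, x1, x2⟩ := h.see H h1.symm h3 h2 hj nj (fun x hx => S x yi hx ri) rk (nzM mk mi h1 _ rk)
        rwa [uk yk x rk x1]
      have jyi : G.Adj qj yi := by
        obtain ⟨x, x1, x2⟩ := h.see H h3 h1.symm h2.symm hj nj (fun x hx => uk x yk hx rk) ri (nzM mi mk h1.symm _ ri)
        rwa [S yi x ri x1]
      refine ⟨h.allInn H h1 h2 h3 hi hj hk ?_ ri rj rk iyj iyk jyi jyk kyi kyj (nj _ rj) (nk _ rk),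
        h.allInn H h2.symm h3.symm h1 hk hi hj ?_ rk ri rj kyi kyj iyk iyj jyk jyi (ni _ ri) (nj _ rj), kyj, fun x hx _ => S x y' hx r'⟩
      · rw [ci, cj, ck]; exact fin3_all h3 h1.symm h2.symm
      · rw [ci, cj, ck]; exact fin3_all h1 h2 h3
    · push Not at S
      obtain ⟨x, x', rx, rx', hne⟩ := S
      have B : ∀ x y, RR G p o i x → RR G p o i y → x ≠ y → _ := fun x y a b hne => h.big H h1 h2 h3 mi mj mk h3 h1.symm hj hk a b hne
      have kyj : G.Adj qk yj := (h.big2 H h2 h1 h3.symm mi mk mj h1.symm h3 hk hj rx rx' hne yj rj).symm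
      have kk : Inn G w p o qk := by
        by_contra hn
        have := B _ _ rx rx' hne
        have := (h.outer H h2.symm h3.symm h1 hk hn rx (nzM mi mj h3 _ rx)).symm
        have := (h.outer H h2.symm h3.symm h1 hk hn rx' (nzM mi mj h3 _ rx')).symm
        tauto
      refine ⟨⟨i, hi, fun g hg => ?_⟩, kk, kyj, ?_⟩
      · by_contra hc
        push Not at hc
        have e := h.frk H h1 h2 h3 hi hk rj rk iyj iyk kyj (nk _ rk) hg hc.1 (by rintro rfl; exact hc.2 _ rk)
        rcases h.innN H h2.symm h3.symm h1 hk nk kk e with e | e | e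
        · rw [e] at hg
          exact h2 ((h.Qc H hi).2.2.2.2.2.2 k hg).symm
        · exact hc.2 _ e
        · exact hc.2 _ e
      · intro z rz kz
        by_contra hz
        have := B _ _ rz r' hz
        have := kz.symm
        have := ky'.symm
        tauto
  obtain ⟨ii, ik, kyj, uy'⟩ := main
  refine h.rc H k fun m x hm hx => ?_
  have hmj : m = j := by
    rcases fin3_all h1 h2 h3 m with rfl | rfl | rfl
    · rw [mi.2 x hm] at hx; exact absurd hx h3
    · rfl
    · rw [mk.2 x hm] at hx; exact absurd hx h2
  subst hmj
  cases uj x yj hm rj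
  refine ⟨i, h2, fun n hn => ?_⟩
  by_contra hc
  push Not at hc
  obtain ⟨c1, c2, c3⟩ := hc
  have nw : n ≠ w := by rintro rfl; exact (h.Rc H rj).2.2.2.1 hn
  have nyk : ¬ G.Adj n yk := fun e => h.stR H rk e (by rw [c3, mk.2 _ rk])
  have npi : ¬ G.Adj n (p i) := by
    intro e
    cases h.star i n qi ⟨e.symm, nw, c1⟩ hi
    exact c2 ii
  have npk : ¬ G.Adj n (p k) := by
    intro e
    cases h.star k n qk ⟨e.symm, nw, c1⟩ hk
    exact c2 ik
  obtain ⟨m, m1, m2, m3⟩ := H.deg3 n yj y'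
  refine T2 H iyj.symm hn rj.1.symm kyj.symm (by rintro rfl; exact hk.2.2 _ rfl) iyk m1 nyk ?_ (nk _ rk) ?_ ?_ ?_
  · intro e
    exact nzM mk mj h2 _ rk ⟨e, rk.2⟩
  · intro e
    rcases h.innN H h1 h2 h3 hi ni ii e with e | e | e
    · exact npi (e ▸ m1)
    · exact m2 (uj _ _ e rj)
    · rw [uk _ _ e rk] at m1; exact nyk m1
  · intro e
    rcases (h.no _ i k h1.symm h3 h2 m).1 e with e | e | e
    · exact npi (e ▸ m1)
    · exact npk (e ▸ m1)
    · exact m2 (uj _ _ e rj)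
  · intro e
    rcases h.innN H h2.symm h3.symm h1 hk nk ik e with e' | e' | e'
    · exact npk (e' ▸ m1)
    · exact m3 (uy' _ e' e)
    · exact m2 (uj _ _ e' rj)
end CB

set_option linter.unusedVariables false

structure SS {V : Type} (G : SimpleGraph V) (φ : V → Fin 3) (w p1 p2 p3 : V) : Prop where
  ls : LS G φ w p1 p2 p3
  c1 : ∃ a, a ≠ w ∧ G.Adj p2 a ∧ G.Adj p3 a
  c2 : ∃ a, a ≠ w ∧ G.Adj p1 a ∧ G.Adj p3 a
  c3 : ∃ a, a ≠ w ∧ G.Adj p1 a ∧ G.Adj p2 a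
  s1 : ∀ q q', G.Adj p1 q → G.Adj p1 q' → ¬ G.Adj p2 q → ¬ G.Adj p2 q' → ¬ G.Adj p3 q → ¬ G.Adj p3 q' → q = q'
  s2 : ∀ q q', G.Adj p2 q → G.Adj p2 q' → ¬ G.Adj p1 q → ¬ G.Adj p1 q' → ¬ G.Adj p3 q → ¬ G.Adj p3 q' → q = q'
  s3 : ∀ q q', G.Adj p3 q → G.Adj p3 q' → ¬ G.Adj p1 q → ¬ G.Adj p1 q' → ¬ G.Adj p2 q → ¬ G.Adj p2 q' → q = q'

namespace SS
variable {V : Type} {G : SimpleGraph V} {φ : V → Fin 3} {w p1 p2 p3 : V}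

theorem rot (h : SS G φ w p1 p2 p3) : SS G φ w p2 p3 p1 where
  ls := h.ls.rot
  c1 := by obtain ⟨a, b, c, d⟩ := h.c2; exact ⟨a, b, d, c⟩
  c2 := by obtain ⟨a, b, c, d⟩ := h.c3; exact ⟨a, b, d, c⟩
  c3 := h.c1
  s1 := fun q q' a b c d e f => h.s2 q q' a b e f c d
  s2 := fun q q' a b c d e f => h.s3 q q' a b e f c d
  s3 := fun q q' a b c d e f => h.s1 q q' a b c d e f

theorem sw (h : SS G φ w p1 p2 p3) : SS G φ w p2 p1 p3 where
  ls := h.ls.sw12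
  c1 := h.c2
  c2 := h.c1
  c3 := by obtain ⟨a, b, c, d⟩ := h.c3; exact ⟨a, b, d, c⟩
  s1 := fun q q' a b c d e f => h.s2 q q' a b c d e f
  s2 := fun q q' a b c d e f => h.s1 q q' a b c d e f
  s3 := fun q q' a b c d e f => h.s3 q q' a b e f c d

theorem rec2 (h : SS G φ w p1 p2 p3) (H : Crit G)
    (hb : ∀ b y, b ≠ w → G.Adj p1 b → G.Adj p3 b → G.Adj b y → y ≠ p3 → φ y ≠ φ p3)
    (hq : ∀ q, G.Adj p3 q → ¬ G.Adj p1 q → ¬ G.Adj p2 q → φ q ≠ φ p2) : False := by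
  classical
  obtain ⟨sy, tri, ir⟩ := H.ctx
  obtain ⟨st, nb, a1, a2, a3, n12, n13, n23, cov, m12, m13, m23⟩ := h.ls.ctx H
  clear tri
  have d : ∀ b b', G.Adj p3 b → G.Adj p3 b' → ¬ G.Adj b b' := fun b b' => H.nadj_of_common
  have ne : p1 ≠ p3 := by rintro rfl; exact n13 rfl
  have hbw : ∀ b, b ≠ w → G.Adj p1 b → ¬ G.Adj w b := fun b _ e => H.nadj_of_common a1.symm e
  refine recol H h.ls.st (fun z => if z = w then φ p3 else if z = p3 then φ p2 else if G.Adj p1 z ∧ G.Adj p3 z then φ p3 else φ z) ?_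
  intro a ha c hac
  have := hb a c
  have := hbw a
  have := hbw c
  have := d a c
  have := hq c
  have := st p2 c
  have := st p3 c
  have := st p3 a
  have := st a c
  have := (nb a).1
  have := (nb c).1
  have := st p1 p3
  have e3 : p3 ≠ w := a3.ne'
  have e2 : p2 ≠ p3 := by rintro rfl; exact n23 rfl
  clear hb hbw d hq st nb
  by_cases haw : a = w
  · subst haw
    clear ha
    grind
  by_cases ha3 : a = p3
  · subst ha3
    clear ha
    grind
  grind

theorem single (h : SS G φ w p1 p2 p3) (H : Crit G) {f f' z z' b : V} (hf : G.Adj p1 f) (hf2 : G.Adj p2 f) (hw : f ≠ w)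
    (hf' : G.Adj p1 f') (hf2' : G.Adj p2 f') (hw' : f' ≠ w) (hz : G.Adj f z) (nz : ¬ G.Adj f' z)
    (hz' : G.Adj f' z') (nz' : ¬ G.Adj f z') (hb1 : G.Adj p1 b) (hb2 : G.Adj p3 b) (hbw : b ≠ w) (hzb : G.Adj b z) : False := by
  obtain ⟨sy, tri, ir⟩ := H.ctx
  obtain ⟨st, nb, a1, a2, a3, n12, n13, n23, cov, m12, m13, m23⟩ := h.ls.ctx H
  clear tri
  have c3 : ∀ f, G.Adj p1 f → G.Adj p2 f → f ≠ w → φ f = φ p3 := by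
    intro f a b c
    have := st p1 f; have := st p2 f; have := cov f
    grind
  have c2 : ∀ f, G.Adj p1 f → G.Adj p3 f → f ≠ w → φ f = φ p2 := by
    intro f a b c
    have := st p1 f; have := st p3 f; have := cov f
    grind
  have c1 : ∀ f, G.Adj p2 f → G.Adj p3 f → f ≠ w → φ f = φ p1 := by
    intro f a b c
    have := st p2 f; have := st p3 f; have := cov f
    grind
  have wn : ∀ f y, G.Adj p1 f → f ≠ w → G.Adj f y → y ≠ w := by
    rintro f y a b c rfl
    exact H.tri _ _ _ a c a1.symm
  have wn2 : ∀ f y, G.Adj p2 f → f ≠ w → G.Adj f y → y ≠ w := by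
    rintro f y a b c rfl
    exact H.tri _ _ _ a c a2.symm
  have cf := c3 f hf hf2 hw
  have cf' := c3 f' hf' hf2' hw'
  have nf3 : ¬ G.Adj f p3 := by have := st f p3; grind
  have nf3' : ¬ G.Adj f' p3 := by have := st f' p3; grind
  have zw : ¬ G.Adj w z := by have := (nb z).1; grind
  have zw' : ¬ G.Adj w z' := by have := (nb z').1; grind
  have fB : ∀ b, G.Adj p1 b → G.Adj p3 b → b ≠ w → G.Adj b z ∨ G.Adj b z' := by
    intro b e1 e2 e3
    have := H.F p1 f z f' z' w b
    grind
  have fA : ∀ b, G.Adj p2 b → G.Adj p3 b → b ≠ w → G.Adj b z ∨ G.Adj b z' := by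
    intro b e1 e2 e3
    have := H.F p2 f z f' z' w b
    grind
  have z0 := wn f z hf hw hz
  have z0' := wn f' z' hf' hw' hz'
  have cz : φ z = φ p1 := by
    have := c2 b hb1 hb2 hbw
    have := st b z; have := st f z; have := cov z
    grind
  have aA : ∀ a, G.Adj p2 a → G.Adj p3 a → a ≠ w → ¬ G.Adj a z ∧ G.Adj a z' := by
    intro a e1 e2 e3
    have := fA a e1 e2 e3
    have := c1 a e1 e2 e3
    have := st a z
    grind
  have cz' : φ z' = φ p2 := by
    obtain ⟨a, e1, e2, e3⟩ := h.c1
    have := aA a e2 e3 e1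
    have := c1 a e2 e3 e1
    have := st a z'; have := st f' z'; have := cov z'
    grind
  have bB : ∀ a, G.Adj p1 a → G.Adj p3 a → a ≠ w → G.Adj a z ∧ ¬ G.Adj a z' := by
    intro a e1 e2 e3
    have := fB a e1 e2 e3
    have := c2 a e1 e2 e3
    have := st a z'
    grind
  have k1 : ∀ b y, b ≠ w → G.Adj p1 b → G.Adj p3 b → G.Adj b y → y ≠ p3 → φ y ≠ φ p3 := by
    intro b y e1 e2 e3 e4 e5 e6
    have := bB b e2 e3 e1
    have := wn b y e2 e1 e4
    have := H.F p1 f' z' b y w f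
    have := (nb y).1
    have := st y f
    have := st y f'
    clear nb st
    grind
  have k2 : ∀ b y, b ≠ w → G.Adj p2 b → G.Adj p3 b → G.Adj b y → y ≠ p3 → φ y ≠ φ p3 := by
    intro b y e1 e2 e3 e4 e5 e6
    have := aA b e2 e3 e1
    have := wn2 b y e2 e1 e4
    have := H.F p2 f z b y w f'
    have := (nb y).1
    have := st y f
    have := st y f'
    clear nb st
    grind
  by_cases Q : ∀ q, G.Adj p3 q → ¬ G.Adj p1 q → ¬ G.Adj p2 q → φ q ≠ φ p2
  · exact h.rec2 H k1 Q
  · push Not at Q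
    obtain ⟨q, q1, q2, q3, q4⟩ := Q
    refine h.sw.rec2 H k2 ?_
    intro q' q1' q3' q2' e
    have := h.s3 q q' q1 q1' q2 q2' q3 q3'
    subst this
    exact n12 (by rw [← e, q4])

theorem singl (h : SS G φ w p1 p2 p3) (H : Crit G) {f f' : V} (hf : G.Adj p1 f) (hf2 : G.Adj p2 f) (hw : f ≠ w)
    (hf' : G.Adj p1 f') (hf2' : G.Adj p2 f') (hw' : f' ≠ w) : f = f' := by
  by_contra hne
  obtain ⟨z, hz, nz⟩ := H.inc f f' hne
  obtain ⟨z', hz', nz'⟩ := H.inc f' f (Ne.symm hne)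
  obtain ⟨b, b1, b2, b3⟩ := h.c2
  obtain ⟨sy, tri, ir⟩ := H.ctx
  obtain ⟨st, nb, a1, a2, a3, n12, n13, n23, cov, m12, m13, m23⟩ := h.ls.ctx H
  clear tri
  have c3 : ∀ f, G.Adj p1 f → G.Adj p2 f → f ≠ w → φ f = φ p3 := by
    intro f a b c
    have := st p1 f; have := st p2 f; have := cov f
    grind
  have cf := c3 f hf hf2 hw
  have cf' := c3 f' hf' hf2' hw'
  have nf3 : ¬ G.Adj f p3 := by have := st f p3; grind
  have nf3' : ¬ G.Adj f' p3 := by have := st f' p3; grind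
  have zw : ¬ G.Adj w z := by have := (nb z).1; grind
  have zw' : ¬ G.Adj w z' := by have := (nb z').1; grind
  have : G.Adj b z ∨ G.Adj b z' := by
    have := H.F p1 f z f' z' w b
    grind
  rcases this with e | e
  · exact h.single H hf hf2 hw hf' hf2' hw' hz nz hz' nz' b2 b3 b1 e
  · exact h.single H hf' hf2' hw' hf hf2 hw hz' nz' hz nz b2 b3 b1 e
end SS

set_option linter.unusedVariables false

theorem SS.cb {V : Type} {G : SimpleGraph V} {φ : V → Fin 3} {w p1 p2 p3 : V} (h : SS G φ w p1 p2 p3) (H : Crit G) : False := by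
  obtain ⟨o1, u1, v1, w1⟩ := h.c1
  obtain ⟨o2, u2, v2, w2⟩ := h.c2
  obtain ⟨o3, u3, v3, w3⟩ := h.c3
  have U1 : ∀ f, f ≠ w → G.Adj p2 f → G.Adj p3 f → f = o1 := fun f a b c => h.rot.singl H b c a v1 w1 u1
  have U2 : ∀ f, f ≠ w → G.Adj p1 f → G.Adj p3 f → f = o2 := fun f a b c => h.rot.rot.singl H c b a w2 v2 u2
  have U3 : ∀ f, f ≠ w → G.Adj p1 f → G.Adj p2 f → f = o3 := fun f a b c => h.singl H b c a v3 w3 u3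
  obtain ⟨st, nb, a1, a2, a3, n12, n13, n23, cov, m12, m13, m23⟩ := h.ls.ctx H
  have k1 : φ o1 = φ p1 := by have := st p2 o1; have := st p3 o1; have := cov o1; have := a2.ne'; have := a3.ne'; grind
  have k2 : φ o2 = φ p2 := by have := st p1 o2; have := st p3 o2; have := cov o2; have := a1.ne'; have := a3.ne'; grind
  have k3 : φ o3 = φ p3 := by have := st p2 o3; have := st p1 o3; have := cov o3; have := a2.ne'; have := a1.ne'; grind
  have sel : ∀ x y z : V, ∃ p : Fin 3 → V, p (φ p1) = x ∧ p (φ p2) = y ∧ p (φ p3) = z := by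
    intro x y z
    refine ⟨fun i => if i = φ p1 then x else if i = φ p2 then y else z, by simp, by simp [n12.symm], by simp [n13.symm, n23.symm]⟩
  obtain ⟨p, e1, e2, e3⟩ := sel p1 p2 p3
  obtain ⟨o, f1, f2, f3⟩ := sel o1 o2 o3
  have C := h.ls.cov
  refine CB.absurdity (φ := φ) (w := w) (p := p) (o := o) ⟨h.ls.st, ?_, ?_, ?_, ?_, ?_, ?_, ?_⟩ H
  · intro x
    rw [nb]
    constructor
    · rintro (rfl | rfl | rfl)
      · exact ⟨_, e1.symm⟩
      · exact ⟨_, e2.symm⟩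
      · exact ⟨_, e3.symm⟩
    · rintro ⟨i, rfl⟩
      rcases C i with rfl | rfl | rfl <;> simp [e1, e2, e3]
  · intro i
    rcases C i with rfl | rfl | rfl <;> simp [e1, e2, e3]
  · intro i
    rcases C i with rfl | rfl | rfl <;> simp [f1, f2, f3, k1, k2, k3]
  · intro i
    rcases C i with rfl | rfl | rfl <;> simp [f1, f2, f3, u1, u2, u3]
  · intro i j hij
    rcases C i with rfl | rfl | rfl <;> rcases C j with rfl | rfl | rfl <;> simp [e1, e2, e3, f1, f2, f3, *] <;> exact (hij rfl).elim
  · intro i j x hij hi hj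
    by_cases xw : x = w
    · exact Or.inl xw
    right
    rcases C i with rfl | rfl | rfl <;> rcases C j with rfl | rfl | rfl <;> simp only [e1, e2, e3] at hi hj
    · exact absurd rfl hij
    · exact ⟨_, (U3 x xw hi hj).trans f3.symm⟩
    · exact ⟨_, (U2 x xw hi hj).trans f2.symm⟩
    · exact ⟨_, (U3 x xw hj hi).trans f3.symm⟩
    · exact absurd rfl hij
    · exact ⟨_, (U1 x xw hi hj).trans f1.symm⟩
    · exact ⟨_, (U2 x xw hj hi).trans f2.symm⟩
    · exact ⟨_, (U1 x xw hj hi).trans f1.symm⟩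
    · exact absurd rfl hij
  · rintro i q q' ⟨A1, A2, A3⟩ ⟨B1, B2, B3⟩
    have x1 : q ≠ o1 := f1 ▸ A3 _
    have x2 : q ≠ o2 := f2 ▸ A3 _
    have x3 : q ≠ o3 := f3 ▸ A3 _
    have y1 : q' ≠ o1 := f1 ▸ B3 _
    have y2 : q' ≠ o2 := f2 ▸ B3 _
    have y3 : q' ≠ o3 := f3 ▸ B3 _
    rcases C i with rfl | rfl | rfl <;> simp only [e1, e2, e3] at A1 B1
    · exact h.s1 q q' A1 B1 (fun e => x3 (U3 _ A2 A1 e)) (fun e => y3 (U3 _ B2 B1 e)) (fun e => x2 (U2 _ A2 A1 e)) (fun e => y2 (U2 _ B2 B1 e))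
    · exact h.s2 q q' A1 B1 (fun e => x3 (U3 _ A2 e A1)) (fun e => y3 (U3 _ B2 e B1)) (fun e => x1 (U1 _ A2 A1 e)) (fun e => y1 (U1 _ B2 B1 e))
    · exact h.s3 q q' A1 B1 (fun e => x2 (U2 _ A2 e A1)) (fun e => y2 (U2 _ B2 e B1)) (fun e => x1 (U1 _ A2 e A1)) (fun e => y1 (U1 _ B2 e B1))

/-- a low vertex has at most one high neighbour -/
theorem twoHigh {V : Type} {G : SimpleGraph V} (H : Crit G) {w p1 p2 : V} (hw : Low G w) (h1 : G.Adj w p1) (h2 : G.Adj w p2)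
    (hne : p1 ≠ p2) (H1 : ¬ Low G p1) (H2 : ¬ Low G p2) : False := by
  have : ∃ p3, ∀ x, G.Adj w x ↔ x = p1 ∨ x = p2 ∨ x = p3 := by
    obtain ⟨a, b, c, hx⟩ := hw
    have y1 := (hx _).1 h1
    have y2 := (hx _).1 h2
    rcases y1 with rfl | rfl | rfl <;> rcases y2 with rfl | rfl | rfl
    · exact absurd rfl hne
    · exact ⟨c, fun x => by rw [hx]⟩
    · exact ⟨b, fun x => by rw [hx]; tauto⟩
    · exact ⟨c, fun x => by rw [hx]; tauto⟩
    · exact absurd rfl hne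
    · exact ⟨a, fun x => by rw [hx]; tauto⟩
    · exact ⟨b, fun x => by rw [hx]; tauto⟩
    · exact ⟨a, fun x => by rw [hx]; tauto⟩
    · exact absurd rfl hne
  obtain ⟨p3, nb⟩ := this
  obtain ⟨φ, hφ⟩ := H.crit w
  have S := exLS H nb hφ
  obtain ⟨b, c, b1, c1, b2, b3, c2, c3, k1, k2, s1⟩ := good H S H1
  obtain ⟨b', a, b1', a1, b2', b3', a2, a3, k1', k2', s2⟩ := good H S.rot H2
  refine SS.cb (φ := φ) (w := w) (p1 := p1) (p2 := p2) (p3 := p3) ⟨S, ⟨a, a1, a2, a3⟩, ⟨b, b1, b2, b3⟩, ⟨c, c1, c2, c3⟩, s1,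
    fun q q' x1 x2 x3 x4 x5 x6 => s2 q q' x1 x2 x5 x6 x3 x4, ?_⟩ H
  by_cases H3 : Low G p3
  · intro q q' x1 x2 x3 x4 x5 x6
    obtain ⟨t1, t2, t3, ht⟩ := H3
    have y1 := (ht w).1 S.a3.symm
    have y2 := (ht a).1 a3
    have y3 := (ht b).1 b3
    have y4 := (ht q).1 x1
    have y5 : a ≠ b := by rintro rfl; exact S.n12 (by rw [← k2', k1])
    have z1 : q ≠ w := by rintro rfl; exact x3 S.a1.symm
    have z2 : q ≠ a := by rintro rfl; exact x5 a2
    have z3 : q ≠ b := by rintro rfl; exact x3 b2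
    clear * - y1 y2 y3 y4 y5 z1 z2 z3 a1 b1
    grind
  · obtain ⟨-, -, -, -, -, -, -, -, -, -, s3⟩ := good H S.rot.rot H3
    exact s3

set_option linter.unusedVariables false

theorem low3 {V : Type} {G : SimpleGraph V} (H : Crit G) {u a b : V} (h : Low G u) (ha : G.Adj u a) (hb : G.Adj u b) (hab : a ≠ b) :
    ∃ c, c ≠ a ∧ c ≠ b ∧ ∀ x, G.Adj u x ↔ x = a ∨ x = b ∨ x = c := by
  obtain ⟨c, c1, c2, c3⟩ := H.deg3 u a b
  refine ⟨c, c2, c3, fun x => ?_⟩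
  obtain ⟨t1, t2, t3, ht⟩ := h
  rw [ht] at *
  grind

/-- low vertex with exactly one high neighbour -/
structure OH {V : Type} (G : SimpleGraph V) (φ : V → Fin 3) (w p1 p2 p3 b f q h2 h3 : V) : Prop where
  ls : LS G φ w p1 p2 p3
  np1 : ∀ x, G.Adj p1 x ↔ x = w ∨ x = b ∨ x = f ∨ x = q
  np2 : ∀ x, G.Adj p2 x ↔ x = w ∨ x = f ∨ x = h2
  np3 : ∀ x, G.Adj p3 x ↔ x = w ∨ x = b ∨ x = h3
  cb : φ b = φ p2
  cf : φ f = φ p3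
  ch2 : φ h2 = φ p1
  ch3 : φ h3 = φ p1
  bw : b ≠ w
  fw : f ≠ w
  qw : q ≠ w
  h2w : h2 ≠ w
  h3w : h3 ≠ w
  qb : q ≠ b
  qf : q ≠ f
  hi : ¬ Low G p1

theorem OH.sw {V : Type} {G : SimpleGraph V} {φ : V → Fin 3} {w p1 p2 p3 b f q h2 h3 : V} (h : OH G φ w p1 p2 p3 b f q h2 h3) :
    OH G φ w p1 p3 p2 f b q h3 h2 where
  ls := h.ls.sw23
  np1 := fun x => by rw [h.np1]; tauto
  np2 := h.np3
  np3 := h.np2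
  cb := h.cf
  cf := h.cb
  ch2 := h.ch3
  ch3 := h.ch2
  bw := h.fw
  fw := h.bw
  qw := h.qw
  h2w := h.h3w
  h3w := h.h2w
  qb := h.qf
  qf := h.qb
  hi := h.hi

/-- colour of the third neighbour of `p2` -/
theorem ch2 {V : Type} {G : SimpleGraph V} (H : Crit G) {φ : V → Fin 3} {w p1 p2 p3 f h2 : V} (S : LS G φ w p1 p2 p3)
    (np2 : ∀ x, G.Adj p2 x ↔ x = w ∨ x = f ∨ x = h2) (hw : h2 ≠ w) (hf : φ f = φ p3) : φ h2 = φ p1 := by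
  classical
  obtain ⟨sy, -, ir⟩ := H.ctx
  obtain ⟨st, nb, a1, a2, a3, n12, n13, n23, cov, m12, m13, m23⟩ := S.ctx H
  by_contra hc
  have c1 : φ h2 = φ p3 := by have := st p2 h2; have := cov h2; have := a2.ne'; grind
  refine recol H S.st (fun z => if z = w then φ p2 else if z = p2 then φ p1 else φ z) ?_
  intro a ha c hac
  have := (nb c).1
  have := (np2 c).1
  have := a2.ne'
  grind

theorem exOH {V : Type} {G : SimpleGraph V} (H : Crit G) {φ : V → Fin 3} {w p1 p2 p3 : V} (S : LS G φ w p1 p2 p3) (hw : Low G w)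
    (hi : ¬ Low G p1) : ∃ b f q h2 h3, OH G φ w p1 p2 p3 b f q h2 h3 := by
  obtain ⟨sy, -, ir⟩ := H.ctx
  obtain ⟨st, nb, a1, a2, a3, n12, n13, n23, cov, m12, m13, m23⟩ := S.ctx H
  have l2 : Low G p2 := by
    by_contra h
    exact twoHigh H hw a1 a2 (by rintro rfl; exact n12 rfl) hi h
  have l3 : Low G p3 := by
    by_contra h
    exact twoHigh H hw a1 a3 (by rintro rfl; exact n13 rfl) hi h
  obtain ⟨b, f, bw, fw, b1, b3, f1, f2, cb, cf, s⟩ := good H S hi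
  obtain ⟨h2, h2w, h2f, np2⟩ := low3 H l2 a2.symm f2 fw.symm
  obtain ⟨h3, h3w, h3b, np3⟩ := low3 H l3 a3.symm b3 bw.symm
  have c2 := ch2 H S np2 h2w cf
  have c3 := ch2 H S.sw23 np3 h3w cb
  have hbf : b ≠ f := by rintro rfl; exact n23 (by rw [← cb, cf])
  obtain ⟨q, q1, q2, q3, q4⟩ := high4 hi a1.symm b1 f1
  have nq : ∀ x, G.Adj p1 x → x ≠ w → φ x ≠ φ p1 := by
    intro x hx hxw
    have := st p1 x
    have := a1.ne'
    grind
  refine ⟨b, f, q, h2, h3, S, ?_, np2, np3, cb, cf, c2, c3, bw, fw, q2, h2w, h3w, q3, q4, hi⟩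
  intro x
  constructor
  · intro hx
    by_contra hc
    push Not at hc
    obtain ⟨y1, y2, y3, y4⟩ := hc
    apply y4
    have := nq x hx y1
    have := nq q q1 q2
    have f2 := fun y => (np2 y).1
    have f3 := fun y => (np3 y).1
    apply s x q hx q1 <;> intro e
    · have := f2 _ e; grind
    · have := f2 _ e; grind
    · have := f3 _ e; grind
    · have := f3 _ e; grind
  · rintro (rfl | rfl | rfl | rfl)
    · exact a1.symm
    · exact b1
    · exact f1
    · exact q1

set_option linter.unusedVariables false

theorem OH.ctx {V : Type} {G : SimpleGraph V} (H : Crit G) {φ : V → Fin 3} {w p1 p2 p3 b f q h2 h3 : V} (h : OH G φ w p1 p2 p3 b f q h2 h3) :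
    p1 ≠ w ∧ p2 ≠ w ∧ p3 ≠ w ∧ p1 ≠ p2 ∧ p1 ≠ p3 ∧ p2 ≠ p3 ∧ b ≠ f ∧ φ q ≠ φ p1 ∧ G.Adj p1 b ∧ G.Adj p1 f ∧ G.Adj p1 q ∧
    G.Adj p2 f ∧ G.Adj p2 h2 ∧ G.Adj p3 b ∧ G.Adj p3 h3 ∧ ¬ G.Adj w b ∧ ¬ G.Adj w f ∧ ¬ G.Adj w q ∧ ¬ G.Adj p2 b ∧ ¬ G.Adj p2 q ∧
    ¬ G.Adj p3 f ∧ ¬ G.Adj p3 q ∧ ¬ G.Adj b f ∧ ¬ G.Adj b q ∧ ¬ G.Adj f q := by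
  obtain ⟨sy, -, ir⟩ := H.ctx
  obtain ⟨st, nb, a1, a2, a3, n12, n13, n23, cov, m12, m13, m23⟩ := h.ls.ctx H
  have x1 := (h.np1 b).2 (by simp)
  have x2 := (h.np1 f).2 (by simp)
  have x3 := (h.np1 q).2 (by simp)
  have x4 := (h.np2 f).2 (by simp)
  have x5 := (h.np2 h2).2 (by simp)
  have x6 := (h.np3 b).2 (by simp)
  have x7 := (h.np3 h3).2 (by simp)
  have cb := h.cb
  have cf := h.cf
  have ch2 := h.ch2
  have ch3 := h.ch3
  have u1 := h.bw
  have u2 := h.fw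
  have u3 := h.qw
  have u4 := h.h2w
  have u5 := h.h3w
  have u6 := h.qb
  have u7 := h.qf
  have := a1.ne'
  have := a2.ne'
  have := a3.ne'
  have cq : φ q ≠ φ p1 := by have := st p1 q; grind
  refine ⟨a1.ne', a2.ne', a3.ne', ?_, ?_, ?_, ?_, cq, x1, x2, x3, x4, x5, x6, x7, H.nadj_of_common a1.symm x1, H.nadj_of_common a1.symm x2,
    H.nadj_of_common a1.symm x3, ?_, ?_, ?_, ?_, H.nadj_of_common x1 x2, H.nadj_of_common x1 x3, H.nadj_of_common x2 x3⟩
  · grind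
  · grind
  · grind
  · grind
  · rw [h.np2]; grind
  · rw [h.np2]; grind
  · rw [h.np3]; grind
  · rw [h.np3]; grind

theorem OH.flow {V : Type} {G : SimpleGraph V} (H : Crit G) {φ : V → Fin 3} {w p1 p2 p3 b f q h2 h3 : V} (h : OH G φ w p1 p2 p3 b f q h2 h3)
    (fl : Low G f) : False := by
  classical
  obtain ⟨sy, -, ir⟩ := H.ctx
  obtain ⟨st, nb, a1, a2, a3, n12, n13, n23, cov, m12, m13, m23⟩ := h.ls.ctx H
  obtain ⟨e1, e2, e3, e4, e5, e6, e7, e8, e9, e10, e11, e12, e13, e14, e15, e16, e17, e18, e19, e20, e21, e22, e23, e24, e25⟩ := OH.ctx H h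
  obtain ⟨-, np1, np2, np3, cb, cf, ch2, ch3, bw, fw, qw, h2w, h3w, qb, qf, hi⟩ := id h
  obtain ⟨x, xp1, xp2, nf⟩ := low3 H fl e10.symm e12.symm e4
  have fx : G.Adj f x := (nf x).2 (by simp)
  have xl : Low G x := by
    by_contra hh
    exact twoHigh H fl e10.symm fx xp1.symm hi hh
  have xw : x ≠ w := by rintro rfl; exact e17 fx.symm
  have cx3 : φ x ≠ φ p3 := by have := st f x; grind
  have fp1 : f ≠ p1 := e10.ne'
  have fp2 : f ≠ p2 := e12.ne'
  have cx : φ x = φ p2 := by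
    by_contra hc
    refine recol H h.ls.st (fun z => if z = w then φ p2 else if z = p2 then φ p3 else if z = f then φ p2 else φ z) ?_
    intro a ha c hac
    have := (nb c).1
    have := (np2 c).1
    have := (nf c).1
    have := cov x
    clear np1 np2 np3 nf nb st cov
    grind
  have cq : φ q = φ p3 := by
    by_contra hc
    refine recol H h.ls.st (fun z => if z = w then φ p1 else if z = f then φ p1 else if z = p1 then φ p3 else φ z) ?_
    intro a ha c hac
    have := (nb c).1
    have := (np1 c).1
    have := (nf c).1
    have := cov q
    clear np1 np2 np3 nf nb st cov
    grind
  have xb : ¬ G.Adj x b := by have := st x b; grind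
  have xnw : ¬ G.Adj x w := by
    intro e
    have := (nb x).1 e.symm
    grind
  have xq : G.Adj x q := by
    obtain ⟨φ', hφ'⟩ := H.crit f
    have S' := exLS H nf hφ'
    obtain ⟨u, u', u1, -, u2, u3, -⟩ := good H S' hi
    have := (np1 u).1 u2
    grind
  obtain ⟨r, rf, rq, nx⟩ := low3 H xl fx.symm xq qf.symm
  have rw' : r ≠ w := by rintro rfl; exact xnw ((nx r).2 (by simp))
  have xr : G.Adj x r := (nx r).2 (by simp)
  have cr2 : φ r ≠ φ p2 := by have := st x r; grind
  have xf : x ≠ f := fx.ne'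
  have cr : φ r = φ p1 := by
    by_contra hc
    refine recol H h.ls.st (fun z => if z = w then φ p2 else if z = x then φ p1 else if z = f then φ p2 else if z = p2 then φ p3 else φ z) ?_
    intro a ha c hac
    have := (nb c).1
    have := (np2 c).1
    have := (nf c).1
    have := (nx c).1
    have := cov r
    clear np1 np2 np3 nf nb st cov nx
    grind
  have key : (∀ y, G.Adj b y → y ≠ p1 → y ≠ p3 → G.Adj q y) ∨ (∀ t, G.Adj q t → t ≠ p1 → t ≠ x → G.Adj b t) := by
    by_contra hc
    push Not at hc
    obtain ⟨⟨y, y1, y2, y3, y4⟩, t, t1, t2, t3, t4⟩ := hc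
    have := H.F p1 q t b y w f
    have := (nb y).1
    have := (nb t).1
    have := (nf y).1
    have := (nf t).1
    clear np1 np2 np3 nf nb st cov nx
    grind
  have qx : q ≠ x := xq.ne'
  have qp1 : q ≠ p1 := e11.ne'
  have bp1 : b ≠ p1 := e9.ne'
  have bp3 : b ≠ p3 := e14.ne'
  have bx : b ≠ x := by rintro rfl; exact e23 fx.symm
  have h3b : h3 ≠ b := by grind
  have p3f : p3 ≠ f := by rintro rfl; exact e17 a3
  have p3q : p3 ≠ q := by rintro rfl; exact e18 a3
  have p1x : ¬ G.Adj p1 x := H.nadj_of_common e10.symm fx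
  have p2x : ¬ G.Adj p2 x := H.nadj_of_common e12.symm fx
  have qp2 : q ≠ p2 := by rintro rfl; exact e18 a2
  rcases key with key | key
  · have cy : ∀ y, G.Adj b y → y ≠ p1 → y ≠ p3 → φ y = φ p1 := by
      intro y y1 y2 y3
      have := key y y1 y2 y3
      have := st q y
      have := st b y
      have : y ≠ w := by rintro rfl; exact e16 y1.symm
      have := cov y
      grind
    refine recol H h.ls.st (fun z => if z = w then φ p3 else if z = b then φ p3 else if z = p3 then φ p2 else φ z) ?_
    intro a ha c hac
    have := (nb c).1
    have := (np3 c).1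
    have := cy c
    clear np1 np2 np3 nf nb st cov nx key cy
    grind
  · have cy : ∀ y, G.Adj q y → y ≠ p1 → y ≠ x → φ y = φ p1 := by
      intro y y1 y2 y3
      have := key y y1 y2 y3
      have := st q y
      have := st b y
      have : y ≠ w := by rintro rfl; exact e18 y1.symm
      have := cov y
      grind
    refine recol H h.ls.st (fun z => if z = w then φ p1 else if z = p1 then φ p3 else if z = f then φ p1 else if z = q then φ p2 else if z = x then φ p3 else φ z) ?_
    intro a ha c hac
    have := (nb c).1
    have := (np1 c).1
    have := (nf c).1
    have := (nx c).1
    have := cy c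
    clear np1 np2 np3 nf nb st cov nx key cy
    have x3 : x ≠ p3 := by grind
    have rx : r ≠ x := xr.ne'
    have rp1 : r ≠ p1 := by rintro rfl; exact p1x xr.symm
    have ha' : a = w ∨ a = p1 ∨ a = f ∨ a = q ∨ a = x := by
      clear this
      grind
    clear ha
    rcases ha' with rfl | rfl | rfl | rfl | rfl
    · grind
    · grind
    · grind
    · grind
    · grind

set_option linter.unusedVariables false

theorem OH.at2 {V : Type} {G : SimpleGraph V} (H : Crit G) {φ : V → Fin 3} {w p1 p2 p3 b f q h2 h3 : V} (h : OH G φ w p1 p2 p3 b f q h2 h3)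
    (fl : ¬ Low G f) : ∃ x e m, (∀ y, G.Adj f y ↔ y = p2 ∨ y = p1 ∨ y = x ∨ y = e) ∧ (∀ y, G.Adj h2 y ↔ y = p2 ∨ y = x ∨ y = m) ∧
      x ≠ p1 ∧ x ≠ p2 ∧ e ≠ p1 ∧ e ≠ p2 ∧ e ≠ x := by
  obtain ⟨e1, e2, e3, e4, e5, e6, e7, e8, e9, e10, e11, e12, e13, e14, e15, e16, e17, e18, e19, e20, e21, e22, e23, e24, e25⟩ := OH.ctx H h
  obtain ⟨φ', hφ'⟩ := H.crit p2
  have S' : LS G φ' p2 f w h2 := exLS H (fun x => by rw [h.np2]; tauto) hφ'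
  obtain ⟨x, f', e, h2', m, O⟩ := exOH H S' ⟨_, _, _, h.np2⟩ fl
  have c := OH.ctx H O
  have : f' = p1 := by
    have := (h.ls.nb f').1 ((O.np2 _).2 (by simp))
    have := (O.np1 f').2 (by simp)
    rcases ‹f' = p1 ∨ _› with r | r | r
    · exact r
    · exact absurd r O.fw
    · rw [r] at this
      exact absurd this.symm e21
  subst this
  refine ⟨x, e, m, fun y => ?_, O.np3, ?_, O.bw, O.qf, O.qw, O.qb⟩
  · rw [O.np1]; tauto
  · exact c.2.2.2.2.2.2.1

theorem OH.high {V : Type} {G : SimpleGraph V} (H : Crit G) {φ : V → Fin 3} {w p1 p2 p3 b f q h2 h3 : V} (h : OH G φ w p1 p2 p3 b f q h2 h3)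
    (fl : ¬ Low G f) (bl : ¬ Low G b) (cq : φ q = φ p3) : False := by
  classical
  obtain ⟨sy, -, ir⟩ := H.ctx
  obtain ⟨st, nb, a1, a2, a3, n12, n13, n23, cov, m12, m13, m23⟩ := h.ls.ctx H
  obtain ⟨e1, e2, e3, e4, e5, e6, e7, e8, e9, e10, e11, e12, e13, e14, e15, e16, e17, e18, e19, e20, e21, e22, e23, e24, e25⟩ := OH.ctx H h
  obtain ⟨x, e, m, nf, nh2, x1, x2, x3, x4, x5⟩ := OH.at2 H h fl
  obtain ⟨y, e', m', nb', nh3, y1, y2, y3, y4, y5⟩ := OH.at2 H h.sw bl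
  obtain ⟨-, np1, np2, np3, cb, cf, ch2, ch3, bw, fw, qw, h2w, h3w, qb, qf, hi⟩ := id h
  have fx : G.Adj f x := (nf x).2 (by simp)
  have fe : G.Adj f e := (nf e).2 (by simp)
  have hx : G.Adj h2 x := (nh2 x).2 (by simp)
  have by' : G.Adj b y := (nb' y).2 (by simp)
  have be : G.Adj b e' := (nb' e').2 (by simp)
  have hy : G.Adj h3 y := (nh3 y).2 (by simp)
  have xw : x ≠ w := by rintro rfl; exact e17 fx.symm
  have yw : y ≠ w := by rintro rfl; exact e16 by'.symm
  have ew : e ≠ w := by rintro rfl; exact e17 fe.symm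
  have ew' : e' ≠ w := by rintro rfl; exact e16 be.symm
  have cx : φ x = φ p2 := by have := st f x; have := st h2 x; have := cov x; grind
  have cy : φ y = φ p3 := by have := st b y; have := st h3 y; have := cov y; grind
  have nwx : ¬ G.Adj w x := by have := (nb x).1; grind
  have nwe : ¬ G.Adj w e := by have := (nb e).1; grind
  have nwy : ¬ G.Adj w y := by have := (nb y).1; grind
  have nwe' : ¬ G.Adj w e' := by have := (nb e').1; grind
  have xb : ¬ G.Adj b x := by have := st b x; grind
  have yf : ¬ G.Adj f y := by have := st f y; grind
  have yq : ¬ G.Adj q y := by have := st q y; grind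
  have xq : G.Adj q x := by have := H.F p1 f x b y w q; grind
  have eqb : G.Adj q e ∨ G.Adj b e := by have := H.F p1 f e b y w q; grind
  have nq : ∀ r, G.Adj q r → r = p1 ∨ r = x ∨ r = e ∨ r = e' := by
    intro r hr
    by_contra hc
    push Not at hc
    have := H.F p1 b y q r w f
    have := (nb r).1
    have := (nf r).1
    have := (nb' r).1
    clear np1 np2 np3 nf nb st cov nb' nh2 nh3
    grind
  have ce' : φ e' = φ p1 := by
    by_contra hc
    have : φ e' = φ p3 := by have := st b e'; have := cov e'; grind
    refine recol H h.ls.st (fun z => if z = w then φ p1 else if z = b then φ p1 else if z = p1 then φ p2 else φ z) ?_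
    intro a ha c hac
    have := (nb c).1
    have := (nb' c).1
    have := (np1 c).1
    have := e9.ne'
    have := e14.ne'
    clear np1 np2 np3 nf nb st cov nb' nh2 nh3 nq
    grind
  have ebe : G.Adj b e := by
    by_contra hbe
    have qe : G.Adj q e := by tauto
    obtain ⟨r, r1, r2⟩ := H.inc e x x5
    have := H.F f p1 b e r p2 x
    have := (np1 r).1
    have := (np2 r).1
    clear np1 np2 np3 nf nb st cov nb' nh2 nh3 nq
    grind
  have ee : e = e' := by
    have := (nb' e).1 ebe
    grind
  subst ee
  have xe : ¬ G.Adj x e := H.nadj_of_common fx fe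
  have p1e : ¬ G.Adj p1 e := H.nadj_of_common e10.symm fe
  have bp1 := e9.ne'
  have bp3 := e14.ne'
  have fp1 := e10.ne'
  have fp2 := e12.ne'
  have qp1 := e11.ne'
  have qp2 : q ≠ p2 := by rintro rfl; exact e18 a2
  have qp3 : q ≠ p3 := by rintro rfl; exact e18 a3
  have bp2 : b ≠ p2 := by rintro rfl; exact e16 a2
  have fp3 : f ≠ p3 := by rintro rfl; exact e17 a3
  have eb : e ≠ b := be.ne'
  have ef : e ≠ f := fe.ne'
  have eq : e ≠ q := by grind
  have xbn : x ≠ b := by grind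
  have xfn : x ≠ f := fx.ne'
  have xqn : x ≠ q := xq.ne'
  have T2' : ∃ t, G.Adj e t ∧ t ≠ b ∧ φ t = φ p2 := by
    by_contra hc
    push Not at hc
    refine recol H h.ls.st (fun z => if z = w then φ p1 else if z = b then φ p1 else if z = p1 then φ p2 else if z = e then φ p2 else φ z) ?_
    intro a ha c hac
    have := (nb c).1
    have := (nb' c).1
    have := (np1 c).1
    have := hc c
    clear np1 np2 np3 nf nb st cov nb' nh2 nh3 nq hc
    have ha' : a = w ∨ a = p1 ∨ a = b ∨ a = e := by
      clear this
      grind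
    clear ha
    rcases ha' with rfl | rfl | rfl | rfl
    · grind
    · grind
    · grind
    · grind
  have T3' : ∃ t, G.Adj e t ∧ t ≠ f ∧ t ≠ q ∧ φ t = φ p3 := by
    by_contra hc
    push Not at hc
    refine recol H h.ls.st (fun z => if z = w then φ p1 else if z = f then φ p1 else if z = q then φ p1 else if z = p1 then φ p3 else if z = e then φ p3 else φ z) ?_
    intro a ha c hac
    have := (nb c).1
    have := (nf c).1
    have := (np1 c).1
    have := nq c
    have := hc c
    clear np1 np2 np3 nf nb st cov nb' nh2 nh3 nq hc
    have ha' : a = w ∨ a = p1 ∨ a = f ∨ a = q ∨ a = e := by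
      clear this
      grind
    clear ha
    rcases ha' with rfl | rfl | rfl | rfl | rfl
    · grind
    · grind
    · grind
    · grind
    · grind
  obtain ⟨t, t1, t2, t3⟩ := T2'
  obtain ⟨s, s1, s2, s3, s4⟩ := T3'
  have sw : s ≠ w := by rintro rfl; exact nwe s1.symm
  have tw : t ≠ w := by rintro rfl; exact nwe t1.symm
  have i1 : ¬ G.Adj p2 t := by have := st p2 t; grind
  have i2 : ¬ G.Adj p2 s := by rw [np2]; grind
  have i3 : ¬ G.Adj p3 s := by have := st p3 s; grind
  have i4 : ¬ G.Adj p3 t := by rw [np3]; grind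
  exact T2 H fe.symm be.symm t1 s1 (by grind) e12.symm e14.symm (fun e => e19 e.symm) (fun e => i1 e.symm) (fun e => i2 e.symm)
    (fun e => e21 e.symm) (fun e => i4 e.symm) (fun e => i3 e.symm)

/-- a low vertex has no high neighbour -/
theorem noHigh {V : Type} {G : SimpleGraph V} (H : Crit G) {w p : V} (hw : Low G w) (h1 : G.Adj w p) : Low G p := by
  by_contra hi
  obtain ⟨p2, c1, hp, -⟩ := H.deg3 w p p
  obtain ⟨p3, -, -, nb⟩ := low3 H hw h1 c1 hp.symm
  obtain ⟨φ, hφ⟩ := H.crit w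
  obtain ⟨b, f, q, h2, h3, O⟩ := exOH H (exLS H nb hφ) hw hi
  by_cases fl : Low G f
  · exact O.flow H fl
  by_cases bl : Low G b
  · exact O.sw.flow H bl
  have c := (OH.ctx H O).2.2.2.2.2.2.2.1
  rcases O.ls.cov (φ q) with r | r | r
  · exact c r
  · exact O.sw.high H bl fl r
  · exact O.high H fl bl r

set_option linter.unusedVariables false

theorem Crit.nocut {V : Type} {G : SimpleGraph V} (H : Crit G) (K : V → Prop) (p : V) (hp : ¬ K p) (k : V) (hk : K k) (z : V) (hz : ¬ K z)
    (hzp : z ≠ p) (hN : ∀ a b, K a → G.Adj a b → K b ∨ b = p) : False := by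
  classical
  obtain ⟨φ, hφ⟩ := H.crit z
  obtain ⟨χ, hχ⟩ := H.crit k
  let σ : Equiv.Perm (Fin 3) := Equiv.swap (φ p) (χ p)
  have hσ : σ (φ p) = χ p := Equiv.swap_apply_left _ _
  have key : ∀ a b, K a → ¬ K b → G.Adj a b → σ (φ a) ≠ χ b := by
    intro a b ha hb hab
    have : b = p := (hN a b ha hab).resolve_left hb
    subst this
    rw [← hσ]
    intro e
    exact hφ a b (by rintro rfl; exact hz ha) hzp.symm hab (σ.injective e)
  refine H.ncol (fun x => if K x then σ (φ x) else χ x) ?_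
  intro a b hab
  by_cases ha : K a <;> by_cases hb : K b <;> simp only [ha, hb, if_true, if_false]
  · exact fun e => hφ a b (by rintro rfl; exact hz ha) (by rintro rfl; exact hz hb) hab (σ.injective e)
  · exact key a b ha hb hab
  · exact (key b a hb ha hab.symm).symm
  · exact hχ a b (by rintro rfl; exact ha hk) (by rintro rfl; exact hb hk) hab

theorem Crit.conn {V : Type} {G : SimpleGraph V} (H : Crit G) (K : V → Prop) (k : V) (hk : K k) (z : V) (hz : ¬ K z)
    (hN : ∀ a b, K a → G.Adj a b → K b) : False := by
  classical
  obtain ⟨φ, hφ⟩ := H.crit z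
  obtain ⟨χ, hχ⟩ := H.crit k
  refine H.ncol (fun x => if K x then (φ x) else χ x) ?_
  intro a b hab
  by_cases ha : K a <;> by_cases hb : K b <;> simp only [ha, hb, if_true, if_false]
  · exact fun e => hφ a b (by rintro rfl; exact hz ha) (by rintro rfl; exact hz hb) hab (e)
  · exact absurd (hN a b ha hab) hb
  · exact absurd (hN b a hb hab.symm) ha
  · exact hχ a b (by rintro rfl; exact ha hk) (by rintro rfl; exact hb hk) hab

theorem Crit.dich {V : Type} {G : SimpleGraph V} (H : Crit G) : (∀ v, Low G v) ∨ (∀ v, ¬ Low G v) := by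
  by_contra hc
  push Not at hc
  obtain ⟨⟨z, hz⟩, k, hk⟩ := hc
  exact H.conn (Low G) k hk z hz (fun a b ha hab => noHigh H ha hab)

set_option linter.unusedVariables false

/-- proper colouring of the subgraph on `K` together with `a`, `b` -/
def PK {V : Type} (G : SimpleGraph V) (K : V → Prop) (a b : V) (φ : V → Fin 3) : Prop :=
  ∀ x y, (K x ∨ x = a ∨ x = b) → (K y ∨ y = a ∨ y = b) → G.Adj x y → φ x ≠ φ y

theorem PK.sw {V : Type} {G : SimpleGraph V} {K : V → Prop} {a b : V} {φ : V → Fin 3} (h : PK G K a b φ) : PK G K b a φ :=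
  fun x y hx hy => h x y (by tauto) (by tauto)

/-- recolour `a` -/
theorem PK.recol {V : Type} {G : SimpleGraph V} {K : V → Prop} {a b : V} {φ : V → Fin 3} (h : PK G K a b φ) (hab : ¬ G.Adj a b)
    (s : V) (ha : ∀ x, K x → G.Adj a x → x = s) (c : Fin 3) (hc : c ≠ φ s) (ne : a ≠ b) : ∃ ψ, PK G K a b ψ ∧ ψ a = c ∧ ψ b = φ b := by
  classical
  refine ⟨fun x => if x = a then c else φ x, ?_, by simp, by simp [ne.symm]⟩
  intro x y hx hy hxy
  have ir : ¬ G.Adj a a := G.irrefl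
  have e1 := h x y hx hy hxy
  have e2 := ha x
  have e3 := ha y
  have e4 := hxy.symm
  dsimp only
  by_cases h1 : x = a
  · subst h1
    have : y ≠ x := e4.ne
    grind
  · by_cases h2 : y = a
    · subst h2
      grind
    · simp [h1, h2, e1]

theorem PK.diff {V : Type} {G : SimpleGraph V} {K : V → Prop} {a b : V} {φ : V → Fin 3} (h : PK G K a b φ) (hab : ¬ G.Adj a b) (ne : a ≠ b)
    (ha : ∃ s, ∀ x, K x → G.Adj a x → x = s) : ∃ ψ, PK G K a b ψ ∧ ψ a ≠ ψ b := by
  obtain ⟨s, ha⟩ := ha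
  obtain ⟨c, h1, h2⟩ := third (φ s) (φ b)
  obtain ⟨ψ, x, y, z⟩ := h.recol hab s ha c h1 ne
  exact ⟨ψ, x, by rw [y, z]; exact h2⟩

theorem PK.same {V : Type} {G : SimpleGraph V} {K : V → Prop} {a b : V} {φ : V → Fin 3} (h : PK G K a b φ) (hab : ¬ G.Adj a b) (ne : a ≠ b)
    (na : ¬ K a) (ha : ∃ s, ∀ x, K x → G.Adj a x → x = s) (hb : ∃ s, ∀ x, K x → G.Adj b x → x = s) : ∃ ψ, PK G K a b ψ ∧ ψ a = ψ b := by
  classical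
  obtain ⟨s, ha⟩ := ha
  obtain ⟨t, hb⟩ := hb
  obtain ⟨c, h1, h2⟩ := third (φ s) (φ t)
  refine ⟨fun x => if x = a ∨ x = b then c else φ x, ?_, by simp⟩
  intro x y hx hy hxy
  have ir : ¬ G.Adj a a := G.irrefl
  have ir : ¬ G.Adj b b := G.irrefl
  have e1 := h x y hx hy hxy
  have e2 := ha x
  have e3 := ha y
  have e5 := hb x
  have e6 := hb y
  have e4 := hxy.symm
  grind

theorem match2 {V : Type} {G : SimpleGraph V} (H : Crit G) (K L : V → Prop) (a b : V) (hab : ¬ G.Adj a b)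
    (cov : ∀ x, K x ∨ L x ∨ x = a ∨ x = b) (dis : ∀ x, K x → ¬ L x) (ka : ¬ K a) (kb : ¬ K b) (la : ¬ L a) (lb : ¬ L b)
    (hKL : ∀ x y, K x → L y → ¬ G.Adj x y) {φ χ : V → Fin 3} (hφ : PK G K a b φ) (hχ : PK G L a b χ)
    (h : φ a = φ b ↔ χ a = χ b) : False := by
  classical
  have : ∃ σ : Equiv.Perm (Fin 3), σ (φ a) = χ a ∧ σ (φ b) = χ b := by
    generalize φ a = p at h ⊢
    generalize φ b = q at h ⊢
    generalize χ a = r at h ⊢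
    generalize χ b = s at h ⊢
    by_cases e : p = q
    · have := h.1 e
      subst e
      subst this
      exact ⟨Equiv.swap p r, by simp, by simp⟩
    · have e' : r ≠ s := fun x => e (h.2 x)
      refine ⟨(Equiv.swap p r).trans (Equiv.swap (Equiv.swap p r q) s), ?_, by simp⟩
      simp only [Equiv.trans_apply, Equiv.swap_apply_left]
      refine Equiv.swap_apply_of_ne_of_ne ?_ e'
      intro x
      apply e
      have : Equiv.swap p r p = Equiv.swap p r q := by rw [← x]; simp
      exact (Equiv.swap p r).injective this
  obtain ⟨σ, s1, s2⟩ := this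
  refine H.ncol (fun x => if K x then σ (φ x) else χ x) ?_
  have key : ∀ x, (K x ∨ x = a ∨ x = b) → (if K x then σ (φ x) else χ x) = σ (φ x) := by
    rintro x (h | rfl | rfl)
    · simp [h]
    · simp [ka, s1]
    · simp [kb, s2]
  have key2 : ∀ x, (L x ∨ x = a ∨ x = b) → (if K x then σ (φ x) else χ x) = χ x := by
    rintro x (h | rfl | rfl)
    · have : ¬ K x := fun e => dis x e h
      simp [this]
    · simp [ka]
    · simp [kb]
  intro x y hxy
  have : (K x ∨ x = a ∨ x = b) ∧ (K y ∨ y = a ∨ y = b) ∨ (L x ∨ x = a ∨ x = b) ∧ (L y ∨ y = a ∨ y = b) := by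
    have c1 := hKL x y
    have c2 := hKL y x
    have c3 := hxy.symm
    rcases cov x with e | e | e
    · rcases cov y with f | f | f
      · exact Or.inl ⟨Or.inl e, Or.inl f⟩
      · exact absurd hxy (c1 e f)
      · exact Or.inl ⟨Or.inl e, Or.inr f⟩
    · rcases cov y with f | f | f
      · exact absurd c3 (c2 f e)
      · exact Or.inr ⟨Or.inl e, Or.inl f⟩
      · exact Or.inr ⟨Or.inl e, Or.inr f⟩
    · rcases cov y with f | f | f
      · exact Or.inl ⟨Or.inr e, Or.inl f⟩
      · exact Or.inr ⟨Or.inr e, Or.inl f⟩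
      · exact Or.inl ⟨Or.inr e, Or.inr f⟩
  rcases this with ⟨e1, e2⟩ | ⟨e1, e2⟩
  · skip
    rw [key x e1, key y e2]
    exact fun e => hφ x y e1 e2 hxy (σ.injective e)
  · skip
    rw [key2 x e1, key2 y e2]
    exact hχ x y e1 e2 hxy

theorem one_side {V : Type} {G : SimpleGraph V} (K L : V → Prop) (dis : ∀ x, K x → ¬ L x) {a : V} (ha : Low G a) :
    (∃ s, ∀ x, K x → G.Adj a x → x = s) ∨ (∃ s, ∀ x, L x → G.Adj a x → x = s) := by
  obtain ⟨p, q, r, h⟩ := ha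
  have d1 := dis p
  have d2 := dis q
  have d3 := dis r
  by_cases e1 : K p
  · by_cases e2 : K q
    · exact Or.inr ⟨r, fun x hx h1 => by have := (h x).1 h1; grind⟩
    · by_cases e3 : K r
      · exact Or.inr ⟨q, fun x hx h1 => by have := (h x).1 h1; grind⟩
      · exact Or.inl ⟨p, fun x hx h1 => by have := (h x).1 h1; grind⟩
  · by_cases e2 : K q
    · by_cases e3 : K r
      · exact Or.inr ⟨p, fun x hx h1 => by have := (h x).1 h1; grind⟩
      · exact Or.inl ⟨q, fun x hx h1 => by have := (h x).1 h1; grind⟩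
    · exact Or.inl ⟨r, fun x hx h1 => by have := (h x).1 h1; grind⟩

theorem Crit.nocut2 {V : Type} {G : SimpleGraph V} (H : Crit G) (low : ∀ v, Low G v) (K : V → Prop) (a b : V) (hab : ¬ G.Adj a b) (ne : a ≠ b)
    (ka : ¬ K a) (kb : ¬ K b) (k : V) (hk : K k) (z : V) (hz : ¬ K z) (hza : z ≠ a) (hzb : z ≠ b)
    (hN : ∀ x y, K x → G.Adj x y → K y ∨ y = a ∨ y = b) : False := by
  classical
  obtain ⟨φ, hφ⟩ := H.crit z
  obtain ⟨χ, hχ⟩ := H.crit k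
  let L : V → Prop := fun x => ¬ K x ∧ x ≠ a ∧ x ≠ b
  have hba : ¬ G.Adj b a := fun e => hab e.symm
  have P : PK G K a b φ := fun x y hx hy => hφ x y (by rintro rfl; tauto) (by rintro rfl; tauto)
  have Q : PK G L a b χ := by
    have k1 : k ≠ a := by rintro rfl; tauto
    have k2 : k ≠ b := by rintro rfl; tauto
    intro x y hx hy
    apply hχ x y
    · rintro rfl
      simp only [L] at hx
      tauto
    · rintro rfl
      simp only [L] at hy
      tauto
  have dis : ∀ x, K x → ¬ L x := fun x hx hl => hl.1 hx
  have la : ¬ L a := fun h => h.2.1 rfl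
  have lb : ¬ L b := fun h => h.2.2 rfl
  have cov : ∀ x, K x ∨ L x ∨ x = a ∨ x = b := by intro x; simp only [L]; tauto
  have M : ∀ φ χ, PK G K a b φ → PK G L a b χ → (φ a = φ b ↔ χ a = χ b) → False := fun φ χ hφ hχ =>
    match2 H K L a b hab cov dis ka kb la lb (fun x y hx hy hxy => by
      rcases hN x y hx hxy with e | e | e
      · exact hy.1 e
      · exact hy.2.1 e
      · exact hy.2.2 e) hφ hχ
  rcases one_side K L dis (low a) with x | x <;> rcases one_side K L dis (low b) with y | y
  · by_cases e : χ a = χ b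
    · obtain ⟨φ', p, q⟩ := P.same hab ne ka x y
      exact M φ' χ p Q (by tauto)
    · obtain ⟨φ', p, q⟩ := P.diff hab ne x
      exact M φ' χ p Q (by tauto)
  · obtain ⟨φ', p, q⟩ := P.diff hab ne x
    obtain ⟨χ', p', q'⟩ := Q.sw.diff hba ne.symm y
    exact M φ' χ' p p'.sw (by constructor <;> intro e; exact absurd e q; exact absurd e.symm q')
  · obtain ⟨φ', p, q⟩ := P.sw.diff hba ne.symm y
    obtain ⟨χ', p', q'⟩ := Q.diff hab ne x
    exact M φ' χ' p.sw p' (by constructor <;> intro e; exact absurd e.symm q; exact absurd e q')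
  · by_cases e : φ a = φ b
    · obtain ⟨φ', p, q⟩ := Q.same hab ne la x y
      exact M φ φ' P p (by tauto)
    · obtain ⟨φ', p, q⟩ := Q.diff hab ne x
      exact M φ φ' P p (by tauto)

/-- reachability of `v` avoiding `a`, `b` -/
inductive Rch {V : Type} (G : SimpleGraph V) (a b v : V) : V → Prop
  | refl : Rch G a b v v
  | step (x y : V) : x ≠ a → x ≠ b → G.Adj x y → Rch G a b v y → Rch G a b v x

theorem Rch.fill {V : Type} {G : SimpleGraph V} (low : ∀ v, Low G v) {a b v x : V} (h : Rch G a b v x) (y : V)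
    (φ : V → Fin 3) (hab : φ a = φ b) (hφ : ∀ s t, s ≠ v → t ≠ v → s ≠ x → t ≠ x → s ≠ y → t ≠ y → G.Adj s t → φ s ≠ φ t) :
    ∃ ψ : V → Fin 3, ψ a = ψ b ∧ ∀ s t, s ≠ v → t ≠ v → s ≠ y → t ≠ y → G.Adj s t → ψ s ≠ ψ t := by
  classical
  induction h generalizing φ with
  | refl => exact ⟨φ, hab, fun s t h1 h2 h3 h4 => hφ s t h1 h2 h1 h2 h3 h4⟩
  | step x z xa xb xz _ ih =>
    have : ∃ s t, ∀ u, G.Adj x u → u = z ∨ u = s ∨ u = t := by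
      obtain ⟨p, q, r, h⟩ := low x
      rcases (h z).1 xz with rfl | rfl | rfl
      · exact ⟨q, r, fun u hu => (h u).1 hu⟩
      · exact ⟨p, r, fun u hu => by have := (h u).1 hu; tauto⟩
      · exact ⟨p, q, fun u hu => by have := (h u).1 hu; tauto⟩
    obtain ⟨s, t, hst⟩ := this
    obtain ⟨c, c1, c2⟩ := third (φ s) (φ t)
    refine ih (fun u => if u = x then c else φ u) (by simp [xa.symm, xb.symm, hab]) ?_
    intro u u' h1 h2 h3 h4 h5 h6 hu
    have e1 := hst u
    have e2 := hst u'
    have e3 := hu.symm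
    have e4 := hu.ne
    have := hφ u u' h1 h2
    by_cases hx : u = x
    · subst hx
      have := e2 hu
      grind
    · by_cases hx' : u' = x
      · subst hx'
        have := e1 hu.symm
        grind
      · simp [hx, hx']
        tauto

theorem cubic {V : Type} {G : SimpleGraph V} (H : Crit G) [Nonempty V] (low : ∀ v, Low G v) : False := by
  classical
  obtain ⟨v⟩ := ‹Nonempty V›
  obtain ⟨a, va, -, -⟩ := H.deg3 v v v
  obtain ⟨b, vb, hba, -⟩ := H.deg3 v a a
  have hab := H.nadj_of_common va vb
  have reach : ∀ x, x ≠ a → x ≠ b → Rch G a b v x := by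
    intro x xa xb
    by_contra hx
    refine H.nocut2 low (fun x => x ≠ a ∧ x ≠ b ∧ ¬ Rch G a b v x) a b hab hba.symm (by simp) (by simp) x ⟨xa, xb, hx⟩ v
      (fun h => h.2.2 .refl) va.ne vb.ne ?_
    rintro y z ⟨y1, y2, y3⟩ hyz
    by_cases za : z = a
    · tauto
    by_cases zb : z = b
    · tauto
    exact Or.inl ⟨za, zb, fun h => y3 (.step y z y1 y2 hyz h)⟩
  obtain ⟨φ, hφ⟩ := H.crit v
  obtain ⟨b1, bb1, hb1, -⟩ := H.deg3 b v v
  obtain ⟨b2, b21, b2v, nb⟩ := low3 H (low b) bb1 vb.symm hb1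
  have bb2 : G.Adj b b2 := (nb b2).2 (by simp)
  obtain ⟨c, ca, cb, nv⟩ := low3 H (low v) va vb hba.symm
  have b1a : b1 ≠ a := by rintro rfl; exact hab bb1.symm
  have b2a : b2 ≠ a := by rintro rfl; exact hab bb2.symm
  have ir : ¬ G.Adj b b := G.irrefl
  obtain ⟨ψ, p1, p2⟩ := (reach b1 b1a bb1.ne.symm).fill low b2 (fun x => if x = b then φ a else φ x) (by simp) (by
    intro s t h1 h2 h3 h4 h5 h6 hst
    have e1 := (nb s).1
    have e2 := (nb t).1
    have e3 := hst.symm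
    have e4 := hφ s t h1 h2 hst
    grind)
  obtain ⟨ψ, p1, p2⟩ := (reach b2 b2a bb2.ne.symm).fill low v ψ p1 (by
    intro s t h1 h2 h3 h4 h5 h6 hst
    exact p2 s t h1 h2 h3 h4 hst)
  exact (exLS H nv (φ := ψ) (fun s t h1 h2 => p2 s t h1 h2 h1 h2)).n12 p1

set_option linter.unusedVariables false

/-- walks of given length -/
def wk {V : Type} (G : SimpleGraph V) : ℕ → V → V → Prop
  | 0, a, b => a = b
  | n + 1, a, b => ∃ x, G.Adj a x ∧ wk G n x b

theorem wk.app {V : Type} {G : SimpleGraph V} {m n : ℕ} {a b c : V} (h1 : wk G m a b) (h2 : wk G n b c) : wk G (m + n) a c := by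
  induction m generalizing a with
  | zero => 
    have : a = b := h1
    subst this
    simpa using h2
  | succ m ih =>
    obtain ⟨x, hx, h⟩ := h1
    rw [show m + 1 + n = (m + n) + 1 by omega]
    exact ⟨x, hx, ih h⟩

theorem wk.one {V : Type} {G : SimpleGraph V} {a b : V} (h : G.Adj a b) : wk G 1 a b := ⟨b, h, rfl⟩

theorem wk.symm {V : Type} {G : SimpleGraph V} {m : ℕ} {a b : V} (h1 : wk G m a b) : wk G m b a := by
  induction m generalizing a with
  | zero => exact Eq.symm h1
  | succ m ih =>
    obtain ⟨x, hx, h⟩ := h1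
    exact (ih h).app (wk.one hx.symm)

/-- `k + 7` is the odd girth -/
def OG {V : Type} (G : SimpleGraph V) (k : ℕ) : Prop := Even k ∧ ∀ m a, Odd m → wk G m a a → k + 7 ≤ m

/-- seven consecutive vertices of a shortest odd closed walk -/
structure Win {V : Type} (G : SimpleGraph V) (k : ℕ) (a b c d e f g : V) : Prop where
  ab : G.Adj a b
  bc : G.Adj b c
  cd : G.Adj c d
  de : G.Adj d e
  ef : G.Adj e f
  fg : G.Adj f g
  far : wk G (k + 1) g a

namespace Win
variable {V : Type} {G : SimpleGraph V} {k : ℕ} {a b c d e f g : V}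

theorem rev (h : Win G k a b c d e f g) : Win G k g f e d c b a :=
  ⟨h.fg.symm, h.ef.symm, h.de.symm, h.cd.symm, h.bc.symm, h.ab.symm, h.far.symm⟩

theorem shR (h : Win G k a b c d e f g) : ∃ x, Win G k b c d e f g x := by
  obtain ⟨x, hx, h1⟩ := h.far
  exact ⟨x, h.bc, h.cd, h.de, h.ef, h.fg, hx, h1.app (wk.one h.ab)⟩

theorem shL (h : Win G k a b c d e f g) : ∃ x, Win G k x a b c d e f := by
  obtain ⟨x, hx⟩ := h.rev.shR
  exact ⟨x, hx.rev⟩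

theorem far4 (h : Win G k a b c d e f g) (O : OG G k) {x y z : V} (h1 : G.Adj a x) (h2 : G.Adj x y) (h3 : G.Adj y z) (h4 : G.Adj z g) : False := by
  have := O.2 _ _ ?_ (((((wk.one h1).app (wk.one h2)).app (wk.one h3)).app (wk.one h4)).app h.far)
  · omega
  · have := O.1
    obtain ⟨m, rfl⟩ := this
    exact ⟨m + 2, by omega⟩

/-- replace the middle vertices -/
theorem rb (h : Win G k a b c d e f g) {b' : V} (h1 : G.Adj a b') (h2 : G.Adj b' c) : Win G k a b' c d e f g :=
  ⟨h1, h2, h.cd, h.de, h.ef, h.fg, h.far⟩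
theorem rc (h : Win G k a b c d e f g) {c' : V} (h1 : G.Adj b c') (h2 : G.Adj c' d) : Win G k a b c' d e f g :=
  ⟨h.ab, h1, h2, h.de, h.ef, h.fg, h.far⟩
theorem rd (h : Win G k a b c d e f g) {d' : V} (h1 : G.Adj c d') (h2 : G.Adj d' e) : Win G k a b c d' e f g :=
  ⟨h.ab, h.bc, h1, h2, h.ef, h.fg, h.far⟩
theorem re (h : Win G k a b c d e f g) {e' : V} (h1 : G.Adj d e') (h2 : G.Adj e' f) : Win G k a b c d e' f g :=
  ⟨h.ab, h.bc, h.cd, h1, h2, h.fg, h.far⟩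
theorem rf (h : Win G k a b c d e f g) {f' : V} (h1 : G.Adj e f') (h2 : G.Adj f' g) : Win G k a b c d e f' g :=
  ⟨h.ab, h.bc, h.cd, h.de, h1, h2, h.far⟩

theorem af (h : Win G k a b c d e f g) (O : OG G k) {x y : V} (h1 : G.Adj a x) (h2 : G.Adj x y) : ¬ G.Adj y f :=
  fun h3 => h.far4 O h1 h2 h3 h.fg
theorem bg (h : Win G k a b c d e f g) (O : OG G k) {x y : V} (h1 : G.Adj b x) (h2 : G.Adj x y) : ¬ G.Adj y g :=
  fun h3 => h.far4 O h.ab h1 h2 h3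
theorem ae (h : Win G k a b c d e f g) (O : OG G k) {x : V} (h1 : G.Adj a x) : ¬ G.Adj x e :=
  fun h2 => h.far4 O h1 h2 h.ef h.fg
theorem bf (h : Win G k a b c d e f g) (O : OG G k) {x : V} (h1 : G.Adj b x) : ¬ G.Adj x f :=
  fun h2 => h.far4 O h.ab h1 h2 h.fg
theorem cg (h : Win G k a b c d e f g) (O : OG G k) {x : V} (h1 : G.Adj c x) : ¬ G.Adj x g :=
  fun h2 => h.far4 O h.ab h.bc h1 h2
theorem nbe (h : Win G k a b c d e f g) (O : OG G k) : ¬ G.Adj b e :=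
  fun h1 => h.far4 O h.ab h1 h.ef h.fg
theorem ncf (h : Win G k a b c d e f g) (O : OG G k) : ¬ G.Adj c f :=
  fun h1 => h.far4 O h.ab h.bc h1 h.fg
theorem nad (h : Win G k a b c d e f g) (O : OG G k) : ¬ G.Adj a d :=
  fun h1 => h.ae O h1 h.de
theorem ndg (h : Win G k a b c d e f g) (O : OG G k) : ¬ G.Adj d g :=
  fun h1 => h.cg O h.cd h1

/-- at most one neighbour of `d` outside the two cells -/
theorem pu (h : Win G k a b c d e f g) (O : OG G k) (H : Crit G) {p q : V} (hp : G.Adj d p) (hq : G.Adj d q) (pb : ¬ G.Adj p b)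
    (pf : ¬ G.Adj p f) (qb : ¬ G.Adj q b) (qf : ¬ G.Adj q f) : p = q := by
  by_contra hne
  exact T2 H h.cd.symm h.de hp hq hne h.bc.symm h.ef (fun e => h.nbe O e.symm) pb qb (h.ncf O) pf qf

end Win

theorem Crit.exOG {V : Type} {G : SimpleGraph V} (H : Crit G) [Nonempty V] : ∃ k, OG G k ∧ ∃ a, wk G (k + 7) a a := by
  classical
  obtain ⟨v⟩ := ‹Nonempty V›
  have ex : ∃ m, Odd m ∧ ∃ a, wk G m a a := by
    by_contra hc
    push Not at hc
    have re : ∀ x, ∃ m, wk G m v x := by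
      intro z
      by_contra hz
      refine H.conn (fun x => ∃ m, wk G m v x) v ⟨0, rfl⟩ z hz ?_
      rintro a b ⟨m, hm⟩ hab
      exact ⟨m + 1, hm.app (wk.one hab)⟩
    refine H.ncol (fun x => if ∃ m, Even m ∧ wk G m v x then 0 else 1) ?_
    intro a b hab
    by_cases h1 : ∃ m, Even m ∧ wk G m v a <;> by_cases h2 : ∃ m, Even m ∧ wk G m v b <;> simp only [h1, h2, if_true, if_false]
    · obtain ⟨m, e1, w1⟩ := h1
      obtain ⟨n, e2, w2⟩ := h2
      exact absurd ((w1.app (wk.one hab)).app w2.symm) (hc _ ((e1.add_one).add_even e2) v)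
    · decide
    · decide
    · obtain ⟨m, w1⟩ := re a
      obtain ⟨n, w2⟩ := re b
      have e1 : Odd m := by
        rw [← Nat.not_even_iff_odd]; exact fun e => h1 ⟨m, e, w1⟩
      have e2 : Odd n := by
        rw [← Nat.not_even_iff_odd]; exact fun e => h2 ⟨n, e, w2⟩
      exact absurd ((w1.app (wk.one hab)).app w2.symm) (hc _ ((e1.add_one).add_odd e2) v)
  have hs := Nat.find_spec ex
  have hm : ∀ m a, Odd m → wk G m a a → Nat.find ex ≤ m := fun m a h1 h2 => Nat.find_min' ex ⟨h1, a, h2⟩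
  generalize Nat.find ex = n at hs hm
  obtain ⟨ho, a, ha⟩ := hs
  have h7 : 7 ≤ n := by
    by_contra hlt
    obtain ⟨j, rfl⟩ := ho
    have : j = 0 ∨ j = 1 ∨ j = 2 := by omega
    rcases this with rfl | rfl | rfl
    · obtain ⟨x, hx, h⟩ := ha
      have : x = a := h
      subst this
      exact hx.ne rfl
    · obtain ⟨x, hx, y, hy, z, hz, h⟩ := ha
      have : z = a := h
      subst this
      exact H.tri z x y hx hy hz.symm
    · obtain ⟨x, hx, y, hy, z, hz, s, hs, t, ht, h⟩ := ha
      have : t = a := h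
      subst this
      exact H.c5 t x y z s hx hy hz hs ht
  obtain ⟨k, rfl⟩ : ∃ k, n = k + 7 := ⟨n - 7, by omega⟩
  refine ⟨k, ⟨?_, hm⟩, a, ha⟩
  obtain ⟨m, hm⟩ := ho
  exact ⟨m - 3, by omega⟩

theorem Crit.exWin {V : Type} {G : SimpleGraph V} (H : Crit G) [Nonempty V] : ∃ k, OG G k ∧ ∃ a b c d e f g, Win G k a b c d e f g := by
  obtain ⟨k, O, a, h⟩ := H.exOG
  obtain ⟨b, h1, c, h2, d, h3, e, h4, f, h5, g, h6, h⟩ := h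
  exact ⟨k, O, a, b, c, d, e, f, g, h1, h2, h3, h4, h5, h6, h⟩

theorem exTop {V : Type} [Finite V] (T : V → Prop) (f : V → V → Prop)
    (tot : ∀ t t', T t → T t' → (∀ x, f t x → f t' x) ∨ (∀ x, f t' x → f t x)) :
    (∀ t, ¬ T t) ∨ ∃ t1, T t1 ∧ ∀ t, T t → ∀ x, f t x → f t1 x := by
  classical
  by_cases hT : ∀ t, ¬ T t
  · exact Or.inl hT
  right
  push Not at hT
  have := Fintype.ofFinite V
  obtain ⟨t1, h1, h2⟩ := Finset.exists_max_image (Finset.univ.filter T) (fun t => (Finset.univ.filter (f t)).card)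
    (by obtain ⟨t, ht⟩ := hT; exact ⟨t, by simp [ht]⟩)
  simp only [Finset.mem_filter, Finset.mem_univ, true_and] at h1 h2
  refine ⟨t1, h1, fun t ht => ?_⟩
  rcases tot t t1 ht h1 with h | h
  · exact h
  · have hs : Finset.univ.filter (f t1) ⊆ Finset.univ.filter (f t) := by
      intro x; simp; exact h x
    have := Finset.eq_of_subset_of_card_le hs (h2 t ht)
    intro x hx
    have hx' : x ∈ Finset.univ.filter (f t) := by simp [hx]
    rw [← this] at hx'
    simpa using hx'

set_option linter.unusedVariables false

theorem lemH {V : Type} {G : SimpleGraph V} (H : Crit G) {u v : V} (uv : G.Adj u v) (W T : V → Prop)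
    (hW : ∀ w, W w ↔ w ≠ u ∧ ¬ G.Adj v w ∧ ∃ p, G.Adj u p ∧ p ≠ v ∧ G.Adj p w)
    (hT : ∀ t, T t ↔ ¬ (G.Adj u t ∧ t ≠ v) ∧ ∃ w, W w ∧ G.Adj w t)
    (h : (∀ t, ¬ T t) ∨ ∃ t1, T t1 ∧ ∀ t, T t → ∀ x, G.Adj t x → ¬ W x → G.Adj t1 x) : False := by
  classical
  have uW : ∀ w, W w → ¬ G.Adj u w := by
    intro w hw
    obtain ⟨-, -, p, h1, h2, h3⟩ := (hW w).1 hw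
    exact H.nadj_of_common h1.symm h3
  have WW : ∀ w w', W w → W w' → ¬ G.Adj w w' := by
    intro w w' hw hw' e
    obtain ⟨-, -, p, h1, h2, h3⟩ := (hW w).1 hw
    obtain ⟨-, -, p', h1', h2', h3'⟩ := (hW w').1 hw'
    exact H.c5 u p w w' p' h1 h3 e h3'.symm h1'.symm
  have TW : ∀ t, T t → ¬ W t := by
    intro t ht hw
    obtain ⟨-, w, h1, h2⟩ := (hT t).1 ht
    exact WW w t h1 hw h2
  have Tu : ∀ t, T t → t ≠ u := by
    rintro t ht rfl
    obtain ⟨-, w, h1, h2⟩ := (hT t).1 ht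
    exact uW w h1 h2.symm
  have h' : ∃ t1, t1 ≠ u ∧ (T t1 ∨ ∀ t, ¬ T t) ∧ ∀ t, T t → ∀ x, G.Adj t x → ¬ W x → G.Adj t1 x := by
    rcases h with h | ⟨t1, h1, h2⟩
    · exact ⟨v, uv.ne.symm, Or.inr h, fun t ht => absurd ht (h t)⟩
    · exact ⟨t1, Tu t1 h1, Or.inl h1, h2⟩
  clear h
  obtain ⟨t1, t1u, t1T, h⟩ := h'
  have TT : ∀ t t', T t → T t' → ¬ G.Adj t t' := by
    intro t t' ht ht' e
    have h1 : T t1 := by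
      rcases t1T with h | h
      · exact h
      · exact absurd ht (h t)
    have := h t ht t' e (TW t' ht')
    exact G.irrefl (h t' ht' t1 this.symm (TW t1 h1))
  have UT : ∀ p t, G.Adj u p → p ≠ v → T t → ¬ G.Adj p t := by
    intro p t h1 h2 ht e
    by_cases hv : G.Adj v t
    · obtain ⟨-, w, hw, h3⟩ := (hT t).1 ht
      obtain ⟨-, -, p', h1', h2', h3'⟩ := (hW w).1 hw
      exact H.c5 u p' w t v h1' h3' h3 hv.symm uv.symm
    · exact TW t ht ((hW t).2 ⟨Tu t ht, hv, p, h1, h2, e⟩)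
  obtain ⟨φ, hφ⟩ := H.crit u
  obtain ⟨i, i1, i2⟩ := third (φ v) (φ t1)
  let ψ : V → Fin 3 := fun x => if x = u ∨ W x then i else if (G.Adj u x ∧ x ≠ v) then φ v else if T x then φ t1 else φ x
  have e1 : ∀ x, (x = u ∨ W x) → ψ x = i := fun x hx => by simp only [ψ, hx, if_true]
  have e2 : ∀ x, (G.Adj u x ∧ x ≠ v) → ψ x = φ v := fun x hx => by
    have h1 : ¬ (x = u ∨ W x) := by
      rintro (rfl | h)
      · exact G.irrefl hx.1
      · exact uW x h hx.1
    simp only [ψ, hx, h1, if_true, if_false]; simp [hx]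
  have e3 : ∀ x, T x → ψ x = φ t1 := fun x hx => by
    have h1 : ¬ (x = u ∨ W x) := by
      rintro (h | h)
      · exact Tu x hx h
      · exact TW x hx h
    have h2 := ((hT x).1 hx).1
    simp only [ψ, hx, h1, h2, if_true, if_false]
  have e4 : ∀ x, ¬ (x = u ∨ W x) → ¬ (G.Adj u x ∧ x ≠ v) → ¬ T x → ψ x = φ x := fun x h1 h2 h3 => by
    simp only [ψ, h1, h2, h3, if_false]
  clear_value ψ
  have key1 : ∀ a b, (a = u ∨ W a) → G.Adj a b → ψ a ≠ ψ b := by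
    intro a b ha hab
    rw [e1 a ha]
    rcases ha with rfl | ha
    · by_cases hb : b = v
      · subst hb
        have := e4 b ?_ ?_ ?_
        · rw [this]; exact i1
        · rintro (h | h)
          · exact uv.ne h.symm
          · exact uW _ h uv
        · simp
        · intro ht
          obtain ⟨-, w, hw, h3⟩ := (hT b).1 ht
          exact ((hW w).1 hw).2.1 h3.symm
      · rw [e2 b ⟨hab, hb⟩]; exact i1
    · by_cases hb : G.Adj u b ∧ b ≠ v
      · rw [e2 b hb]; exact i1
      · rw [e3 b ((hT b).2 ⟨hb, a, ha, hab⟩)]; exact i2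
  have key2 : ∀ a b, (G.Adj u a ∧ a ≠ v) → G.Adj a b → ψ a ≠ ψ b := by
    intro a b ha hab
    by_cases hb : b = u ∨ W b
    · exact (key1 b a hb hab.symm).symm
    · have hb2 : ¬ (G.Adj u b ∧ b ≠ v) := fun h => H.nadj_of_common ha.1 h.1 hab
      have hb3 : ¬ T b := fun h => UT a b ha.1 ha.2 h hab
      rw [e2 a ha, e4 b hb hb2 hb3]
      push Not at hb
      have : G.Adj v b := by
        by_contra hv
        exact hb.2 ((hW b).2 ⟨hb.1, hv, a, ha.1, ha.2, hab⟩)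
      exact hφ v b uv.ne.symm hb.1 this
  have key3 : ∀ a b, T a → G.Adj a b → ψ a ≠ ψ b := by
    intro a b ha hab
    by_cases hb : b = u ∨ W b
    · exact (key1 b a hb hab.symm).symm
    by_cases hb2 : G.Adj u b ∧ b ≠ v
    · exact (key2 b a hb2 hab.symm).symm
    have hb3 : ¬ T b := fun h => TT a b ha h hab
    rw [e3 a ha, e4 b hb hb2 hb3]
    push Not at hb
    exact hφ t1 b t1u hb.1 (h a ha b hab hb.2)
  refine H.ncol ψ ?_
  intro a b hab
  by_cases ha : a = u ∨ W a
  · exact key1 a b ha hab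
  by_cases hb : b = u ∨ W b
  · exact (key1 b a hb hab.symm).symm
  by_cases ha2 : G.Adj u a ∧ a ≠ v
  · exact key2 a b ha2 hab
  by_cases hb2 : G.Adj u b ∧ b ≠ v
  · exact (key2 b a hb2 hab.symm).symm
  by_cases ha3 : T a
  · exact key3 a b ha3 hab
  by_cases hb3 : T b
  · exact (key3 b a hb3 hab.symm).symm
  rw [e4 a ha ha2 ha3, e4 b hb hb2 hb3]
  exact hφ a b (fun h => ha (Or.inl h)) (fun h => hb (Or.inl h)) hab

set_option linter.unusedVariables false

/-- `y` has a neighbour in the cell between `c` and `a` -/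
def Lt {V : Type} (G : SimpleGraph V) (c a y : V) : Prop := ∃ s, G.Adj c s ∧ G.Adj s a ∧ G.Adj s y

def Dbl {V : Type} (G : SimpleGraph V) (k : ℕ) : Prop :=
  ∀ a b c d e f g, Win G k a b c d e f g → ∃ d', d' ≠ d ∧ G.Adj c d' ∧ G.Adj d' e

theorem LR {V : Type} {G : SimpleGraph V} {k : ℕ} (O : OG G k) {a b c d e f g y : V} (w : Win G k a b c d e f g)
    (h1 : Lt G c a y) (h2 : Lt G e g y) : False := by
  obtain ⟨s, -, h3, h4⟩ := h1
  obtain ⟨t, -, h5, h6⟩ := h2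
  exact w.far4 O h3.symm h4 h6.symm h5

theorem ChR {V : Type} {G : SimpleGraph V} (H : Crit G) {k : ℕ} (O : OG G k) (D : Dbl G k) {a b c x e f g x' y y' : V} (w : Win G k a b c x e f g)
    (h2 : G.Adj x' e) (h3 : G.Adj x y) (h4 : ¬ G.Adj x' y) (h5 : G.Adj x' y') (h6 : ¬ G.Adj x y') :
    Lt G e g y ∨ Lt G e g y' := by
  obtain ⟨h, w1⟩ := w.shR
  obtain ⟨i, w2⟩ := w1.shR
  obtain ⟨f', f1, f2, f3⟩ := D _ _ _ _ _ _ _ w2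
  by_contra hc
  push Not at hc
  obtain ⟨n1, n2⟩ := hc
  have g1 := w.ef
  have g2 := w.fg
  exact T2 H w.de.symm h2.symm w.ef f2 f1.symm h3 h5 h4 (fun q => n1 ⟨f, g1, g2, q⟩) (fun q => n1 ⟨f', f2, f3, q⟩)
    h6 (fun q => n2 ⟨f, g1, g2, q⟩) (fun q => n2 ⟨f', f2, f3, q⟩)

/-- an `L` neighbour forces the reverse difference to be `R` -/
theorem CL {V : Type} {G : SimpleGraph V} (H : Crit G) {k : ℕ} (O : OG G k) (D : Dbl G k) {a b c x e f g x' y y' : V} (w : Win G k a b c x e f g)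
    (h1 : G.Adj c x') (h2 : G.Adj x' e) (h3 : G.Adj x y) (h4 : ¬ G.Adj x' y) (h5 : G.Adj x' y') (h6 : ¬ G.Adj x y')
    (hL : Lt G c a y) : Lt G e g y' ∧ ¬ Lt G c a y' := by
  have : Lt G e g y' := by
    rcases ChR H O D w h2 h3 h4 h5 h6 with h | h
    · exact (LR O w hL h).elim
    · exact h
  exact ⟨this, fun h => LR O w h this⟩

theorem CR {V : Type} {G : SimpleGraph V} (H : Crit G) {k : ℕ} (O : OG G k) (D : Dbl G k) {a b c x e f g x' y y' : V} (w : Win G k a b c x e f g)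
    (h1 : G.Adj c x') (h2 : G.Adj x' e) (h3 : G.Adj x y) (h4 : ¬ G.Adj x' y) (h5 : G.Adj x' y') (h6 : ¬ G.Adj x y')
    (hR : Lt G e g y) : Lt G c a y' ∧ ¬ Lt G e g y' :=
  CL H O D w.rev h2.symm h1.symm h3 h4 h5 h6 hR

/-- maximal element of the chain on the right -/
theorem exMax {V : Type} {G : SimpleGraph V} (H : Crit G) [Finite V] {k : ℕ} (O : OG G k) (D : Dbl G k) {a b c d e f g : V} (w : Win G k a b c d e f g) :
    ∃ e1, G.Adj d e1 ∧ G.Adj e1 f ∧ ∀ e', G.Adj d e' → G.Adj e' f → ∀ y, G.Adj e' y → Lt G d b y → G.Adj e1 y := by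
  obtain ⟨h, w1⟩ := w.shR
  have := exTop (fun t => G.Adj d t ∧ G.Adj t f) (fun t x => G.Adj t x ∧ Lt G d b x) ?_
  · rcases this with h | ⟨t, ⟨h1, h2⟩, h3⟩
    · exact absurd ⟨w.de, w.ef⟩ (h e)
    · exact ⟨t, h1, h2, fun e' h4 h5 y h6 h7 => (h3 e' ⟨h4, h5⟩ y ⟨h6, h7⟩).1⟩
  · rintro t t' ⟨h1, h2⟩ ⟨h3, h4⟩
    by_contra hc
    push Not at hc
    obtain ⟨⟨x, ⟨x1, x2⟩, x3⟩, ⟨x', ⟨x1', x2'⟩, x3'⟩⟩ := hc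
    exact (CL H O D (w1.rd h1 h2) h3 h4 x1 (fun h => x3 h x2) x1' (fun h => x3' h x2') x2).2 x2'

/-- the difference vertex on the right -/
theorem exDiff {V : Type} {G : SimpleGraph V} (H : Crit G) {k : ℕ} (O : OG G k) (D : Dbl G k) {a b c d e f g : V} (w : Win G k a b c d e f g)
    {e1 e0 : V} (h1 : G.Adj d e1) (h2 : G.Adj e1 f) (h3 : G.Adj d e0) (h4 : G.Adj e0 f) (ne : e0 ≠ e1)
    (hm : ∀ e', G.Adj d e' → G.Adj e' f → ∀ y, G.Adj e' y → Lt G d b y → G.Adj e1 y) :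
    ∃ z, G.Adj e1 z ∧ ¬ G.Adj e0 z ∧ Lt G d b z := by
  obtain ⟨h, w1⟩ := w.shR
  obtain ⟨z, z1, z2⟩ := H.inc e1 e0 ne.symm
  obtain ⟨y, y1, y2⟩ := H.inc e0 e1 ne
  refine ⟨z, z1, z2, ?_⟩
  by_contra hz
  have := ChR H O D (w1.rd h1 h2).rev h3.symm z1 z2 y1 y2
  rcases this with h | h
  · exact hz h
  · exact y2 (hm e0 h3 h4 y y1 h)

theorem alpha1 {V : Type} {G : SimpleGraph V} (H : Crit G) [Finite V] {k : ℕ} (O : OG G k) (D : Dbl G k) {a b c d e f g : V} (w : Win G k a b c d e f g) : False := by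
  obtain ⟨e1, de1, ef1, hm1⟩ := exMax H O D w
  obtain ⟨c1, dc1, cb1, hm2⟩ := exMax H O D w.rev
  have exE : ∃ e0, e0 ≠ e1 ∧ G.Adj d e0 ∧ G.Adj e0 f := by
    obtain ⟨h, w1⟩ := (w.re de1 ef1).shR
    exact D _ _ _ _ _ _ _ w1
  have exC : ∃ c0, c0 ≠ c1 ∧ G.Adj d c0 ∧ G.Adj c0 b := by
    obtain ⟨h, w1⟩ := (w.rc cb1.symm dc1.symm).shL
    obtain ⟨x, h1, h2, h3⟩ := D _ _ _ _ _ _ _ w1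
    exact ⟨x, h1, h3.symm, h2.symm⟩
  obtain ⟨e0, ne, de0, ef0⟩ := exE
  obtain ⟨c0, nc, dc0, cb0⟩ := exC
  obtain ⟨v', v1, v2, v3⟩ := D _ _ _ _ _ _ _ ((w.re de0 ef0).rc cb0.symm dc0.symm)
  have v4 : G.Adj e1 v' := hm1 e0 de0 ef0 v' v3.symm ⟨c0, dc0, cb0, v2⟩
  have v5 : G.Adj c1 v' := hm2 c0 dc0 cb0 v' v2 ⟨e0, de0, ef0, v3.symm⟩
  obtain ⟨z, z1, z2, s, s1, s2, s3⟩ := exDiff H O D w de1 ef1 de0 ef0 ne hm1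
  obtain ⟨y, y1, y2, t, t1, t2, t3⟩ := exDiff H O D w.rev dc1 cb1 dc0 cb0 nc hm2
  have z3 : G.Adj c1 z := hm2 s s1 s2 z s3 ⟨e1, de1, ef1, z1⟩
  have y3 : G.Adj e1 y := hm1 t t1 t2 y t3 ⟨c1, dc1, cb1, y1⟩
  have L0 : Lt G c1 a c0 := ⟨b, cb1, w.ab.symm, cb0.symm⟩
  have R0 : Lt G e1 g e0 := ⟨f, ef1, w.fg, ef0.symm⟩
  have M := (w.re de1 ef1).rc cb1.symm dc1.symm
  clear hm1 hm2
  have Mv := M.rd v5 v4.symm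
  have My := M.rd y1 y3.symm
  have Mz := M.rd z3 z1.symm
  -- the differences of `d` (or `v'`) against `z`, `y`
  have zd : ∀ x, G.Adj z x → ¬ G.Adj d x → Lt G c1 a x := fun x h1 h2 =>
    (CR H O D M z3 z1.symm de0 (fun h => z2 h.symm) h1 h2 R0).1
  have zv : ∀ x, G.Adj z x → ¬ G.Adj v' x → Lt G c1 a x := fun x h1 h2 =>
    (CR H O D Mv z3 z1.symm v3 (fun h => z2 h.symm) h1 h2 R0).1
  have yd : ∀ x, G.Adj y x → ¬ G.Adj d x → Lt G e1 g x := fun x h1 h2 =>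
    (CL H O D M y1 y3.symm dc0 (fun h => y2 h.symm) h1 h2 L0).1
  have yv : ∀ x, G.Adj y x → ¬ G.Adj v' x → Lt G e1 g x := fun x h1 h2 =>
    (CL H O D Mv y1 y3.symm v2.symm (fun h => y2 h.symm) h1 h2 L0).1
  have lr : ∀ x, Lt G c1 a x → ¬ Lt G e1 g x := fun x h1 h2 => LR O M h1 h2
  have nzd : z ≠ d := fun h => z2 (h ▸ de0.symm)
  have nzv : z ≠ v' := fun h => z2 (h ▸ v3.symm)
  have nyd : y ≠ d := fun h => y2 (h ▸ dc0.symm)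
  have nyv : y ≠ v' := fun h => y2 (h ▸ v2)
  have exg : ∃ x, G.Adj z x ∧ ¬ G.Adj d x ∧ ¬ G.Adj v' x := by
    obtain ⟨g1, p1, p2⟩ := H.inc z d nzd
    obtain ⟨g2, q1, q2⟩ := H.inc z v' nzv
    by_cases h1 : G.Adj v' g1
    · by_cases h2 : G.Adj d g2
      · exact absurd (zv g2 q1 q2) (CL H O D Mv dc1.symm de1 h1 p2 h2 q2 (zd g1 p1 p2)).2
      · exact ⟨g2, q1, h2, q2⟩
    · exact ⟨g1, p1, p2, h1⟩
  have exh : ∃ x, G.Adj y x ∧ ¬ G.Adj d x ∧ ¬ G.Adj v' x := by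
    obtain ⟨g1, p1, p2⟩ := H.inc y d nyd
    obtain ⟨g2, q1, q2⟩ := H.inc y v' nyv
    by_cases h1 : G.Adj v' g1
    · by_cases h2 : G.Adj d g2
      · exact absurd (yv g2 q1 q2) (CR H O D Mv dc1.symm de1 h1 p2 h2 q2 (yd g1 p1 p2)).2
      · exact ⟨g2, q1, h2, q2⟩
    · exact ⟨g1, p1, p2, h1⟩
  obtain ⟨p, p1, p2, p3⟩ := exg
  obtain ⟨q, q1, q2, q3⟩ := exh
  refine T2 H z1 y3 de1.symm v4 v1.symm p1 q1 ?_ p2 p3 ?_ q2 q3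
  · exact fun h => lr p (zd p p1 p2) (yd p h p2)
  · exact fun h => lr q (zd q h q2) (yd q q1 q2)

set_option linter.unusedVariables false

theorem cell2 {V : Type} {G : SimpleGraph V} (H : Crit G) (high : ∀ v, ¬ Low G v) {k : ℕ} (O : OG G k) {a b c d e f g : V} (w : Win G k a b c d e f g)
    (priv : ∀ x, G.Adj d x → G.Adj f x → x = e) : ∃ c', c' ≠ c ∧ G.Adj b c' ∧ G.Adj c' d := by
  obtain ⟨d1, h1, h2, h3, -⟩ := high4 (high d) w.cd.symm w.de w.de
  obtain ⟨d2, h4, h5, h6, h7⟩ := high4 (high d) w.cd.symm w.de h1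
  by_cases e1 : G.Adj d1 b
  · exact ⟨d1, h2, e1.symm, h1.symm⟩
  by_cases e2 : G.Adj d2 b
  · exact ⟨d2, h5, e2.symm, h4.symm⟩
  exact absurd (w.pu O H h1 h4 e1 (fun h => h3 (priv d1 h1 h.symm)) e2 (fun h => h6 (priv d2 h4 h.symm))) h7.symm

theorem alpha3 {V : Type} {G : SimpleGraph V} (H : Crit G) [Finite V] (high : ∀ v, ¬ Low G v) {k : ℕ} (O : OG G k) {a b c u v r s : V} (w : Win G k a b c u v r s)
    (priv : ∀ x, G.Adj u x → G.Adj r x → x = v)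
    (hA : ∀ a', G.Adj b a' → G.Adj a' u → ∀ x, G.Adj a' x → G.Adj v x → x = u) : False := by
  have uv := w.de
  have vr := w.ef
  obtain ⟨c', cc', bc', cu'⟩ := cell2 H high O w priv
  obtain ⟨r', rr', sr', rv'⟩ : ∃ r', r' ≠ r ∧ G.Adj s r' ∧ G.Adj r' v := by
    obtain ⟨t, w1⟩ := w.shR
    exact cell2 H high O w1.rev (fun x h1 h2 => hA c w.bc w.cd x h2 h1)
  have cellb : ∀ a', G.Adj b a' → G.Adj a' u → ∃ b', b' ≠ b ∧ G.Adj a b' ∧ G.Adj b' a' := by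
    intro a' h1 h2
    obtain ⟨t, w1⟩ := (w.rc h1 h2).shL
    exact cell2 H high O w1 (fun x h3 h4 => hA a' h1 h2 x h3 h4)
  let W : V → Prop := fun w => w ≠ u ∧ ¬ G.Adj v w ∧ ∃ p, G.Adj u p ∧ p ≠ v ∧ G.Adj p w
  let T : V → Prop := fun t => ¬ (G.Adj u t ∧ t ≠ v) ∧ ∃ w, W w ∧ G.Adj w t
  have cv : c ≠ v := by rintro rfl; exact w.nbe O w.bc
  have cv' : c' ≠ v := by rintro rfl; exact w.nbe O bc'
  have Av : ∀ a', G.Adj b a' → a' ≠ v := by rintro a' h rfl; exact w.nbe O h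
  have W1 : ∀ x, W x → ∀ p q, G.Adj u p → G.Adj u q → p ≠ v → q ≠ v → p ≠ q → G.Adj p x ∨ G.Adj q x := by
    rintro x ⟨x1, x2, p0, x3, x4, x5⟩ p q up uq pv qv pq
    by_contra hc
    push Not at hc
    exact T2 H x3 uv up uq pq x5 vr x2 hc.1 hc.2 (fun h => x4 (priv _ x3 h.symm)) (fun h => pv (priv _ up h.symm))
      (fun h => qv (priv _ uq h.symm))
  have WA : ∀ a' x, G.Adj b a' → G.Adj a' u → G.Adj a' x → x ≠ u → W x := fun a' x h1 h2 h3 h4 =>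
    ⟨h4, fun h5 => h4 (hA a' h1 h2 x h3 h5), a', h2.symm, Av a' h1, h3⟩
  have uW : ∀ x, W x → ¬ G.Adj u x := by
    rintro x ⟨-, -, p, h1, h2, h3⟩
    exact H.nadj_of_common h1.symm h3
  have Tv : ∀ t, T t → ¬ G.Adj u t := by
    rintro t ⟨h1, x, ⟨h2, h3, -⟩, h4⟩ h5
    exact h1 ⟨h5, fun e => h3 (e ▸ h4.symm)⟩
  have T1 : ∀ t, T t → ∃ a', G.Adj b a' ∧ G.Adj a' u ∧ ∃ x, x ≠ u ∧ G.Adj a' x ∧ G.Adj x t := by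
    rintro t ⟨h1, x, h2, h3⟩
    rcases W1 x h2 c c' w.cd.symm cu'.symm cv cv' cc'.symm with h | h
    · exact ⟨c, w.bc, w.cd, x, h2.1, h, h3⟩
    · exact ⟨c', bc', cu', x, h2.1, h, h3⟩
  have T3 : ∀ t, T t → ∀ a', G.Adj b a' → G.Adj a' u → ∀ x, x ≠ u → G.Adj a' x → G.Adj x t → ∀ p q, G.Adj a' p → G.Adj a' q →
      p ≠ u → q ≠ u → p ≠ q → G.Adj p t ∨ G.Adj q t := by
    intro t ht a' h1 h2 x h3 h4 h5 p q ap aq pu qu pq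
    by_contra hc
    push Not at hc
    have N : ∀ x, G.Adj a' x → x ≠ u → ¬ G.Adj x v := fun x h3 h4 h5 => h4 (hA a' h1 h2 x h3 h5.symm)
    exact T2 H h4 h2 ap aq pq h5 uv (Tv t ht) hc.1 hc.2 (N x h4 h3) (N p ap pu) (N q aq qu)
  -- no edges from `T` to `N(v)`
  have TE : ∀ t, T t → ∀ x, G.Adj v x → x ≠ u → ¬ G.Adj t x := by
    intro t ht x vx xu tx
    obtain ⟨a', h1, h2, y, h3, h4, h5⟩ := T1 t ht
    obtain ⟨b', b1, b2, b3⟩ := cellb a' h1 h2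
    have bu : b ≠ u := by rintro rfl; exact w.nad O w.ab
    have bu' : b' ≠ u := by rintro rfl; exact w.nad O b2
    have : ∃ z, G.Adj a z ∧ G.Adj z t := by
      rcases T3 t ht a' h1 h2 y h3 h4 h5 b b' h1.symm b3.symm bu bu' b1.symm with h | h
      · exact ⟨b, w.ab, h⟩
      · exact ⟨b', b2, h⟩
    obtain ⟨z, z1, z2⟩ := this
    have n1 : ¬ G.Adj t r := fun h => w.far4 O z1 z2 h w.fg
    have n2 : ¬ G.Adj t r' := fun h => w.far4 O z1 z2 h sr'.symm
    have N : ∀ x, G.Adj v x → x ≠ u → ¬ G.Adj x a' := fun x h3 h4 h5 => h4 (hA a' h1 h2 x h5.symm h3)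
    have ru : r ≠ u := by rintro rfl; exact w.ndg O w.fg
    have ru' : r' ≠ u := by rintro rfl; exact w.ndg O sr'.symm
    exact T2 H vx uv.symm vr rv'.symm rr'.symm tx.symm h2.symm (Tv t ht) (fun h => n1 h.symm) (fun h => n2 h.symm)
      (N x vx xu) (N r vr ru) (N r' rv'.symm ru')
  -- a third neighbour
  have U3 : ∀ x y, G.Adj u x → G.Adj u y → ∃ p, G.Adj u p ∧ p ≠ v ∧ p ≠ x ∧ p ≠ y := by
    intro x y hx hy
    obtain ⟨p, h1, h2, h3, h4⟩ := high4 (high u) uv hx hy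
    exact ⟨p, h1, h2, h3, h4⟩
  have W2 : ∀ x, W x → ∃ p q, p ≠ q ∧ G.Adj u p ∧ p ≠ v ∧ G.Adj u q ∧ q ≠ v ∧ G.Adj x p ∧ G.Adj x q := by
    intro x hx
    obtain ⟨-, -, p, p1, p2, p3⟩ := id hx
    obtain ⟨q, q1, q2, q3, -⟩ := U3 p p p1 p1
    by_cases h : G.Adj q x
    · exact ⟨p, q, q3.symm, p1, p2, q1, q2, p3.symm, h.symm⟩
    · obtain ⟨q', q1', q2', q3', q4'⟩ := U3 p q p1 q1
      rcases W1 x hx q q' q1 q1' q2 q2' q4'.symm with h' | h'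
      · exact absurd h' h
      · exact ⟨p, q', q3'.symm, p1, p2, q1', q2', p3.symm, h'.symm⟩
  have out : ∀ t x p, T t → G.Adj t x → ¬ W x → G.Adj u p → p ≠ v → ¬ G.Adj p x := by
    intro t x p ht tx hx up pv px
    have xu : x ≠ u := by rintro rfl; exact Tv t ht tx.symm
    by_cases h : G.Adj v x
    · exact TE t ht x h xu tx
    · exact hx ⟨xu, h, p, up, pv, px⟩
  have cmp : ∀ t t' x, T t → T t' → W x → G.Adj x t → G.Adj x t' →
      (∀ y, G.Adj t y ∧ ¬ W y → G.Adj t' y ∧ ¬ W y) ∨ (∀ y, G.Adj t' y ∧ ¬ W y → G.Adj t y ∧ ¬ W y) := by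
    intro t t' x ht ht' hx h1 h2
    by_contra hc
    push Not at hc
    obtain ⟨⟨y, ⟨y1, y2⟩, y3⟩, ⟨y', ⟨y1', y2'⟩, y3'⟩⟩ := hc
    obtain ⟨p, q, pq, p1, p2, q1, q2, p3, q3⟩ := W2 x hx
    exact T2 H h1 h2 p3 q3 pq y1 y1' (fun h => y2 (y3 h)) (out t y p ht y1 y2 p1 p2) (out t y q ht y1 y2 q1 q2)
      (fun h => y2' (y3' h)) (out t' y' p ht' y1' y2' p1 p2) (out t' y' q ht' y1' y2' q1 q2)
  -- two further neighbours of `a'`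
  have A3 : ∀ a' x y, G.Adj a' u → G.Adj a' x → G.Adj a' y → ∃ p, G.Adj a' p ∧ p ≠ u ∧ p ≠ x ∧ p ≠ y := by
    intro a' x y h hx hy
    obtain ⟨p, h1, h2, h3, h4⟩ := high4 (high a') h hx hy
    exact ⟨p, h1, h2, h3, h4⟩
  have shA : ∀ t t' a' x x', T t → T t' → G.Adj b a' → G.Adj a' u → G.Adj a' x → x ≠ u → G.Adj x t → G.Adj a' x' → x' ≠ u → G.Adj x' t' →
      ∃ y, W y ∧ G.Adj y t ∧ G.Adj y t' := by
    intro t t' a' x x' ht ht' h1 h2 h3 h4 h5 h6 h7 h8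
    by_cases e1 : G.Adj x t'
    · exact ⟨x, WA a' x h1 h2 h3 h4, h5, e1⟩
    by_cases e2 : G.Adj x' t
    · exact ⟨x', WA a' x' h1 h2 h6 h7, e2, h8⟩
    obtain ⟨p, p1, p2, p3, p4⟩ := A3 a' x x' h2 h3 h6
    have f1 := T3 t ht a' h1 h2 x h4 h3 h5 p x' p1 h6 p2 h7 p4
    have f2 := T3 t' ht' a' h1 h2 x' h7 h6 h8 p x p1 h3 p2 h4 p3
    exact ⟨p, WA a' p h1 h2 p1 p2, by tauto, by tauto⟩
  have share : ∀ t t', T t → T t' → ∃ y, W y ∧ G.Adj y t ∧ G.Adj y t' := by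
    intro t t' ht ht'
    by_contra hno
    obtain ⟨a1, h1, h2, x1, h3, h4, h5⟩ := T1 t ht
    obtain ⟨a2, g1, g2, x2, g3, g4, g5⟩ := T1 t' ht'
    have na : ∀ y, G.Adj a1 y → y ≠ u → ¬ G.Adj y t' := fun y y1 y2 y3 =>
      hno (shA t t' a1 x1 y ht ht' h1 h2 h4 h3 h5 y1 y2 y3)
    have nb : ∀ y, G.Adj a2 y → y ≠ u → ¬ G.Adj y t := fun y y1 y2 y3 =>
      hno (shA t t' a2 y x2 ht ht' g1 g2 y1 y2 y3 g4 g3 g5)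
    have bu : b ≠ u := by rintro rfl; exact w.nad O w.ab
    have bt := nb b g1.symm bu
    have bt' := na b h1.symm bu
    -- other than `b`, neighbours of `a1` are adjacent to `t`, and not to `a2`
    have m1 : ∀ y, G.Adj a1 y → y ≠ u → y ≠ b → G.Adj y t ∧ ¬ G.Adj a2 y := by
      intro y y1 y2 y3
      have : G.Adj y t := (T3 t ht a1 h1 h2 x1 h3 h4 h5 y b y1 h1.symm y2 bu y3).resolve_right bt
      exact ⟨this, fun h => nb y h y2 this⟩
    have m2 : ∀ y, G.Adj a2 y → y ≠ u → y ≠ b → G.Adj y t' ∧ ¬ G.Adj a1 y := by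
      intro y y1 y2 y3
      have : G.Adj y t' := (T3 t' ht' a2 g1 g2 x2 g3 g4 g5 y b y1 g1.symm y2 bu y3).resolve_right bt'
      exact ⟨this, fun h => na y h y2 this⟩
    obtain ⟨p, p1, p2, p3, p4⟩ := U3 a1 a2 h2.symm g2.symm
    have k1 : ∀ y, G.Adj a1 y → y ≠ u → y ≠ b → G.Adj p y := by
      intro y y1 y2 y3
      exact (W1 y (WA a1 y h1 h2 y1 y2) p a2 p1 g2.symm p2 (Av a2 g1) p4).resolve_right (m1 y y1 y2 y3).2
    have k2 : ∀ y, G.Adj a2 y → y ≠ u → y ≠ b → G.Adj p y := by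
      intro y y1 y2 y3
      exact (W1 y (WA a2 y g1 g2 y1 y2) p a1 p1 h2.symm p2 (Av a1 h1) p3).resolve_right (m2 y y1 y2 y3).2
    have xb : x1 ≠ b := fun e => bt (e ▸ h5)
    have xb' : x2 ≠ b := fun e => bt' (e ▸ g5)
    obtain ⟨y, y1, y2, y3, y4⟩ := A3 a2 x2 b g2 g4 g1.symm
    have q1 := k1 x1 h4 h3 xb
    have q2 := k2 x2 g4 g3 xb'
    have q3 := k2 y y1 y2 y4
    have ep : ∀ z, G.Adj p z → z ≠ u → ¬ G.Adj z v := by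
      intro z z1 z2 z3
      have e1 := TE t ht z z3.symm z2
      have e2 := TE t' ht' z z3.symm z2
      exact T2 H q1 q2 p1.symm z1 z2.symm h5 g5 (nb x2 g4 g3) (Tv t ht) (fun h => e1 h.symm)
        (na x1 h4 h3) (Tv t' ht') (fun h => e2 h.symm)
    exact T2 H q1 p1.symm q2 q3 y3.symm h5 uv (Tv t ht) (nb x2 g4 g3) (nb y y1 y2) (ep x1 q1 h3) (ep x2 q2 g3) (ep y q3 y2)
  have top := exTop T (fun t x => G.Adj t x ∧ ¬ W x) (fun t t' ht ht' => by
    obtain ⟨y, y1, y2, y3⟩ := share t t' ht ht'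
    exact cmp t t' y ht ht' y1 y2 y3)
  refine lemH H uv W T (fun _ => Iff.rfl) (fun _ => Iff.rfl) ?_
  rcases top with h | ⟨t1, h1, h2⟩
  · exact Or.inl h
  · exact Or.inr ⟨t1, h1, fun t ht x hx hW => (h2 t ht x ⟨hx, hW⟩).1⟩

set_option linter.unusedVariables false

theorem lemZ {V : Type} {G : SimpleGraph V} (H : Crit G) {k : ℕ} (O : OG G k) {a b c v e f g : V} (w : Win G k a b c v e f g)
    (priv : ∀ x, G.Adj c x → G.Adj e x → x = v) {p x y b' f' : V} (cp : G.Adj c p) (pv : p ≠ v) (py : G.Adj p y) (vy : G.Adj v y) (yf : G.Adj y f)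
    (vx : G.Adj v x) (bx : G.Adj b x) (px : ¬ G.Adj p x) (ff : f' ≠ f) (ef : G.Adj e f') (fg : G.Adj f' g) (fy : G.Adj f' y)
    (bb : b' ≠ b) (ab : G.Adj a b') (bc : G.Adj b' c) : False := by
  have x1 : ¬ G.Adj f x := fun h => w.bf O bx h.symm
  have x2 : ¬ G.Adj f' x := fun h => w.bg O bx h.symm fg
  obtain ⟨s, s1, s2⟩ := H.inc p v pv
  have b1 : ¬ G.Adj b' e := (w.rb ab.symm.symm bc |>.rb ab bc).nbe O
  have R : ∃ r, G.Adj a r ∧ G.Adj r s := by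
    by_contra hc
    push Not at hc
    exact T2 H cp w.cd.symm.symm w.bc.symm bc.symm bb.symm s1 w.de s2 (hc b w.ab) (hc b' ab) (fun h => pv (priv p cp h.symm)) (w.nbe O) b1
  have E : ∃ r, G.Adj r g ∧ G.Adj r s := by
    by_contra hc
    push Not at hc
    exact T2 H py.symm vy.symm yf fy.symm ff.symm s1 vx s2 (hc f w.fg) (hc f' fg) px x1 x2
  obtain ⟨r, r1, r2⟩ := R
  obtain ⟨r', r1', r2'⟩ := E
  exact w.far4 O r1 r2 r2'.symm r1'

theorem alpha2core {V : Type} {G : SimpleGraph V} (H : Crit G) [Finite V] (high : ∀ v, ¬ Low G v) {k : ℕ} (O : OG G k) {a b c v e f g : V} (w : Win G k a b c v e f g)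
    (priv : ∀ x, G.Adj c x → G.Adj e x → x = v) {x y : V} (bx : G.Adj b x) (xv : G.Adj v x) (xc : x ≠ c) (fy : G.Adj y f) (yv : G.Adj v y) (ye : y ≠ e)
    (hE : ∀ e', G.Adj e e' → G.Adj e' g → ∀ y', G.Adj v y' → G.Adj y' f → G.Adj e' y') : False := by
  obtain ⟨z, wl⟩ := w.shL
  obtain ⟨h, wr⟩ := w.shR
  have vc := w.cd.symm
  have ve := w.de
  have cb := w.bc.symm
  have ef := w.ef
  obtain ⟨b', bb, ab, bc⟩ := cell2 H high O wl priv
  obtain ⟨f', ff, fg, fe⟩ := cell2 H high O wr.rev (fun x h1 h2 => priv x h2 h1)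
  have RY : ∀ r y', G.Adj a r → G.Adj y' f → ¬ G.Adj r y' := fun r y' h1 h2 h3 => w.af O h1 h3 h2
  have XE : ∀ x' e', G.Adj b x' → G.Adj e' g → ¬ G.Adj x' e' := fun x' e' h1 h2 h3 => w.bg O h1 h3 h2
  have TV : ∀ r e' s t, G.Adj a r → G.Adj r c → G.Adj e e' → G.Adj e' g → G.Adj v s → G.Adj v t → s ≠ t → ¬ G.Adj s r → ¬ G.Adj s e' →
      ¬ G.Adj t r → ¬ G.Adj t e' → False := by
    intro r e' s t h1 h2 h3 h4 h5 h6 h7 n1 n2 n3 n4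
    exact T2 H vc ve h5 h6 h7 h2.symm h3 (fun h => RY r e h1 ef h.symm) n1 n3 (XE c e' w.bc h4) n2 n4
  obtain ⟨q, eq, yq⟩ := H.inc e y ye.symm
  have qv : q ≠ v := by rintro rfl; exact yq yv.symm
  have qg : ¬ G.Adj q g := fun h => yq (hE q eq h y yv fy).symm
  have cq : ¬ G.Adj c q := fun h => qv (priv q h eq)
  have qu : ∀ s, G.Adj e s → s ≠ v → ¬ G.Adj s g → s = q := fun s h1 h2 h3 =>
    wr.pu O H h1 eq (fun h => h2 (priv s h.symm h1)) h3 (fun h => cq h.symm) qg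
  have qY : ∀ y', G.Adj v y' → G.Adj y' f → y' ≠ e → ¬ G.Adj y' q := by
    intro y' h1 h2 h3 h4
    obtain ⟨s, s1, s2⟩ := H.inc e y' h3.symm
    have := qu s s1 (by rintro rfl; exact s2 h1.symm) (fun h => s2 (hE s s1 h y' h1 h2).symm)
    exact s2 (this ▸ h4)
  have be : ¬ G.Adj b e := w.nbe O
  have bY : ∀ y', G.Adj y' f → ¬ G.Adj y' b := fun y' h1 h2 => RY b y' w.ab h1 h2.symm
  have Yu : ∀ y', G.Adj v y' → G.Adj y' f → y' ≠ e → y' = y := by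
    intro y' h1 h2 h3
    by_contra hne
    exact T2 H ve vc h1 yv hne eq cb cq (qY y' h1 h2 h3) yq (fun h => be h.symm) (bY y' h2) (bY y fy)
  have QR : ∀ r s, G.Adj a r → G.Adj r c → G.Adj v s → s ≠ y → ¬ G.Adj s r → G.Adj s q := by
    intro r s h1 h2 h3 h4 h5
    by_contra h6
    exact T2 H ve vc h3 yv h4 eq h2.symm cq h6 yq (fun h => RY r e h1 ef h.symm) h5 (fun h => RY r y h1 fy h.symm)
  have xf : ¬ G.Adj x f := w.bf O bx
  have cf : ¬ G.Adj c f := w.ncf O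
  by_cases case1 : ∀ r, G.Adj a r → G.Adj r c → ∀ x', G.Adj v x' → G.Adj b x' → G.Adj r x'
  · obtain ⟨p, cp, xp⟩ := H.inc c x xc.symm
    have pv : p ≠ v := by rintro rfl; exact xp xv.symm
    have ep : ¬ G.Adj e p := fun h => pv (priv p cp h)
    have pa : ¬ G.Adj p a := fun h => xp (case1 p h.symm cp.symm x xv bx).symm
    by_cases h1 : G.Adj y p
    · exact lemZ H O w priv cp pv h1.symm yv fy xv bx (fun h => xp h.symm) ff fe.symm fg.symm (hE f' fe.symm fg.symm y yv fy) bb ab bc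
    by_cases h2 : G.Adj x q
    · exact lemZ H O w.rev (fun x h1 h2 => priv x h2 h1) eq qv h2.symm xv bx.symm yv fy.symm (fun h => yq h.symm) bb bc.symm ab.symm
        (case1 b' ab bc x xv bx) ff fg.symm.symm fe
    · exact T2 H vc ve xv yv (by rintro rfl; exact xf fy) cp eq ep xp h1 cq h2 yq
  push Not at case1
  obtain ⟨r, ar, rc, x0, x1, x2, rx⟩ := case1
  have x0c : x0 ≠ c := by rintro rfl; exact rx rc
  clear xc bx xv xf
  clear x
  obtain ⟨x, rfl⟩ : ∃ x, x = x0 := ⟨_, rfl⟩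
  have xf : ¬ G.Adj x f := w.bf O x2
  have xy : x ≠ y := by rintro rfl; exact xf fy
  have rx' : ¬ G.Adj x r := fun h => rx h.symm
  have xq : G.Adj x q := QR r x ar rc x1 xy rx'
  have re : ¬ G.Adj r e := RY r e ar ef
  have ry : ¬ G.Adj r y := RY r y ar fy
  have P1 : ∀ s, G.Adj v s → G.Adj s b ∨ s = e ∨ s = y := by
    intro s vs
    by_contra hc
    push Not at hc
    obtain ⟨sb, se, sy⟩ := hc
    have sf : ¬ G.Adj s f := fun h => sy (Yu s vs h se)
    have xs : x ≠ s := by rintro rfl; exact sb x2.symm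
    have sr : G.Adj s r := by
      by_contra h
      exact TV r f x s ar rc ef w.fg x1 vs xs rx' xf h sf
    exact T2 H x1 vs ve yv ye.symm x2.symm sr sb (fun h => be h.symm) (bY y fy) rx' (fun h => re h.symm) (fun h => ry h.symm)
  have qX : ∀ x', x' ≠ c → G.Adj v x' → G.Adj b x' → G.Adj x' q := by
    intro x' h1 h2 h3
    by_contra h4
    exact T2 H x1 yv vc h2 h1.symm xq fy yq cq h4 xf cf (w.bf O h3)
  by_cases two : ∀ x', G.Adj v x' → G.Adj b x' → x' = c ∨ x' = x
  · have pr : ∀ s, G.Adj v s → G.Adj r s → s = c := by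
      intro s s1 s2
      rcases P1 s s1 with h | rfl | rfl
      · rcases two s s1 h.symm with h | h
        · exact h
        · exact absurd (h ▸ s2) rx
      · exact absurd s2 re
      · exact absurd s2 ry
    have exp : ∃ p, G.Adj y p ∧ G.Adj c p ∧ p ≠ v := by
      by_contra hc
      push Not at hc
      refine alpha3 H high O (w.rb ar rc).rev pr ?_
      intro a' h1 h2 s h3 h4
      by_cases h5 : a' = e
      · subst h5
        exact priv s h4 h3
      · have := Yu a' h2.symm h1.symm h5
        subst this
        exact hc s h3 h4
    obtain ⟨p, yp, cp, pv⟩ := exp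
    have pa : ¬ G.Adj a p := fun h => RY p y h fy yp.symm
    have pe : ¬ G.Adj p e := fun h => pv (priv p cp h.symm)
    by_cases px : G.Adj p x
    · have wlr := wl.rc ar rc
      obtain ⟨z', wl2⟩ := wlr.shL
      obtain ⟨d, da, zd, dr⟩ := cell2 H high O wl2 (fun s h1 h2 => pr s h2 h1)
      have rb : r ≠ b := by rintro rfl; exact rx x2
      obtain ⟨k', rk, bk⟩ := H.inc r b rb
      have vk : ¬ G.Adj v k' := fun h => bk (pr k' h rk ▸ w.bc)
      have pb : p ≠ b := by rintro rfl; exact pa w.ab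
      have pk : G.Adj p k' := by
        by_contra hpk
        exact T2 H rc.symm w.cd cp cb pb rk ve vk hpk bk re pe be
      have fk : ¬ G.Adj k' f := w.af O ar rk
      have ck : c ≠ k' := by rintro rfl; exact bk w.bc
      have qk : G.Adj k' q := by
        by_contra hq
        exact T2 H px yp.symm cp.symm pk ck xq fy yq cq hq xf cf fk
      have aq : ¬ G.Adj a q := fun h => wl.af O wl.ab h eq.symm
      have dq : ¬ G.Adj d q := fun h => wl.af O zd h eq.symm
      exact T2 H rk rc ar.symm dr.symm da.symm qk w.cd cq aq dq (fun h => vk h.symm) (w.nad O) (wl.ae O zd)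
    · exact lemZ H O w priv cp pv yp.symm yv fy x1 x2 px ff fe.symm fg.symm (hE f' fe.symm fg.symm y yv fy) bb ab bc
  · push Not at two
    obtain ⟨x', v1, v2, v3, v4⟩ := two
    have xf' : ¬ G.Adj x' f := w.bf O v2
    have xr' : G.Adj x' r := by
      by_contra h
      exact TV r f x x' ar rc ef w.fg x1 v1 v4.symm rx' xf h xf'
    have gy : ∀ s, G.Adj x s → ¬ G.Adj x' s → G.Adj y s := by
      intro s s1 s2
      by_contra h
      refine T2 H x1 v1 yv ve ye s1 xr' s2 h ?_ rx' (fun h => ry h.symm) (fun h => re h.symm)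
      intro es
      have sv : s ≠ v := by rintro rfl; exact s2 v1.symm
      have sg : ¬ G.Adj s g := fun h => XE x s x2 h s1
      exact s2 (qu s es sv sg ▸ qX x' v3 v1 v2)
    have RC : ∀ r', G.Adj a r' → G.Adj r' c → G.Adj x' r' := by
      intro r' h1 h2
      by_contra h
      have : G.Adj x r' := by
        by_contra h3
        exact TV r' f x x' h1 h2 ef w.fg x1 v1 v4.symm h3 xf h xf'
      exact RY r' y h1 fy (gy r' this h).symm
    obtain ⟨p, cp, xp⟩ := H.inc c x' v3.symm
    have pv : p ≠ v := by rintro rfl; exact xp v1.symm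
    have pe : ¬ G.Adj e p := fun h => pv (priv p cp h)
    have px : G.Adj x p := by
      by_contra h
      exact T2 H vc ve x1 v1 v4.symm cp ef pe h xp cf xf xf'
    have py := gy p px xp
    exact lemZ H O w priv cp pv py.symm yv fy v1 v2 (fun h => xp h.symm) ff fe.symm fg.symm (hE f' fe.symm fg.symm y yv fy) bb ab bc

theorem alpha2 {V : Type} {G : SimpleGraph V} (H : Crit G) [Finite V] (high : ∀ v, ¬ Low G v) {k : ℕ} (O : OG G k) {a b c v e f g : V} (w : Win G k a b c v e f g)
    (priv : ∀ x, G.Adj c x → G.Adj e x → x = v) : False := by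
  have step : ∀ {a b c v e f g : V}, Win G k a b c v e f g → (∀ x, G.Adj c x → G.Adj e x → x = v) →
      ∃ b', G.Adj a b' ∧ G.Adj b' c ∧ ∃ x, G.Adj b' x ∧ G.Adj v x ∧ x ≠ c := by
    intro a b c v e f g w priv
    by_contra hc
    push Not at hc
    obtain ⟨z, wl⟩ := w.shL
    exact alpha3 H high O wl priv hc
  obtain ⟨b', h1, h2, x, x1, x2, x3⟩ := step w priv
  obtain ⟨f', h3, h4, y, y1, y2, y3⟩ := step w.rev (fun x h1 h2 => priv x h2 h1)
  have w := (w.rb h1 h2).rf h4.symm h3.symm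
  clear h1 h2 h3 h4
  by_cases hE : ∀ e', G.Adj e e' → G.Adj e' g → ∀ y', G.Adj v y' → G.Adj y' f' → G.Adj e' y'
  · exact alpha2core H high O w priv x1 x2 x3 y1.symm y2 y3 hE
  by_cases hR : ∀ e', G.Adj c e' → G.Adj e' a → ∀ y', G.Adj v y' → G.Adj y' b' → G.Adj e' y'
  · exact alpha2core H high O w.rev (fun x h1 h2 => priv x h2 h1) y1 y2 y3 x1.symm x2 x3 hR
  push Not at hE hR
  obtain ⟨s, s1, s2, t, t1, t2, t3⟩ := hE
  obtain ⟨s', s1', s2', t', t1', t2', t3'⟩ := hR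
  have RY : ∀ r y', G.Adj a r → G.Adj y' f' → ¬ G.Adj r y' := fun r y' h1 h2 h3 => w.af O h1 h3 h2
  have XE : ∀ x' e', G.Adj b' x' → G.Adj e' g → ¬ G.Adj x' e' := fun x' e' h1 h2 h3 => w.bg O h1 h3 h2
  have tt : t ≠ t' := by rintro rfl; exact w.bf O t2'.symm t2
  exact T2 H w.de w.cd.symm t1 t1' tt s1 s1' (XE c s w.bc s2) (fun h => t3 h.symm) (XE t' s t2'.symm s2)
    (fun h => RY s' e s2'.symm w.ef h.symm) (fun h => RY s' t s2'.symm t2 h.symm) (fun h => t3' h.symm)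

theorem alpha {V : Type} {G : SimpleGraph V} (H : Crit G) [Finite V] [Nonempty V] (high : ∀ v, ¬ Low G v) : False := by
  obtain ⟨k, O, a, b, c, d, e, f, g, w⟩ := H.exWin
  refine alpha1 H O ?_ w
  intro a b c d e f g w
  by_contra hc
  push Not at hc
  refine alpha2 H high O w ?_
  intro x h1 h2
  by_contra hne
  exact hc x hne h1 h2.symm


theorem c5_of {V : Type} {G : SimpleGraph V} (tri : ∀ a b c, G.Adj a b → G.Adj b c → G.Adj a c → False)
    (h5 : ¬ ∃ c : Fin 5 → V, IsC5 G c) (a b c d e : V) (h1 : G.Adj a b) (h2 : G.Adj b c) (h3 : G.Adj c d) (h4 : G.Adj d e) (h6 : G.Adj e a) : False := by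
  have n1 : a ≠ c := by rintro rfl; exact tri a d e h3 h4 h6.symm
  have n2 : a ≠ d := by rintro rfl; exact tri a b c h1 h2 h3.symm
  have n3 : b ≠ d := by rintro rfl; exact tri b e a h4 h6 h1.symm
  have n4 : b ≠ e := by rintro rfl; exact tri b c d h2 h3 h4.symm
  have n5 : c ≠ e := by rintro rfl; exact tri c a b h6 h1 h2.symm
  have m1 := h1.ne
  have m2 := h2.ne
  have m3 := h3.ne
  have m4 := h4.ne
  have m5 := h6.ne
  refine h5 ⟨![a, b, c, d, e], ?_, ?_⟩
  · intro i j
    fin_cases i <;> fin_cases j <;> simp <;> grind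
  · intro i
    fin_cases i <;> simp [*]

theorem fork_of {V : Type} {G : SimpleGraph V} (h : ForkFree G) (v a b c d x y : V) (va : G.Adj v a) (vb : G.Adj v b) (vc : G.Adj v c)
    (vd : G.Adj v d) (cd : c ≠ d) (ax : G.Adj a x) (yb : G.Adj b y) (xb : ¬ G.Adj x b) (xc : ¬ G.Adj x c) (xd : ¬ G.Adj x d)
    (ya : ¬ G.Adj y a) (yc : ¬ G.Adj y c) (yd : ¬ G.Adj y d) (tri : ∀ a b c, G.Adj a b → G.Adj b c → G.Adj a c → False)
    (c5 : ∀ a b c d e, G.Adj a b → G.Adj b c → G.Adj c d → G.Adj d e → G.Adj e a → False) : False := by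
  have sy : ∀ s t, ¬ G.Adj s t → ¬ G.Adj t s := fun s t h h' => h h'.symm
  have nc : ∀ s t, G.Adj v s → G.Adj v t → ¬ G.Adj s t := fun s t h1 h2 h3 => tri v s t h1 h3 h2
  have xy : ¬ G.Adj x y := fun h => c5 v a x y b va ax h yb.symm vb.symm
  have vx : ¬ G.Adj v x := fun h => tri v a x va ax h
  have vy : ¬ G.Adj v y := fun h => tri v b y vb yb h
  have ab : a ≠ b := by rintro rfl; exact xb ax.symm
  have ac : a ≠ c := by rintro rfl; exact xc ax.symm
  have ad : a ≠ d := by rintro rfl; exact xd ax.symm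
  have bc : b ≠ c := by rintro rfl; exact yc yb.symm
  have bd : b ≠ d := by rintro rfl; exact yd yb.symm
  have nxy : x ≠ y := by rintro rfl; exact ya ax.symm
  have nx : ∀ s, G.Adj v s → s ≠ x ∧ s ≠ y := fun s hs => ⟨by rintro rfl; exact vx hs, by rintro rfl; exact vy hs⟩
  have nvx : v ≠ x := by rintro rfl; exact xc vc
  have nvy : v ≠ y := by rintro rfl; exact yc vc
  have q1 := nx a va
  have q2 := nx b vb
  have q3 := nx c vc
  have q4 := nx d vd
  have r1 := va.ne
  have r2 := vb.ne
  have r3 := vc.ne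
  have r4 := vd.ne
  have inj : Function.Injective ![v, c, d, a, x, b, y] := by
    intro i j
    fin_cases i <;> fin_cases j <;> simp <;> grind
  refine h.false ⟨⟨![v, c, d, a, x, b, y], inj⟩, ?_⟩
  have n1 := nc a b va vb
  have n2 := nc a c va vc
  have n3 := nc a d va vd
  have n4 := nc b c vb vc
  have n5 := nc b d vb vd
  have n6 := nc c d vc vd
  have s1 := sy _ _ n1
  have s2 := sy _ _ n2
  have s3 := sy _ _ n3
  have s4 := sy _ _ n4
  have s5 := sy _ _ n5
  have s6 := sy _ _ n6
  have s7 := sy _ _ xy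
  have s8 := sy _ _ vx
  have s9 := sy _ _ vy
  have t1 := sy _ _ xb
  have t2 := sy _ _ xc
  have t3 := sy _ _ xd
  have t4 := sy _ _ ya
  have t5 := sy _ _ yc
  have t6 := sy _ _ yd
  have u1 := va.symm
  have u2 := vb.symm
  have u3 := vc.symm
  have u4 := vd.symm
  have u5 := ax.symm
  have u6 := yb.symm
  intro i j
  fin_cases i <;> fin_cases j <;> simp [fork, *]

theorem exCrit {V : Type} [Fintype V] (G : SimpleGraph V) (tri : ∀ a b c, G.Adj a b → G.Adj b c → G.Adj a c → False)
    (c5 : ∀ a b c d e, G.Adj a b → G.Adj b c → G.Adj c d → G.Adj d e → G.Adj e a → False) (h : ForkFree G)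
    (hcol : ¬ ∃ φ : V → Fin 3, ∀ a b, G.Adj a b → φ a ≠ φ b) : False := by
  classical
  obtain ⟨S, hS, hmin⟩ : ∃ S : Finset V, (¬ ∃ φ : V → Fin 3, ∀ a ∈ S, ∀ b ∈ S, G.Adj a b → φ a ≠ φ b) ∧
      ∀ S' : Finset V, S'.card < S.card → ∃ φ : V → Fin 3, ∀ a ∈ S', ∀ b ∈ S', G.Adj a b → φ a ≠ φ b := by
    obtain ⟨S, h1, h2⟩ := Finset.exists_min_image
      ((Finset.univ : Finset (Finset V)).filter (fun S => ¬ ∃ φ : V → Fin 3, ∀ a ∈ S, ∀ b ∈ S, G.Adj a b → φ a ≠ φ b)) Finset.card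
      ⟨Finset.univ, by simpa using hcol⟩
    simp only [Finset.mem_filter, Finset.mem_univ, true_and] at h1 h2
    refine ⟨S, h1, fun S' hS' => ?_⟩
    by_contra hc
    exact absurd (h2 S' hc) (by omega)
  let G' : SimpleGraph {x // x ∈ S} := G.comap Subtype.val
  have adj : ∀ a b : {x // x ∈ S}, G'.Adj a b ↔ G.Adj a.1 b.1 := fun _ _ => Iff.rfl
  have H : Crit G' := by
    refine ⟨fun a b c => tri a.1 b.1 c.1, fun a b c d e => c5 a.1 b.1 c.1 d.1 e.1, ?_, ?_, ?_⟩
    · intro v a b c d x y h1 h2 h3 h4 h5 h6 h7 h8 h9 h10 h11 h12 h13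
      exact fork_of h v.1 a.1 b.1 c.1 d.1 x.1 y.1 h1 h2 h3 h4 (fun e => h5 (Subtype.ext e)) h6 h7 h8 h9 h10 h11 h12 h13 tri c5
    · intro φ hφ
      refine hS ⟨fun x => if hx : x ∈ S then φ ⟨x, hx⟩ else 0, ?_⟩
      intro a ha b hb hab
      simp only [ha, hb, dif_pos]
      exact hφ ⟨a, ha⟩ ⟨b, hb⟩ hab
    · intro v
      obtain ⟨φ, hφ⟩ := hmin (S.erase v.1) (Finset.card_erase_lt_of_mem v.2)
      refine ⟨fun x => φ x.1, fun a b h1 h2 hab => hφ a.1 ?_ b.1 ?_ hab⟩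
      · exact Finset.mem_erase.2 ⟨fun e => h1 (Subtype.ext e), a.2⟩
      · exact Finset.mem_erase.2 ⟨fun e => h2 (Subtype.ext e), b.2⟩
  have ne : Nonempty {x // x ∈ S} := by
    by_contra hc
    refine hS ⟨fun _ => 0, fun a ha => (hc ⟨a, ha⟩).elim⟩
  rcases H.dich with h | h
  · exact cubic H h
  · exact alpha H h

theorem fork_free_odd_girth_seven_three_colorable {V : Type} [Fintype V]
    (G : SimpleGraph V) (h2 : ForkFree G) (h1 : G.CliqueFree 3)
    (h5 : ¬ ∃ c : Fin 5 → V, IsC5 G c) :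
    G.chromaticNumber ≤ 3 := by
  classical
  have tri : ∀ a b c, G.Adj a b → G.Adj b c → G.Adj a c → False := fun a b c hab hbc hac =>
    h1 {a, b, c} (SimpleGraph.is3Clique_triple_iff.2 ⟨hab, hac, hbc⟩)
  have col : ∃ φ : V → Fin 3, ∀ a b, G.Adj a b → φ a ≠ φ b := by
    by_contra hc
    exact exCrit G tri (c5_of tri h5) h2 hc
  obtain ⟨φ, hφ⟩ := col
  have : G.Colorable 3 := ⟨SimpleGraph.Coloring.mk φ (fun {a b} hab => hφ a b hab)⟩
  exact_mod_cast this.chromaticNumber_le
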